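/- ∫₀^∞ [I₀(t)]²[K₀(t)]⁴ t dt = (π²/10)·₄F₃(1/3,1/2,1/2,2/3; 5/6,1,7/6 | 1), and moreover this quantity also equals (3π^{3/2}/20)·[ (√3/64)·(Γ(1/3)/√π)⁹·₄F₃(1/6,1/3,1/3,1/2; 2/3,5/6,5/6 | 1) + (16/3)·(√π/Γ(1/3))⁹·₄F₃(1/2,2/3,2/3,5/6; 7/6,7/6,4/3 | 1) ]. -/

import Mathlib

open Real MeasureTheory Set

/-- Modified Bessel function `I₀(t) = (1/π)∫₀^π exp(t cos θ) dθ`. -/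
noncomputable def I0 (t : ℝ) : ℝ := (1 / π) * ∫ θ in (0:ℝ)..π, exp (t * cos θ)

/-- Modified Bessel function `K₀(t) = ∫₀^∞ exp(−t cosh u) du`. -/
noncomputable def K0 (t : ℝ) : ℝ := ∫ u in Ioi (0:ℝ), exp (-(t * cosh u))

/-- Rising factorial `(a)ₙ = a(a+1)⋯(a+n−1)`. -/
noncomputable def ris (a : ℝ) (n : ℕ) : ℝ := ∏ k ∈ Finset.range n, (a + k)

/-- Generalized hypergeometric series `ₚF_q(a; b | x)`. -/
noncomputable def pFq (a b : List ℝ) (x : ℝ) : ℝ :=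
  ∑' n : ℕ, ((a.map fun p => ris p n).prod / (b.map fun q => ris q n).prod) * x ^ n
    / (n.factorial : ℝ)

noncomputable def bC (z : ℂ) : ℂ := Complex.Gamma (z + 1/2) / Complex.Gamma (z + 1)

noncomputable def bR (x : ℝ) : ℝ := Real.Gamma (x + 1/2) / Real.Gamma (x + 1)

lemma bC_eq_beta (z : ℂ) (hz : -(1/2) < z.re) :
    bC z = Complex.betaIntegral (z + 1/2) (1/2) / Complex.Gamma (1/2) := by
  have h := Complex.Gamma_mul_Gamma_eq_betaIntegral (s := z + 1/2) (t := 1/2)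
    (by simp; linarith) (by simp)
  have e : z + 1/2 + 1/2 = z + 1 := by ring
  rw [e] at h
  have h1 : Complex.Gamma (z + 1) ≠ 0 := Complex.Gamma_ne_zero_of_re_pos (by simp; linarith)
  have h2 : Complex.Gamma (1/2) ≠ 0 := Complex.Gamma_ne_zero_of_re_pos (by simp)
  rw [bC, div_eq_div_iff h1 h2, h, mul_comm]

lemma bC_ofReal (x : ℝ) : bC (x : ℂ) = (bR x : ℂ) := by
  unfold bC bR
  push_cast
  rw [← Complex.Gamma_ofReal, ← Complex.Gamma_ofReal]
  push_cast; rfl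

lemma norm_beta_le (z : ℂ) (x : ℝ) (hx : -(1/2) < x) (hz : x ≤ z.re) :
    ‖Complex.betaIntegral (z + 1/2) (1/2)‖ ≤ ‖Complex.betaIntegral ((x:ℂ) + 1/2) (1/2)‖ := by
  set g : ℝ → ℝ := fun t => t ^ (x - 1/2) * (1 - t) ^ (-(1/2) : ℝ) with hg
  have hgx : ∀ t ∈ Ioo (0:ℝ) 1, (t : ℂ) ^ ((x:ℂ) + 1/2 - 1) * (1 - (t : ℂ)) ^ ((1/2:ℂ) - 1) = (g t : ℂ) := by
    intro t ht
    have h1 : (0:ℝ) ≤ 1 - t := by linarith [ht.2]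
    rw [hg]; push_cast
    rw [Complex.ofReal_cpow ht.1.le, Complex.ofReal_cpow h1]
    push_cast
    congr 2 <;> ring
  have hgz : ∀ t ∈ Ioo (0:ℝ) 1, ‖(t : ℂ) ^ (z + 1/2 - 1) * (1 - (t : ℂ)) ^ ((1/2:ℂ) - 1)‖ ≤ g t := by
    intro t ht
    have h1 : (0:ℝ) < 1 - t := by linarith [ht.2]
    have e : (1 - (t:ℂ)) = ((1 - t : ℝ) : ℂ) := by push_cast; ring
    rw [norm_mul, e, Complex.norm_cpow_eq_rpow_re_of_pos ht.1, Complex.norm_cpow_eq_rpow_re_of_pos h1]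
    simp only [hg]
    have e2 : ((1/2:ℂ) - 1).re = -(1/2) := by norm_num
    rw [e2]
    refine mul_le_mul_of_nonneg_right ?_ (rpow_nonneg h1.le _)
    apply rpow_le_rpow_of_exponent_ge ht.1 ht.2.le
    simp; linarith
  have hconv := Complex.betaIntegral_convergent (u := (x:ℂ)+1/2) (v := 1/2) (by simp; linarith) (by simp)
  have hint : IntervalIntegrable g volume 0 1 := by
    have := hconv.norm
    rw [intervalIntegrable_iff_integrableOn_Ioo_of_le zero_le_one] at this ⊢
    refine this.congr_fun (fun t ht => ?_) measurableSet_Ioo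
    simp only
    rw [hgx t ht, Complex.norm_real, norm_of_nonneg]
    exact mul_nonneg (rpow_nonneg ht.1.le _) (rpow_nonneg (by linarith [ht.2]) _)
  have e1 : Complex.betaIntegral ((x:ℂ) + 1/2) (1/2) = ((∫ t in (0:ℝ)..1, g t : ℝ) : ℂ) := by
    rw [Complex.betaIntegral, ← intervalIntegral.integral_ofReal]
    rw [intervalIntegral.integral_of_le zero_le_one, intervalIntegral.integral_of_le zero_le_one,
      integral_Ioc_eq_integral_Ioo, integral_Ioc_eq_integral_Ioo]
    exact setIntegral_congr_fun measurableSet_Ioo hgx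
  rw [e1, Complex.norm_real]
  refine le_trans ?_ (le_abs_self _)
  rw [Complex.betaIntegral]
  rw [intervalIntegral.integral_of_le zero_le_one, intervalIntegral.integral_of_le zero_le_one,
      integral_Ioc_eq_integral_Ioo, integral_Ioc_eq_integral_Ioo]
  rw [intervalIntegrable_iff_integrableOn_Ioo_of_le zero_le_one] at hint
  exact norm_integral_le_of_norm_le hint (by
    filter_upwards [ae_restrict_mem measurableSet_Ioo] with t ht using hgz t ht)

lemma norm_bC_le (z : ℂ) (x : ℝ) (hx : -(1/2) < x) (hz : x ≤ z.re) : ‖bC z‖ ≤ bR x := by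
  have h0 : 0 ≤ bR x := by
    unfold bR
    exact div_nonneg (Real.Gamma_pos_of_pos (by linarith)).le (Real.Gamma_pos_of_pos (by linarith)).le
  have : ‖bC (x:ℂ)‖ = bR x := by rw [bC_ofReal, Complex.norm_real, norm_of_nonneg h0]
  rw [← this, bC_eq_beta z (by linarith), bC_eq_beta x (by simpa using hx), norm_div, norm_div]
  gcongr
  exact norm_beta_le z x hx hz

lemma bR_sq_le (x : ℝ) (hx : 0 < x) : (bR x)^2 ≤ 1/x := by
  have h := Real.Gamma_mul_add_mul_le_rpow_Gamma_mul_rpow_Gamma (s := x) (t := x+1) (a := 1/2) (b := 1/2)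
    hx (by linarith) (by norm_num) (by norm_num) (by norm_num)
  have e : 1/2 * x + 1/2 * (x+1) = x + 1/2 := by ring
  rw [e] at h
  have g0 := Real.Gamma_pos_of_pos hx
  have g1 := Real.Gamma_pos_of_pos (show 0 < x+1 by linarith)
  have gh := Real.Gamma_pos_of_pos (show 0 < x+1/2 by linarith)
  rw [← sqrt_eq_rpow, ← sqrt_eq_rpow, ← Real.sqrt_mul g0.le] at h
  have h2 : Real.Gamma (x+1/2)^2 ≤ Real.Gamma x * Real.Gamma (x+1) := by
    calc _ ≤ (√(Real.Gamma x * Real.Gamma (x+1)))^2 := by gcongr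
      _ = _ := Real.sq_sqrt (by positivity)
  have h3 : Real.Gamma (x+1) = x * Real.Gamma x := Real.Gamma_add_one hx.ne'
  rw [bR, div_pow, div_le_div_iff₀ (by positivity) hx]
  nlinarith

lemma norm_bC_sq_le (z : ℂ) (hz : 0 < z.re) : ‖bC z‖^2 ≤ 1/z.re :=
  le_trans (by gcongr; exact norm_bC_le z z.re (by linarith) le_rfl) (bR_sq_le _ hz)

noncomputable def LC (z : ℂ) : ℂ := bC z ^ 3 * bC (3 * z + 1/2)

lemma norm_LC_le (z : ℂ) (hz : 0 < z.re) : ‖LC z‖ ≤ 1/z.re^2 := by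
  have h1 := norm_bC_sq_le z hz
  have h2 := norm_bC_sq_le (3*z+1/2) (by simp; linarith)
  have h3 : ‖bC (3*z+1/2)‖^2 ≤ 1/z.re := h2.trans (by
    apply one_div_le_one_div_of_le hz; simp; linarith)
  rw [LC, norm_mul, norm_pow]
  have e : 1/z.re^2 = (1/z.re) * (1/z.re) := by field_simp
  rw [e]
  have h4 : ‖bC z‖ * ‖bC (3*z+1/2)‖ ≤ 1/z.re := by nlinarith [sq_nonneg (‖bC z‖ - ‖bC (3*z+1/2)‖)]
  calc ‖bC z‖^3 * ‖bC (3*z+1/2)‖ = ‖bC z‖^2 * (‖bC z‖ * ‖bC (3*z+1/2)‖) := by ring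
    _ ≤ _ := by gcongr

lemma norm_LC_le' (z : ℂ) (hz : -(1/4) ≤ z.re) : ‖LC z‖ ≤ bR (-(1/4))^4 := by
  have h1 := norm_bC_le z (-(1/4)) (by norm_num) hz
  have h2 := norm_bC_le (3*z+1/2) (-(1/4)) (by norm_num) (by simp; linarith)
  rw [LC, norm_mul, norm_pow]
  calc _ ≤ bR (-(1/4))^3 * bR (-(1/4)) := by have := (norm_nonneg _).trans h1; gcongr
    _ = _ := by ring

lemma bC_diff (z : ℂ) (hz : -(1/2) < z.re) : DifferentiableAt ℂ bC z := by
  unfold bC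
  have h1 : DifferentiableAt ℂ Complex.Gamma (z + 1/2) := by
    apply Complex.differentiableAt_Gamma
    intro m h
    have := congrArg Complex.re h
    simp at this
    have : (0:ℝ) ≤ m := Nat.cast_nonneg m
    linarith
  have h2 : DifferentiableAt ℂ Complex.Gamma (z + 1) := by
    apply Complex.differentiableAt_Gamma
    intro m h
    have := congrArg Complex.re h
    simp at this
    have : (0:ℝ) ≤ m := Nat.cast_nonneg m
    linarith
  have h3 : Complex.Gamma (z+1) ≠ 0 := Complex.Gamma_ne_zero_of_re_pos (by simp; linarith)
  refine DifferentiableAt.div ?_ ?_ h3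
  · exact h1.comp z (by fun_prop)
  · exact h2.comp z (by fun_prop)

lemma LC_diff (z : ℂ) (hz : -(1/3) < z.re) : DifferentiableAt ℂ LC z := by
  unfold LC
  refine ((bC_diff z (by linarith)).pow 3).mul ?_
  have h : DifferentiableAt ℂ bC (3*z+1/2) := bC_diff (3*z+1/2) (by simp; linarith)
  exact DifferentiableAt.comp (f := fun z : ℂ => 3*z+1/2) z h (by fun_prop)

lemma bC_refl (z : ℂ) (hs : Complex.sin (π * z) ≠ 0) (hc : Complex.cos (π * z) ≠ 0) :
    Complex.sin (π * z) * bC (-(1/2) - z) = - Complex.cos (π * z) * bC z := by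
  have e1 := Complex.Gamma_mul_Gamma_one_sub (-z)
  have e2 := Complex.Gamma_mul_Gamma_one_sub (1/2 - z)
  have e3 : (π:ℂ) * (1/2 - z) = π/2 - π * z := by ring
  rw [e3, Complex.sin_pi_div_two_sub] at e2
  rw [show (π:ℂ) * -z = -(π*z) by ring, Complex.sin_neg] at e1
  have e4 : (1:ℂ) - (1/2 - z) = z + 1/2 := by ring
  have e5 : (1:ℂ) - -z = z + 1 := by ring
  rw [e4] at e2; rw [e5] at e1
  have hpi : (π:ℂ) ≠ 0 := by exact_mod_cast Real.pi_ne_zero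
  have h1 : Complex.Gamma (z+1) ≠ 0 := by
    intro h; rw [h, mul_zero] at e1
    have := div_ne_zero hpi (neg_ne_zero.mpr hs); exact this e1.symm
  have h2 : Complex.Gamma (1/2 - z) ≠ 0 := by
    intro h; rw [h, zero_mul] at e2
    exact div_ne_zero hpi hc e2.symm
  unfold bC
  rw [show -(1/2:ℂ) - z + 1/2 = -z by ring, show -(1/2:ℂ) - z + 1 = 1/2 - z by ring]
  rw [eq_div_iff (neg_ne_zero.mpr hs)] at e1
  rw [eq_div_iff hc] at e2
  rw [← mul_div_assoc, ← mul_div_assoc, div_eq_div_iff h2 h1]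
  linear_combination (-1) * e1 + e2

lemma LC_refl (z : ℂ) (hs : Complex.sin (π * z) ≠ 0) (hc : Complex.cos (π * z) ≠ 0)
    (hs3 : Complex.sin (π * (3*z)) ≠ 0) (hc3 : Complex.cos (π * (3*z)) ≠ 0) :
    Complex.sin (π * z)^2 * (Complex.sin (π * z)^2 - 1/4) * LC (-(1/2) - z)
      = (1 - Complex.sin (π * z)^2) * (3/4 - Complex.sin (π * z)^2) * LC z := by
  have h1 := bC_refl z hs hc
  have aux1 : (π:ℂ) * (3*z+1/2) = π * (3*z) + π/2 := by ring
  have h2 := bC_refl (3*z+1/2) (by rw [aux1, Complex.sin_add_pi_div_two]; exact hc3)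
    (by rw [aux1, Complex.cos_add_pi_div_two]; exact neg_ne_zero.mpr hs3)
  rw [aux1, Complex.sin_add_pi_div_two, Complex.cos_add_pi_div_two] at h2
  have e3 : (π:ℂ) * (3*z) = 3 * (π*z) := by ring
  rw [e3, Complex.cos_three_mul, Complex.sin_three_mul] at h2
  unfold LC
  rw [show 3 * (-(1/2:ℂ) - z) + 1/2 = -(1/2) - (3*z+1/2) by ring]
  have hsc := Complex.sin_sq_add_cos_sq (π*z)
  set s := Complex.sin (π*z)
  set c := Complex.cos (π*z)
  have hc2 : c^2 = 1 - s^2 := by linear_combination hsc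
  have key : (s * bC (-(1/2)-z))^3 * ((4 * c ^ 3 - 3 * c) * bC (-(1/2) - (3*z+1/2))) =
     (-c * bC z)^3 * (- -(3 * s - 4 * s ^ 3) * bC (3 * z + 1/2)) := by rw [h1, h2]
  apply mul_left_cancel₀ (mul_ne_zero hs hc)
  have k2 : s * c * (s^2 * (4 * c^2 - 3)) * (bC (-(1/2)-z)^3 * bC (-(1/2) - (3*z+1/2)))
      = - (s * c * (c^2 * (3 - 4 * s^2))) * (bC z ^3 * bC (3*z+1/2)) := by
    linear_combination key
  rw [hc2] at k2
  linear_combination (-1/4) * k2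

noncomputable def TC (θ : ℂ) : ℂ := ∑' n : ℕ, LC (θ + (n + 1))
noncomputable def LamC (θ : ℂ) : ℂ := LC θ + TC θ

lemma sum_bd : Summable (fun n : ℕ => 4 / ((n:ℝ) + 1)^2) := by
  have h := (summable_nat_add_iff 1).mpr (Real.summable_one_div_nat_pow.mpr (show 1 < 2 by norm_num))
  have := h.mul_left 4
  refine this.congr (fun n => ?_)
  push_cast; ring

lemma term_bd (θ : ℂ) (hθ : -(1/2) < θ.re) (n : ℕ) : ‖LC (θ + (n + 1))‖ ≤ 4 / ((n:ℝ) + 1)^2 := by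
  have hn : (0:ℝ) ≤ n := Nat.cast_nonneg n
  have e : (θ + ((n:ℂ) + 1)).re = θ.re + (n + 1) := by simp
  refine (norm_LC_le _ (by rw [e]; linarith)).trans ?_
  rw [e, div_le_div_iff₀ (by apply pow_pos; linarith) (by positivity)]
  nlinarith

lemma TC_summable (θ : ℂ) (hθ : -(1/2) < θ.re) : Summable (fun n : ℕ => LC (θ + (n + 1))) :=
  Summable.of_norm_bounded sum_bd (term_bd θ hθ)

lemma TC_bd : ∃ M : ℝ, 0 ≤ M ∧ ∀ θ : ℂ, -(1/4) ≤ θ.re → ‖LamC θ‖ ≤ M := by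
  refine ⟨bR (-(1/4))^4 + ∑' n : ℕ, 4 / ((n:ℝ) + 1)^2, ?_, fun θ hθ => ?_⟩
  · have : 0 ≤ ∑' n : ℕ, 4 / ((n:ℝ) + 1)^2 := tsum_nonneg (fun n => by positivity)
    positivity
  · refine (norm_add_le _ _).trans (add_le_add (norm_LC_le' θ hθ) ?_)
    exact tsum_of_norm_bounded sum_bd.hasSum (term_bd θ (by linarith))

lemma TC_eq (θ : ℂ) (hθ : -(1/2) < θ.re) : TC θ = LamC (θ + 1) := by
  unfold LamC TC
  rw [(TC_summable θ hθ).tsum_eq_zero_add]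
  simp only [Nat.cast_zero, zero_add, Nat.cast_add, Nat.cast_one]
  congr 1
  apply tsum_congr; intro n; congr 1; ring

lemma TC_diff : DifferentiableOn ℂ TC {θ : ℂ | -(1/3) < θ.re} := by
  have hU : IsOpen {θ : ℂ | -(1/3) < θ.re} := isOpen_lt continuous_const Complex.continuous_re
  refine Complex.differentiableOn_tsum_of_summable_norm sum_bd (fun n => ?_) hU
    (fun n w hw => term_bd w (by simp at hw; linarith) n)
  intro z hz
  have hn : (0:ℝ) ≤ n := Nat.cast_nonneg n
  have h : DifferentiableAt ℂ LC (z + (n+1)) := LC_diff _ (by simp at hz ⊢; linarith)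
  exact (DifferentiableAt.comp (f := fun z : ℂ => z + (n+1)) z h (by fun_prop)).differentiableWithinAt

lemma LamC_diff (z : ℂ) (hz : -(1/3) < z.re) : DifferentiableAt ℂ LamC z := by
  have hU : IsOpen {θ : ℂ | -(1/3) < θ.re} := isOpen_lt continuous_const Complex.continuous_re
  exact (LC_diff z hz).add ((TC_diff z hz).differentiableAt (hU.mem_nhds hz))

lemma bC_step (z : ℂ) (hz : 0 ≤ z.re) : ‖bC (z+1)‖ ≤ ‖bC z‖ := by
  have h1 : z + 1/2 ≠ 0 := by
    intro h; have := congrArg Complex.re h; simp at this; linarith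
  have h2 : z + 1 ≠ 0 := by
    intro h; have := congrArg Complex.re h; simp at this; linarith
  have e : bC (z+1) = (z+1/2)/(z+1) * bC z := by
    unfold bC
    rw [show z + 1 + 1/2 = (z+1/2) + 1 by ring, Complex.Gamma_add_one _ h1, Complex.Gamma_add_one _ h2]
    rw [div_mul_div_comm]
  rw [e, norm_mul, norm_div]
  have h3 : ‖z+1/2‖ ≤ ‖z+1‖ := by
    rw [← sq_le_sq₀ (norm_nonneg _) (norm_nonneg _), ← Complex.normSq_eq_norm_sq, ← Complex.normSq_eq_norm_sq,
      Complex.normSq_apply, Complex.normSq_apply]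
    simp; nlinarith
  have h4 : 0 < ‖z+1‖ := norm_pos_iff.mpr h2
  have h5 : ‖z+1/2‖/‖z+1‖ ≤ 1 := (div_le_one h4).mpr h3
  nlinarith [norm_nonneg (bC z)]

lemma bC_step_nat (z : ℂ) (hz : 0 ≤ z.re) (n : ℕ) : ‖bC (z+n)‖ ≤ ‖bC z‖ := by
  induction n with
  | zero => simp
  | succ n ih =>
    refine le_trans ?_ ih
    have := bC_step (z+n) (by have : (0:ℝ) ≤ n := Nat.cast_nonneg n
                              simp; linarith)
    rwa [show z + ((n+1:ℕ):ℂ) = z + n + 1 by push_cast; ring]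

lemma bC_I_bd (Y : ℝ) (hY : Y ≠ 0) : ‖bC (Y * Complex.I)‖^2 ≤ 1/|Y| := by
  set z : ℂ := Y * Complex.I with hz
  have hz0 : z ≠ 0 := by simp [hz, hY]
  have hconj : starRingEnd ℂ z = -z := by simp [hz]
  have hb : bC (-z) = starRingEnd ℂ (bC z) := by
    unfold bC
    rw [map_div₀, ← Complex.Gamma_conj, ← Complex.Gamma_conj, map_add, map_add, hconj]
    have h2 : (starRingEnd ℂ) (2:ℂ) = 2 := Complex.conj_ofNat 2
    simp [h2]
  have h1 : ‖bC z‖^2 = ‖bC z * bC (-z)‖ := by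
    rw [norm_mul, hb, RCLike.norm_conj, sq]
  have e1 := Complex.Gamma_mul_Gamma_one_sub z
  have e2 := Complex.Gamma_mul_Gamma_one_sub (z+1/2)
  rw [show (1:ℂ) - (z+1/2) = -z + 1/2 by ring, show (π:ℂ) * (z+1/2) = π * z + π/2 by ring,
    Complex.sin_add_pi_div_two] at e2
  have e3 := Complex.Gamma_add_one z hz0
  have e4 : bC z * bC (-z) = Complex.sin (π*z) / (Complex.cos (π*z) * z) := by
    unfold bC
    rw [div_mul_div_comm, e2, e3, show -z + 1 = 1 - z by ring, mul_assoc, e1]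
    have hpi : (π:ℂ) ≠ 0 := by exact_mod_cast Real.pi_ne_zero
    by_cases hs : Complex.sin (π*z) = 0
    · simp [hs]
    by_cases hc : Complex.cos (π*z) = 0
    · simp [hc]
    field_simp
  rw [h1, e4, norm_div, norm_mul]
  have hπz : (π:ℂ) * z = ((π * Y : ℝ) : ℂ) * Complex.I := by rw [hz]; push_cast; ring
  have hnz : ‖z‖ = |Y| := by simp [hz]
  rw [hπz, Complex.sin_mul_I, Complex.cos_mul_I, norm_mul, Complex.norm_I, mul_one, ← Complex.ofReal_sinh,
    ← Complex.ofReal_cosh, Complex.norm_real, Complex.norm_real, hnz]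
  have hc : 0 < cosh (π*Y) := cosh_pos _
  have hY' : 0 < |Y| := abs_pos.mpr hY
  rw [norm_of_nonneg hc.le, Real.norm_eq_abs, div_le_div_iff₀ (by positivity) hY']
  have : |sinh (π*Y)| ≤ cosh (π*Y) := by
    rw [abs_le]
    constructor
    · have := Real.cosh_add_sinh (π*Y); have := exp_pos (π*Y); linarith
    · exact (Real.sinh_lt_cosh _).le
  nlinarith

open Filter Topology in
lemma bC_I_tendsto (c : ℝ) (hc : c ≠ 0) : Tendsto (fun Y : ℝ => ‖bC ((c * Y : ℝ) * Complex.I)‖) atTop (𝓝 0) := by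
  have h : Tendsto (fun Y : ℝ => ‖bC ((c * Y : ℝ) * Complex.I)‖^2) atTop (𝓝 0) := by
    have h1 : Tendsto (fun Y : ℝ => 1/|c * Y|) atTop (𝓝 0) := by
      have : Tendsto (fun Y : ℝ => |c * Y|) atTop atTop := by
        simp_rw [abs_mul]
        exact (tendsto_abs_atTop_atTop).const_mul_atTop (abs_pos.mpr hc)
      refine this.inv_tendsto_atTop.congr (fun Y => ?_)
      simp only [Pi.inv_apply, one_div]
    refine squeeze_zero' (Eventually.of_forall fun Y => by positivity) ?_ h1
    filter_upwards [eventually_gt_atTop 0] with Y hY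
    exact bC_I_bd _ (mul_ne_zero hc hY.ne')
  have h2 := (Real.continuous_sqrt.tendsto 0).comp h
  simp only [Real.sqrt_zero] at h2
  refine h2.congr (fun Y => ?_)
  simp [Real.sqrt_sq (norm_nonneg _)]

open Filter Topology in
lemma LamC_tendsto (θ : ℝ → ℂ) (hre : ∀ Y, 0 ≤ (θ Y).re)
    (g : ℝ → ℝ) (hg : Tendsto g atTop (𝓝 0))
    (h : ∀ Y (n : ℕ), ‖LC (θ Y + n)‖ ≤ g Y) : Tendsto (fun Y => LamC (θ Y)) atTop (𝓝 0) := by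
  unfold LamC
  have h1 : Tendsto (fun Y => LC (θ Y)) atTop (𝓝 0) := by
    refine squeeze_zero_norm (fun Y => ?_) hg
    simpa using h Y 0
  have h2 : Tendsto (fun Y => TC (θ Y)) atTop (𝓝 (∑' n : ℕ, (0:ℂ))) := by
    unfold TC
    refine tendsto_tsum_of_dominated_convergence sum_bd (fun n => ?_)
      (Eventually.of_forall fun Y n => term_bd _ (by linarith [hre Y]) n)
    refine squeeze_zero_norm (fun Y => ?_) hg
    simpa using h Y (n+1)
  simpa using h1.add h2

open Filter Topology in
lemma LamC_tendsto_I (c : ℝ) (hc : c ≠ 0) : Tendsto (fun Y : ℝ => LamC ((c * Y : ℝ) * Complex.I)) atTop (𝓝 0) := by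
  refine LamC_tendsto _ (fun Y => by simp) (fun Y => ‖bC ((c * Y : ℝ) * Complex.I)‖^3 * bR (-(1/4))) ?_ ?_
  · simpa using ((bC_I_tendsto c hc).pow 3).mul_const (bR (-(1/4)))
  · intro Y n
    have hn : (0:ℝ) ≤ n := Nat.cast_nonneg n
    have h1 := bC_step_nat ((c * Y : ℝ) * Complex.I) (by simp) n
    have h2 := norm_bC_le (3*((c * Y : ℝ) * Complex.I + n)+1/2) (-(1/4)) (by norm_num) (by simp; linarith)
    rw [LC, norm_mul, norm_pow]
    gcongr

open Filter Topology in
lemma LamC_tendsto_half (c : ℝ) (hc : c ≠ 0) : Tendsto (fun Y : ℝ => LamC (1/2 + (c * Y : ℝ) * Complex.I)) atTop (𝓝 0) := by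
  refine LamC_tendsto _ (fun Y => by simp) (fun Y => bR (-(1/4))^3 * ‖bC (((3*c) * Y : ℝ) * Complex.I)‖) ?_ ?_
  · simpa using (bC_I_tendsto (3*c) (by simpa using hc)).const_mul (bR (-(1/4))^3)
  · intro Y n
    have hn : (0:ℝ) ≤ n := Nat.cast_nonneg n
    have h1 := bC_step_nat (((3*c) * Y : ℝ) * Complex.I) (by simp) (3*n+2)
    have h2 := norm_bC_le (1/2 + (c * Y : ℝ) * Complex.I + n) (-(1/4)) (by norm_num) (by simp; linarith)
    rw [LC, norm_mul, norm_pow]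
    rw [show 3 * (1/2 + ((c * Y : ℝ):ℂ) * Complex.I + n) + 1/2 = ((3*c) * Y : ℝ) * Complex.I + ((3*n+2 : ℕ):ℂ) by push_cast; ring]
    have := (norm_nonneg _).trans h2
    gcongr

noncomputable def EC (θ : ℂ) : ℂ :=
  (1 - Complex.sin (π * θ)^2) * (3/4 - Complex.sin (π * θ)^2) * (LamC θ + LamC (-θ))
  + Complex.sin (π * θ)^2 * (Complex.sin (π * θ)^2 - 1/4) * (LamC (1/2 - θ) + LamC (1/2 + θ))

def US : Set ℂ := {z | -(1/3) < z.re ∧ z.re < 1/3}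

lemma US_open : IsOpen US :=
  (isOpen_lt continuous_const Complex.continuous_re).inter (isOpen_lt Complex.continuous_re continuous_const)

lemma EC_diff : DifferentiableOn ℂ EC US := by
  intro z hz
  obtain ⟨h1, h2⟩ := hz
  have a1 : DifferentiableAt ℂ LamC z := LamC_diff z h1
  have a2 : DifferentiableAt ℂ (fun z => LamC (-z)) z :=
    DifferentiableAt.comp (f := fun z : ℂ => -z) z (LamC_diff (-z) (by simp; linarith)) (by fun_prop)
  have a3 : DifferentiableAt ℂ (fun z => LamC (1/2-z)) z :=
    DifferentiableAt.comp (f := fun z : ℂ => 1/2-z) z (LamC_diff (1/2-z) (by simp; linarith)) (by fun_prop)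
  have a4 : DifferentiableAt ℂ (fun z => LamC (1/2+z)) z :=
    DifferentiableAt.comp (f := fun z : ℂ => 1/2+z) z (LamC_diff (1/2+z) (by simp; linarith)) (by fun_prop)
  have s1 : DifferentiableAt ℂ (fun z : ℂ => Complex.sin (π * z)^2) z := by fun_prop
  exact ((((s1.const_sub 1).mul (s1.const_sub (3/4))).mul (a1.add a2)).add
    ((s1.mul (s1.sub_const (1/4))).mul (a3.add a4))).differentiableWithinAt

lemma EC_even (z : ℂ) : EC (-z) = EC z := by
  unfold EC
  rw [show (π:ℂ) * -z = -(π*z) by ring, Complex.sin_neg, neg_sq, neg_neg, sub_neg_eq_add, ← sub_eq_add_neg]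
  ring

lemma sin_cos_ne (x : ℂ) (k : ℤ) (h1 : k < 2 * x.re) (h2 : 2 * x.re < k+1) :
    Complex.sin (π * x) ≠ 0 ∧ Complex.cos (π * x) ≠ 0 := by
  have hpi : (π:ℂ) ≠ 0 := by exact_mod_cast Real.pi_ne_zero
  constructor
  · intro h
    rw [Complex.sin_eq_zero_iff] at h
    obtain ⟨m, hm⟩ := h
    have e : x = m := mul_left_cancel₀ hpi (by rw [hm]; ring)
    rw [e] at h1 h2; simp at h1 h2
    norm_cast at h1 h2; omega
  · intro h
    rw [Complex.cos_eq_zero_iff] at h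
    obtain ⟨m, hm⟩ := h
    have e : x = ((2*m+1 : ℝ)/2 : ℝ) := by
      apply mul_left_cancel₀ hpi; rw [hm]; push_cast; ring
    rw [e] at h1 h2; rw [Complex.ofReal_re] at h1 h2
    have h1' : (k:ℝ) < 2*m+1 := by linarith
    have h2' : (2:ℝ)*m+1 < k+1 := by linarith
    norm_cast at h1' h2'; omega

lemma EC_per (z : ℂ) (h1 : -(1/3) < z.re) (h2 : z.re < -(1/6)) : EC (z + 1/2) = EC z := by
  have a := sin_cos_ne z (-1) (by push_cast; linarith) (by push_cast; linarith)
  have b := sin_cos_ne (3*z) (-2) (by simp; linarith) (by simp; linarith)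
  have r := LC_refl z a.1 a.2 b.1 b.2
  have t1 : LamC (1/2 + (z + 1/2)) = TC z := by
    rw [TC_eq z (by linarith)]; congr 1; ring
  have t2 : LamC (-(z+1/2)) = LC (-(1/2) - z) + LamC (1/2 - z) := by
    rw [LamC, TC_eq _ (by simp; linarith)]
    congr 2 <;> ring
  have hsc := Complex.sin_sq_add_cos_sq (π * z)
  unfold EC
  rw [t1, t2, show (π:ℂ) * (z+1/2) = π * z + π/2 by ring, Complex.sin_add_pi_div_two,
   show (1/2:ℂ) - (z+1/2) = -z by ring, show z + 1/2 = 1/2 + z by ring]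
  have hc2 : Complex.cos (π*z)^2 = 1 - Complex.sin (π*z)^2 := by linear_combination hsc
  have t3 : LamC z = LC z + TC z := rfl
  rw [hc2, t3]
  linear_combination r

noncomputable def sD : ℂ → ℂ := dslope (fun z : ℂ => Complex.sin (2 * π * z)) 0
noncomputable def eD : ℂ → ℂ := dslope (dslope EC 0) 0
noncomputable def qC (z : ℂ) : ℂ := eD z / sD z ^ 2

lemma US_nhds : US ∈ nhds (0:ℂ) := US_open.mem_nhds (by constructor <;> simp)

lemma qC_eq (z : ℂ) (hz : z ≠ 0) : qC z = (EC z - EC 0) / Complex.sin (2*π*z)^2 := by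
  have d0 : dslope EC 0 0 = 0 := by
    rw [dslope_same]
    have hd : DifferentiableAt ℂ EC 0 := EC_diff.differentiableAt US_nhds
    have h1 : HasDerivAt (fun z => EC (-z)) (-(deriv EC 0)) 0 := by
      have := (show HasDerivAt EC (deriv EC 0) (-0) by simpa using hd.hasDerivAt)
      have := HasDerivAt.comp (0:ℂ) this (hasDerivAt_neg (0:ℂ))
      rw [mul_neg_one] at this
      exact this
    have h2 : (fun z => EC (-z)) = EC := funext EC_even
    rw [h2] at h1
    have := h1.unique hd.hasDerivAt
    linear_combination (-1/2) * this
  unfold qC eD sD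
  rw [dslope_of_ne _ hz, dslope_of_ne _ hz, slope_def_field, slope_def_field, d0, dslope_of_ne _ hz, slope_def_field]
  simp only [sub_zero, mul_zero, Complex.sin_zero]
  by_cases h : Complex.sin (2*π*z) = 0
  · simp [h]
  field_simp

lemma sD_ne (z : ℂ) (hz : z ∈ US) : sD z ≠ 0 := by
  by_cases h0 : z = 0
  · subst h0
    unfold sD
    rw [dslope_same]
    have : HasDerivAt (fun z : ℂ => Complex.sin (2*π*z)) (Complex.cos (2*π*0) * (2*π*1)) 0 :=
      ((hasDerivAt_id (0:ℂ)).const_mul (2*π:ℂ)).csin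
    rw [this.deriv]
    simp [Real.pi_ne_zero]
  · unfold sD
    rw [dslope_of_ne _ h0, slope_def_field]
    simp only [sub_zero, mul_zero, Complex.sin_zero]
    refine div_ne_zero ?_ h0
    rw [Ne, Complex.sin_eq_zero_iff]
    rintro ⟨m, hm⟩
    have hpi : (π:ℂ) ≠ 0 := by exact_mod_cast Real.pi_ne_zero
    have e : 2 * z = m := mul_left_cancel₀ hpi (by linear_combination hm)
    have e1 := congrArg Complex.re e
    simp at e1
    have m1 : (-1:ℝ) < m := by rw [← e1]; linarith [hz.1]
    have m2 : (m:ℝ) < 1 := by rw [← e1]; linarith [hz.2]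
    have m0 : m = 0 := by
      have : (-1:ℤ) < m := by exact_mod_cast m1
      have : m < (1:ℤ) := by exact_mod_cast m2
      omega
    rw [m0] at e; simp at e; exact h0 e

lemma qC_diff : DifferentiableOn ℂ qC US := by
  have h1 : DifferentiableOn ℂ eD US :=
    (Complex.differentiableOn_dslope US_nhds).mpr ((Complex.differentiableOn_dslope US_nhds).mpr EC_diff)
  have h2 : DifferentiableOn ℂ sD US :=
    (Complex.differentiableOn_dslope US_nhds).mpr (by fun_prop)
  exact h1.div (h2.pow 2) (fun z hz => pow_ne_zero 2 (sD_ne z hz))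

lemma qC_per (z : ℂ) (h1 : -(1/3) < z.re) (h2 : z.re < -(1/6)) : qC (z + 1/2) = qC z := by
  have n1 : z ≠ 0 := by rintro rfl; simp at h2; linarith
  have n2 : z + 1/2 ≠ 0 := by
    intro h; have := congrArg Complex.re h; simp at this; linarith
  rw [qC_eq z n1, qC_eq _ n2, EC_per z h1 h2, show 2 * (π:ℂ) * (z+1/2) = 2 * π * z + π by ring,
    Complex.sin_add_pi, neg_sq]

noncomputable def FC (z : ℂ) : ℂ := qC (z - ((round (2 * z.re) : ℤ) : ℂ) / 2)

lemma FC_loc (m : ℤ) (z : ℂ) (h : z - (m:ℂ)/2 ∈ US) : FC z = qC (z - (m:ℂ)/2) := by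
  unfold FC
  set k := round (2*z.re) with hk
  have hk1 := abs_le.mp (abs_sub_round (2*z.re))
  rw [← hk] at hk1
  have a1 : -(1/3) < z.re - m/2 := by have := h.1; simpa using this
  have a2 : z.re - m/2 < 1/3 := by have := h.2; simpa using this
  have b1 : (k:ℝ) - m < 2 := by linarith [hk1.1, hk1.2]
  have b2 : -2 < (k:ℝ) - m := by linarith [hk1.1, hk1.2]
  have b1' : k - m < 2 := by exact_mod_cast b1
  have b2' : -2 < k - m := by exact_mod_cast b2
  rcases (by omega : k = m ∨ k = m + 1 ∨ k = m - 1) with h0 | h0 | h0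
  · rw [h0]
  · have := qC_per (z - (k:ℂ)/2) (by rw [h0] at hk1 ⊢; push_cast at hk1; simp; linarith) (by rw [h0]; simp; linarith)
    rw [← this, h0]; congr 1; push_cast; ring
  · have := qC_per (z - (m:ℂ)/2) (by simp; linarith) (by rw [h0] at hk1; push_cast at hk1; simp; linarith)
    rw [← this, h0]; congr 1; push_cast; ring

lemma FC_diff : Differentiable ℂ FC := by
  intro z
  set m := round (2*z.re) with hm
  have hk1 := abs_le.mp (abs_sub_round (2*z.re))
  rw [← hm] at hk1
  have hz : z - (m:ℂ)/2 ∈ US := by constructor <;> simp <;> linarith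
  have h1 : DifferentiableAt ℂ (fun z => qC (z - (m:ℂ)/2)) z :=
    DifferentiableAt.comp (f := fun z : ℂ => z - (m:ℂ)/2) z (qC_diff.differentiableAt (US_open.mem_nhds hz)) (by fun_prop)
  refine h1.congr_of_eventuallyEq ?_
  have hc : Continuous (fun z : ℂ => z - (m:ℂ)/2) := by fun_prop
  filter_upwards [(US_open.preimage hc).mem_nhds hz] with w hw
  exact FC_loc m w hw

lemma norm_sin_le (z : ℂ) : ‖Complex.sin z‖ ≤ cosh z.im := by
  rw [Complex.sin]
  have h1 : ‖Complex.exp (-z * Complex.I)‖ = exp z.im := by rw [Complex.norm_exp]; simp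
  have h2 : ‖Complex.exp (z * Complex.I)‖ = exp (-z.im) := by rw [Complex.norm_exp]; simp
  rw [norm_div, norm_mul, Complex.norm_I, mul_one, Complex.norm_ofNat, Real.cosh_eq]
  gcongr
  refine (norm_sub_le _ _).trans ?_
  rw [h1, h2]

lemma norm_sin_sq_ge (z : ℂ) : sinh z.im ^2 ≤ ‖Complex.sin z‖^2 := by
  rw [← Complex.normSq_eq_norm_sq]
  have e : Complex.sin z = Complex.sin (z.re + z.im * Complex.I) := by rw [Complex.re_add_im]
  rw [e, Complex.sin_add_mul_I]
  rw [← Complex.ofReal_sin, ← Complex.ofReal_cos, ← Complex.ofReal_cosh, ← Complex.ofReal_sinh, Complex.normSq_apply]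
  simp only [Complex.add_re, Complex.add_im, Complex.mul_re, Complex.mul_im, Complex.ofReal_re, Complex.ofReal_im,
    Complex.I_re, Complex.I_im, mul_zero, mul_one, sub_zero, zero_mul, add_zero, zero_add]
  have h1 := Real.sin_sq_add_cos_sq z.re
  have h2 := cosh_sq z.im
  have : sin z.re * cosh z.im * (sin z.re * cosh z.im) +
    cos z.re * sinh z.im * (cos z.re * sinh z.im)
     = sin z.re^2 + sinh z.im^2 := by
    linear_combination (sin z.re^2) * h2 + sinh z.im^2 * h1
  rw [this]; nlinarith [sq_nonneg (sin z.re)]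

lemma EC_bd (z : ℂ) (Λ : ℝ) (h : ‖LamC z‖ + ‖LamC (-z)‖ + ‖LamC (1/2-z)‖ + ‖LamC (1/2+z)‖ ≤ Λ) :
    ‖EC z‖ ≤ 4 * cosh (π * z.im)^4 * Λ := by
  have hs : ‖Complex.sin (π*z)^2‖ ≤ cosh (π*z.im)^2 := by
    rw [norm_pow]
    have := norm_sin_le (π*z)
    simp at this
    gcongr
  have hc1 := Real.one_le_cosh (π * z.im)
  set c := cosh (π * z.im)
  set s := Complex.sin (π*z)^2
  have hc2 : 1 ≤ c^2 := by nlinarith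
  have n1 : ‖(1:ℂ) - s‖ ≤ 2*c^2 := (norm_sub_le _ _).trans (by simp; linarith)
  have n2 : ‖(3/4:ℂ) - s‖ ≤ 2*c^2 := (norm_sub_le _ _).trans (by norm_num; linarith)
  have n3 : ‖s - (1/4:ℂ)‖ ≤ 2*c^2 := (norm_sub_le _ _).trans (by norm_num; linarith)
  have A : ‖(1 - s) * (3/4 - s) * (LamC z + LamC (-z))‖ ≤ 2*c^2 * (2*c^2) * (‖LamC z‖ + ‖LamC (-z)‖) := by
    rw [norm_mul, norm_mul]; gcongr; exact norm_add_le _ _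
  have B : ‖s * (s - 1/4) * (LamC (1/2-z) + LamC (1/2+z))‖ ≤ 2*c^2 * (2*c^2) * (‖LamC (1/2-z)‖ + ‖LamC (1/2+z)‖) := by
    rw [norm_mul, norm_mul]; gcongr
    · linarith
    · exact norm_add_le _ _
  unfold EC
  refine (norm_add_le _ _).trans ((add_le_add A B).trans ?_)
  calc _ = 4*c^4 * (‖LamC z‖ + ‖LamC (-z)‖ + ‖LamC (1/2-z)‖ + ‖LamC (1/2+z)‖) := by ring
    _ ≤ _ := by gcongr

lemma qC_bd (z : ℂ) (hz : 1 ≤ |z.im|) (Λ : ℝ) (h : ‖LamC z‖ + ‖LamC (-z)‖ + ‖LamC (1/2-z)‖ + ‖LamC (1/2+z)‖ ≤ Λ) :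
    ‖qC z‖ ≤ 2 * Λ + ‖EC 0‖ / |z.im| := by
  have n1 : z ≠ 0 := by rintro rfl; simp at hz; linarith
  rw [qC_eq z n1, norm_div, norm_pow]
  have hs := norm_sin_sq_ge (2*π*z)
  have e : (2*π*z : ℂ).im = 2*(π*z.im) := by simp; ring
  rw [e, Real.sinh_two_mul] at hs
  have hE := EC_bd z Λ h
  have hΛ : 0 ≤ Λ := le_trans (by positivity) h
  have hc := cosh_sq (π*z.im)
  have hsh : |z.im| ≤ |sinh (π*z.im)| := by
    rw [Real.abs_sinh, abs_mul, abs_of_pos pi_pos]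
    refine le_trans ?_ (Real.self_le_sinh_iff.mpr (by positivity))
    nlinarith [Real.pi_gt_three, abs_nonneg z.im]
  have hsq : z.im^2 ≤ sinh (π*z.im)^2 := sq_le_sq.mpr hsh
  have hz2 : |z.im| ≤ z.im^2 := by rw [← sq_abs]; nlinarith
  set c := cosh (π*z.im)
  set s := sinh (π*z.im)
  have hz0 : 0 < |z.im| := by linarith
  have hs2 : 1 ≤ s^2 := by linarith
  have hX : 0 < (2*s*c)^2 := by nlinarith
  refine (div_le_div_of_nonneg_left (norm_nonneg _) hX hs).trans ?_
  have e1 : ‖EC z - EC 0‖ ≤ 4*c^4*Λ + ‖EC 0‖ := (norm_sub_le _ _).trans (by linarith)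
  rw [div_le_iff₀ hX]
  refine e1.trans ?_
  have f1 : 4*c^4*Λ ≤ 2*Λ*(2*s*c)^2 := by
    have : c^4 ≤ c^2 * (2*s^2) := by nlinarith
    nlinarith
  have f2 : ‖EC 0‖ ≤ ‖EC 0‖/|z.im| * (2*s*c)^2 := by
    rw [div_mul_eq_mul_div, le_div_iff₀ hz0]
    have : |z.im| ≤ (2*s*c)^2 := by nlinarith
    gcongr
  linarith

lemma FC_bounded : Bornology.IsBounded (range FC) := by
  obtain ⟨M, hM0, hM⟩ := TC_bd
  have hK : IsCompact (Icc (-(1/4):ℝ) (1/4) ×ℂ Icc (-1:ℝ) 1) := isCompact_Icc.reProdIm isCompact_Icc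
  obtain ⟨C, hC⟩ := hK.exists_bound_of_continuousOn (f := qC)
    (qC_diff.continuousOn.mono (fun z hz => by
      have := hz.1; simp only [mem_preimage, mem_Icc] at this
      exact ⟨by linarith, by linarith⟩))
  have hq : ∀ z : ℂ, -(1/4) ≤ z.re → z.re ≤ 1/4 → ‖qC z‖ ≤ max C (8*M + ‖EC 0‖) := by
    intro z h1 h2
    by_cases h : |z.im| ≤ 1
    · exact (hC z ⟨⟨h1, h2⟩, abs_le.mp h⟩).trans (le_max_left _ _)
    · push Not at h
      refine (qC_bd z h.le (4*M) ?_).trans (le_trans ?_ (le_max_right _ _))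
      · have a1 := hM z h1
        have a2 := hM (-z) (by simp; linarith)
        have a3 := hM (1/2-z) (by simp; linarith)
        have a4 := hM (1/2+z) (by simp; linarith)
        linarith
      · have : ‖EC 0‖ / |z.im| ≤ ‖EC 0‖ := div_le_self (norm_nonneg _) h.le
        linarith
  rw [isBounded_iff_forall_norm_le]
  refine ⟨max C (8*M + ‖EC 0‖), ?_⟩
  rintro _ ⟨z, rfl⟩
  have hk1 := abs_le.mp (abs_sub_round (2*z.re))
  apply hq <;> simp <;> linarith

open Filter Topology in
lemma EC_sixth : EC (1/6) = EC 0 := by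
  have hconst : ∀ Y : ℝ, qC (Y * Complex.I) = qC (1/6) := by
    intro Y
    have h := FC_diff.apply_eq_apply_of_bounded FC_bounded (Y * Complex.I) (1/6)
    rw [FC_loc 0 _ (by constructor <;> norm_num), FC_loc 0 _ (by constructor <;> norm_num)] at h
    simpa using h
  have hz : Tendsto (fun Y : ℝ => qC (Y * Complex.I)) atTop (𝓝 0) := by
    have t1 := (LamC_tendsto_I 1 (by norm_num)).norm
    have t2 := (LamC_tendsto_I (-1) (by norm_num)).norm
    have t3 := (LamC_tendsto_half (-1) (by norm_num)).norm
    have t4 := (LamC_tendsto_half 1 (by norm_num)).norm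
    have t5 : Tendsto (fun Y : ℝ => ‖EC 0‖ / |Y|) atTop (𝓝 0) := tendsto_abs_atTop_atTop.const_div_atTop _
    have T := ((((t1.add t2).add t3).add t4).const_mul 2).add t5
    simp only [norm_zero, add_zero, mul_zero] at T
    refine squeeze_zero_norm' ?_ T
    filter_upwards [eventually_ge_atTop 1] with Y hY
    have := qC_bd (Y * Complex.I) (by simp; exact le_trans hY (le_abs_self Y)) _ le_rfl
    refine this.trans (le_of_eq ?_)
    simp [sub_eq_add_neg]
  have h0 : qC (1/6) = 0 := by
    have : Tendsto (fun Y : ℝ => qC (Y * Complex.I)) atTop (𝓝 (qC (1/6))) := by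
      simp_rw [hconst]; exact tendsto_const_nhds
    exact tendsto_nhds_unique this hz
  rw [qC_eq _ (by norm_num)] at h0
  have hs : Complex.sin (2 * π * (1/6)) ≠ 0 := by
    have : (2 * (π:ℂ) * (1/6)) = ((π/3 : ℝ) : ℂ) := by push_cast; ring
    rw [this, ← Complex.ofReal_sin]
    norm_cast
    exact (Real.sin_pos_of_pos_of_lt_pi (by positivity) (by linarith [pi_pos])).ne'
  rcases div_eq_zero_iff.mp h0 with h | h
  · linear_combination h
  · exact absurd h (pow_ne_zero 2 hs)

lemma LamC_three : 4 * LamC 0 = LamC (1/6) + LamC (-(1/6)) := by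
  have h := EC_sixth
  unfold EC at h
  have hs : Complex.sin (π * (1/6)) = 1/2 := by
    have : ((π:ℂ) * (1/6)) = ((π/6 : ℝ) : ℂ) := by push_cast; ring
    rw [this, ← Complex.ofReal_sin, Real.sin_pi_div_six]; push_cast; ring
  rw [hs] at h
  norm_num at h
  norm_num
  linear_combination (-8/3) * h

noncomputable def LR (x : ℝ) : ℝ := bR x ^ 3 * bR (3 * x + 1/2)

lemma LC_ofReal (x : ℝ) : LC (x : ℂ) = (LR x : ℂ) := by
  unfold LC LR
  rw [bC_ofReal, show 3 * (x:ℂ) + 1/2 = ((3*x+1/2 : ℝ):ℂ) by push_cast; ring, bC_ofReal]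
  push_cast; ring

lemma bR_step (x : ℝ) (hx : -(1/2) < x) : bR (x+1) = (x+1/2)/(x+1) * bR x := by
  unfold bR
  rw [show x + 1 + 1/2 = (x+1/2) + 1 by ring, Real.Gamma_add_one (by linarith), Real.Gamma_add_one (by linarith)]
  rw [div_mul_div_comm]

lemma LR_step (x : ℝ) (hx : -(1/3) < x) :
    LR (x+1) = LR x * ((x+1/2)^2*(x+1/3)*(x+2/3)/((x+1)^2*(x+5/6)*(x+7/6))) := by
  unfold LR
  rw [show 3*(x+1)+1/2 = 3*x+1/2+1+1+1 by ring, bR_step x (by linarith), bR_step (3*x+1/2+1+1) (by linarith),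
    bR_step (3*x+1/2+1) (by linarith), bR_step (3*x+1/2) (by linarith)]
  have h1 : x + 1 ≠ 0 := by linarith
  have h2 : x + 5/6 ≠ 0 := by linarith
  have h3 : x + 7/6 ≠ 0 := by linarith
  have e1 : 3*x+1/2+1 = 3*(x+1/2) := by ring
  have e2 : 3*x+1/2+1+1 = 3*(x+5/6) := by ring
  have e3 : 3*x+1/2+1+1+1 = 3*(x+7/6) := by ring
  rw [e3, e2, e1]
  have h4 : x + 1/2 ≠ 0 := by linarith
  rw [show 3 * (x + 1 / 2) + 1 / 2 = 3*(x+2/3) by ring, show 3 * (x + 5 / 6) + 1 / 2 = 3*(x+1) by ring,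
    show 3*x+1/2+1/2 = 3*(x+1/3) by ring]
  have g5 : 3*(x+5/6) ≠ 0 := by simpa using h2
  field_simp

lemma ris_succ (a : ℝ) (n : ℕ) : ris a (n+1) = ris a n * (a + n) := by
  unfold ris; rw [Finset.prod_range_succ]

lemma ris_zero (a : ℝ) : ris a 0 = 1 := by simp [ris]

lemma ris_pos (a : ℝ) (ha : 0 < a) (n : ℕ) : 0 < ris a n := by
  unfold ris; apply Finset.prod_pos; intro i _; positivity

lemma LR_nat (θ : ℝ) (h : -(1/3) < θ) (n : ℕ) : LR (θ + n) = LR θ *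
    (ris (θ+1/3) n * ris (θ+1/2) n^2 * ris (θ+2/3) n / (ris (θ+5/6) n * ris (θ+1) n^2 * ris (θ+7/6) n)) := by
  induction n with
  | zero => simp [ris_zero]
  | succ n ih =>
    have hn : (0:ℝ) ≤ n := Nat.cast_nonneg n
    rw [show θ + ((n+1:ℕ):ℝ) = θ + n + 1 by push_cast; ring, LR_step _ (by linarith), ih]
    simp only [ris_succ]
    have := ris_pos (θ+5/6) (by linarith) n
    have := ris_pos (θ+1) (by linarith) n
    have := ris_pos (θ+7/6) (by linarith) n
    have : θ + n + 1 ≠ 0 := by linarith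
    have : θ + n + 5/6 ≠ 0 := by linarith
    have : θ + n + 7/6 ≠ 0 := by linarith
    have : θ + 1 + n ≠ 0 := by linarith
    have : θ + 5/6 + n ≠ 0 := by linarith
    have : θ + 7/6 + n ≠ 0 := by linarith
    rw [show θ + (n:ℝ) + 1 = θ + 1 + n by ring, show θ + (n:ℝ) + 1/2 = θ + 1/2 + n by ring,
     show θ + (n:ℝ) + 1/3 = θ + 1/3 + n by ring, show θ + (n:ℝ) + 2/3 = θ + 2/3 + n by ring,
     show θ + (n:ℝ) + 5/6 = θ + 5/6 + n by ring, show θ + (n:ℝ) + 7/6 = θ + 7/6 + n by ring]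
    rw [mul_assoc, div_mul_div_comm]
    congr 2 <;> ring

lemma LamC_hasSum (θ : ℝ) (h : -(1/3) < θ) : HasSum (fun n : ℕ => LR (θ + n)) (LamC θ).re := by
  have h1 := TC_summable θ (by simp; linarith)
  have h2 : Summable (fun n : ℕ => LC (θ + n)) := by
    rw [← summable_nat_add_iff 1]; simpa using h1
  have h3 : HasSum (fun n : ℕ => LC (θ + n)) (LamC θ) := by
    convert h2.hasSum using 1
    rw [h2.tsum_eq_zero_add, LamC, TC]; simp
  have h4 := Complex.hasSum_re h3
  convert h4 using 2 with n
  rw [show (θ:ℂ) + n = ((θ + n : ℝ) : ℂ) by push_cast; ring, LC_ofReal, Complex.ofReal_re]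

lemma ris_one (n : ℕ) : ris 1 n = n.factorial := by
  induction n with
  | zero => simp [ris_zero]
  | succ n ih => rw [ris_succ, ih, Nat.factorial_succ]; push_cast; ring

lemma Lam0 : HasSum (fun n : ℕ => LR (0 + n)) (LR 0 * pFq [1/3, 1/2, 1/2, 2/3] [5/6, 1, 7/6] 1) := by
  have h := LamC_hasSum 0 (by norm_num)
  convert h using 1
  rw [← h.tsum_eq, pFq, ← tsum_mul_left]
  apply tsum_congr; intro n
  rw [LR_nat _ (by norm_num)]
  simp [← ris_one]
  left; ring

lemma Lamm : HasSum (fun n : ℕ => LR (-(1/6) + n)) (LR (-(1/6)) * pFq [1/6, 1/3, 1/3, 1/2] [2/3, 5/6, 5/6] 1) := by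
  have h := LamC_hasSum (-(1/6)) (by norm_num)
  convert h using 1
  rw [← h.tsum_eq, pFq, ← tsum_mul_left]
  apply tsum_congr; intro n
  rw [LR_nat _ (by norm_num)]
  norm_num [← ris_one]
  left; ring

lemma Lamp : HasSum (fun n : ℕ => LR (1/6 + n)) (LR (1/6) * pFq [1/2, 2/3, 2/3, 5/6] [7/6, 7/6, 4/3] 1) := by
  have h := LamC_hasSum (1/6) (by norm_num)
  convert h using 1
  rw [← h.tsum_eq, pFq, ← tsum_mul_left]
  apply tsum_congr; intro n
  rw [LR_nat _ (by norm_num)]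
  norm_num [← ris_one]
  left; ring

lemma three_term : 4 * (LR 0 * pFq [1/3, 1/2, 1/2, 2/3] [5/6, 1, 7/6] 1)
    = LR (1/6) * pFq [1/2, 2/3, 2/3, 5/6] [7/6, 7/6, 4/3] 1
     + LR (-(1/6)) * pFq [1/6, 1/3, 1/3, 1/2] [2/3, 5/6, 5/6] 1 := by
  rw [Lam0.unique (LamC_hasSum 0 (by norm_num)), Lamm.unique (LamC_hasSum (-(1/6)) (by norm_num)),
    Lamp.unique (LamC_hasSum (1/6) (by norm_num))]
  have := congrArg Complex.re LamC_three
  simpa using this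

lemma G_consts : let s := √π; let G := Real.Gamma (1/3)
    LR 0 = 2 * s^2 ∧ LR (-(1/6)) = 3 * √3 / 16 * s * (G / s)^9 ∧ LR (1/6) = 64 * s * (s / G)^9 := by
  intro s G
  have hs : 0 < s := Real.sqrt_pos.mpr pi_pos
  have hs2 : s^2 = π := Real.sq_sqrt pi_pos.le
  have hG : 0 < G := Real.Gamma_pos_of_pos (by norm_num)
  have g12 : Real.Gamma (1/2) = s := Real.Gamma_one_half_eq
  have g32 : Real.Gamma (3/2) = s/2 := by
    rw [show (3/2:ℝ) = 1/2 + 1 by norm_num, Real.Gamma_add_one (by norm_num), g12]; ring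
  have g2 : Real.Gamma 2 = 1 := Real.Gamma_two
  have g76 : Real.Gamma (7/6) = Real.Gamma (1/6) / 6 := by
    rw [show (7/6:ℝ) = 1/6 + 1 by norm_num, Real.Gamma_add_one (by norm_num)]; ring
  have r1 := Real.Gamma_mul_Gamma_one_sub (1/3)
  have r2 := Real.Gamma_mul_Gamma_one_sub (1/6)
  rw [show π * (1/3) = π/3 by ring, Real.sin_pi_div_three, show (1:ℝ) - 1/3 = 2/3 by norm_num] at r1
  rw [show π * (1/6) = π/6 by ring, Real.sin_pi_div_six, show (1:ℝ) - 1/6 = 5/6 by norm_num] at r2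
  have r3 := Real.Gamma_mul_Gamma_add_half (1/3)
  rw [show (1:ℝ)/3+1/2 = 5/6 by norm_num, show (2:ℝ) * (1/3) = 2/3 by norm_num] at r3
  have c2 : ((2:ℝ) ^ (1 - 2/3 : ℝ))^3 = 2 := by
    rw [← Real.rpow_natCast, ← Real.rpow_mul (by norm_num)]; norm_num
  have t3 : √3^2 = 3 := Real.sq_sqrt (by norm_num)
  have t0 : 0 < √3 := Real.sqrt_pos.mpr (by norm_num)
  have p16 : 0 < Real.Gamma (1/6) := Real.Gamma_pos_of_pos (by norm_num)
  have p56 : 0 < Real.Gamma (5/6) := Real.Gamma_pos_of_pos (by norm_num)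
  have p23 : 0 < Real.Gamma (2/3) := Real.Gamma_pos_of_pos (by norm_num)
  have q23 : Real.Gamma (2/3) = 2 * s^2 / (√3 * G) := by
    rw [hs2, eq_div_iff (by positivity)]
    have : G * Real.Gamma (2/3) = π / (√3/2) := r1
    field_simp at this ⊢
    linarith
  have q23' : Real.Gamma (2/3)^3 = 8 * s^6 / (3 * √3 * G^3) := by
    rw [q23, div_pow]; 
    rw [show (√3 * G)^3 = √3^2 * √3 * G^3 by ring, t3]; ring
  have q56 : Real.Gamma (5/6)^3 = 16 * s^9 / (3 * √3 * G^6) := by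
    have h : (G * Real.Gamma (5/6))^3 = 2 * s^3 * Real.Gamma (2/3)^3 := by
      have : G * Real.Gamma (5/6) = Real.Gamma (2/3) * (2:ℝ) ^ (1 - 2/3 : ℝ) * s := r3
      rw [this]; rw [mul_pow, mul_pow, c2]; ring
    rw [q23', mul_pow] at h
    have : Real.Gamma (5/6)^3 = (2 * s ^ 3 * (8 * s ^ 6 / (3 * √3 * G ^ 3)))/G^3 := by
      rw [eq_div_iff (by positivity)]; linarith
    rw [this]; field_simp
    norm_num
  have q16 : Real.Gamma (1/6)^3 = 3 * √3 * G^6 / (2 * s^3) := by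
    have h : (Real.Gamma (1/6) * Real.Gamma (5/6))^3 = 8 * s^6 := by
      rw [r2, show s^6 = (s^2)^3 by ring, hs2]; ring
    rw [mul_pow, q56] at h
    field_simp at h ⊢
    nlinarith
  refine ⟨?_, ?_, ?_⟩
  · unfold LR bR
    norm_num
    rw [g32]
    rw [show Real.Gamma (1/2) = s from g12]; field_simp
  · unfold LR bR
    norm_num
    rw [show Real.Gamma (1/2) = s from g12, div_pow, q56]
    change G^3 / _ * s = _
    field_simp
  · unfold LR bR
    norm_num
    rw [g32, g76, div_pow, div_pow, q23', q16, div_pow]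
    field_simp
    rw [t3]; norm_num

lemma claim2_of : (π^2/10) * pFq [1/3, 1/2, 1/2, 2/3] [5/6, 1, 7/6] 1
      = (3 * π ^ ((3:ℝ)/2) / 20) *
          ((Real.sqrt 3 / 64) * (Gamma (1/3) / Real.sqrt π)^9 *
              pFq [1/6, 1/3, 1/3, 1/2] [2/3, 5/6, 5/6] 1
            + (16/3) * (Real.sqrt π / Gamma (1/3))^9 *
              pFq [1/2, 2/3, 2/3, 5/6] [7/6, 7/6, 4/3] 1) := by
  have h := three_term
  obtain ⟨h1, h2, h3⟩ := G_consts
  rw [h1, h2, h3] at h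
  have hs : 0 < √π := Real.sqrt_pos.mpr pi_pos
  have hs2 : √π^2 = π := Real.sq_sqrt pi_pos.le
  have e : π ^ ((3:ℝ)/2) = √π^3 := by
    rw [sqrt_eq_rpow, ← Real.rpow_natCast, ← Real.rpow_mul pi_pos.le]; norm_num
  rw [e]
  have e2 : π^2 = √π^4 := by rw [show √π^4 = (√π^2)^2 by ring, hs2]
  rw [e2]
  generalize pFq [1/3, 1/2, 1/2, 2/3] [5/6, 1, 7/6] 1 = A at *
  generalize pFq [1/6, 1/3, 1/3, 1/2] [2/3, 5/6, 5/6] 1 = B at *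
  generalize pFq [1/2, 2/3, 2/3, 5/6] [7/6, 7/6, 4/3] 1 = C at *
  linear_combination (√π^2/80) * h

def SU : Set ℂ := {u : ℂ | u.re < 1 ∨ u.im ≠ 0}
noncomputable def Dc (w : ℝ) (u : ℂ) : ℂ := ((cosh w ^ 2 : ℝ) : ℂ) - u
noncomputable def fc (s : ℝ) (u : ℂ) (w : ℝ) : ℂ := ((cosh (w/3) : ℝ) : ℂ) * (Dc w u) ^ ((-s : ℝ) : ℂ)
noncomputable def Jc (s : ℝ) (u : ℂ) : ℂ := ∫ w in Ioi (0:ℝ), fc s u w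

lemma one_le_cosh_sq (w : ℝ) : 1 ≤ cosh w ^ 2 := by nlinarith [Real.one_le_cosh w]

lemma SU_open : IsOpen SU :=
  (isOpen_lt Complex.continuous_re continuous_const).union
    (isOpen_ne_fun Complex.continuous_im continuous_const)

lemma Dc_slit (w : ℝ) (u : ℂ) (hu : u ∈ SU) : Dc w u ∈ Complex.slitPlane := by
  rw [Complex.mem_slitPlane_iff]
  unfold Dc
  rcases hu with h | h
  · left
    have := one_le_cosh_sq w
    rw [Complex.sub_re, Complex.ofReal_re]; linarith
  · right
    rw [Complex.sub_im, Complex.ofReal_im]; simpa using h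

lemma Dc_lower (u0 : ℂ) (hu : u0 ∈ SU) : ∃ c > 0, ∃ δ > 0, Metric.ball u0 δ ⊆ SU ∧
    ∀ u ∈ Metric.ball u0 δ, ∀ w : ℝ, c * cosh w ^ 2 ≤ ‖Dc w u‖ := by
  have hne : ∀ t ∈ Icc (0:ℝ) 1, (0:ℝ) < ‖1 - u0 * (t:ℂ)‖ := by
    intro t ht
    rw [norm_pos_iff]
    intro h
    have hr := congrArg Complex.re h
    have hi := congrArg Complex.im h
    simp at hr hi
    rcases hi with hi | hi
    · rcases hu with h' | h'
      · by_cases h0 : 0 ≤ u0.re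
        · nlinarith [ht.1, ht.2]
        · nlinarith [ht.1, ht.2]
      · exact h' hi
    · rw [hi] at hr; simp at hr
  obtain ⟨t0, ht0, hmin⟩ := isCompact_Icc.exists_isMinOn (s := Icc (0:ℝ) 1) ⟨0, by simp⟩
    (f := fun t : ℝ => ‖1 - u0 * (t:ℂ)‖) (by fun_prop)
  obtain ⟨δ, hδ, hb⟩ := Metric.isOpen_iff.mp SU_open u0 hu
  set m := ‖1 - u0 * (t0:ℂ)‖
  have hm : 0 < m := hne t0 ht0
  refine ⟨m/2, by positivity, min δ (m/2), by positivity, ?_, ?_⟩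
  · exact (Metric.ball_subset_ball (min_le_left _ _)).trans hb
  · intro u hu w
    have hu' : ‖u - u0‖ < m/2 := by
      have := lt_of_lt_of_le (Metric.mem_ball.mp hu) (min_le_right _ _); rwa [dist_eq_norm] at this
    have h1 := one_le_cosh_sq w
    set x := cosh w ^ 2
    have hx : 0 < x := by linarith
    have ht : x⁻¹ ∈ Icc (0:ℝ) 1 := ⟨by positivity, inv_le_one_of_one_le₀ h1⟩
    have h2 : m ≤ ‖1 - u0 * ((x⁻¹ : ℝ):ℂ)‖ := hmin ht
    have e : Dc w u = (x:ℂ) * (1 - u0 * ((x⁻¹ : ℝ):ℂ)) - (u - u0) := by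
      have : (x:ℂ) ≠ 0 := by exact_mod_cast hx.ne'
      unfold Dc; rw [Complex.ofReal_inv]; change (x:ℂ) - u = _; field_simp; ring
    have h3 : ‖(x:ℂ) * (1 - u0 * ((x⁻¹ : ℝ):ℂ))‖ = x * ‖1 - u0 * ((x⁻¹ : ℝ):ℂ)‖ := by
      rw [norm_mul, Complex.norm_real, norm_of_nonneg hx.le]
    have h4 := norm_sub_norm_le ((x:ℂ) * (1 - u0 * ((x⁻¹ : ℝ):ℂ))) (u - u0)
    rw [← e, h3] at h4
    nlinarith

lemma cosh_le_exp (w : ℝ) (hw : 0 ≤ w) : cosh w ≤ exp w := by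
  rw [Real.cosh_eq]
  have := Real.exp_le_exp.mpr (by linarith : -w ≤ w); linarith

lemma inv_cosh_le (w : ℝ) : (cosh w)⁻¹ ≤ 2 * exp (-w) := by
  rw [inv_le_comm₀ (cosh_pos _) (by positivity), mul_inv, ← Real.exp_neg, neg_neg, Real.cosh_eq]
  have := exp_pos (-w); linarith

lemma cosh_ratio_le (w : ℝ) (hw : 0 ≤ w) : cosh (w/3) * (cosh w)⁻¹ ≤ 2 * exp (-(2/3) * w) := by
  have h1 := cosh_le_exp (w/3) (by positivity)
  have h2 := inv_cosh_le w
  have h3 := cosh_pos (w/3)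
  calc _ ≤ exp (w/3) * (2 * exp (-w)) := by gcongr
    _ = _ := by rw [mul_left_comm, ← Real.exp_add]; ring_nf

lemma pow_cosh_le (c : ℝ) (hc : 0 < c) (s : ℝ) (hs : 1/2 ≤ s) (w : ℝ) :
    (c * cosh w ^ 2) ^ (-s) ≤ c ^ (-s) * (cosh w)⁻¹ := by
  have h1 := one_le_cosh_sq w
  rw [Real.mul_rpow hc.le (by positivity)]
  have : (cosh w ^ 2) ^ (-s) ≤ (cosh w)⁻¹ := by
    calc (cosh w ^ 2) ^ (-s) ≤ (cosh w ^ 2) ^ (-(1/2) : ℝ) :=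
          Real.rpow_le_rpow_of_exponent_le h1 (by linarith)
      _ = _ := by
          rw [Real.rpow_neg (by positivity), ← sqrt_eq_rpow, Real.sqrt_sq (cosh_pos _).le]
  gcongr

lemma norm_fc_le (c : ℝ) (hc : 0 < c) (s : ℝ) (hs : 1/2 ≤ s) (u : ℂ) (w : ℝ) (hw : 0 ≤ w)
    (h : c * cosh w ^ 2 ≤ ‖Dc w u‖) : ‖fc s u w‖ ≤ c ^ (-s) * (2 * exp (-(2/3) * w)) := by
  unfold fc
  have h1 := one_le_cosh_sq w
  have h3 := cosh_pos (w/3)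
  rw [norm_mul, Complex.norm_real, norm_of_nonneg h3.le, Complex.norm_cpow_real]
  calc _ ≤ cosh (w/3) * (c * cosh w ^ 2) ^ (-s) := by
        gcongr ?_ * ?_
        exact rpow_le_rpow_of_nonpos (by positivity) h (by linarith)
    _ ≤ cosh (w/3) * (c ^ (-s) * (cosh w)⁻¹) := by
        gcongr; exact pow_cosh_le c hc s hs w
    _ = c ^ (-s) * (cosh (w/3) * (cosh w)⁻¹) := by ring
    _ ≤ _ := mul_le_mul_of_nonneg_left (cosh_ratio_le w hw) (Real.rpow_nonneg hc.le _)

lemma fc_cont (s : ℝ) (u : ℂ) (hu : u ∈ SU) : Continuous (fc s u) := by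
  unfold fc
  refine Continuous.mul (by fun_prop) ?_
  refine Continuous.cpow (by unfold Dc; fun_prop) continuous_const (fun w => Dc_slit w u hu)

lemma exp_int (C : ℝ) : IntegrableOn (fun w : ℝ => C * (2 * exp (-(2/3) * w))) (Ioi 0) := by
  exact ((exp_neg_integrableOn_Ioi 0 (by norm_num : (0:ℝ) < 2/3)).const_mul 2).const_mul C

lemma fc_int (s : ℝ) (hs : 1/2 ≤ s) (u : ℂ) (hu : u ∈ SU) : IntegrableOn (fc s u) (Ioi 0) := by
  obtain ⟨c, hc, δ, hδ, -, hb⟩ := Dc_lower u hu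
  refine Integrable.mono' (exp_int (c^(-s))) (fc_cont s u hu).aestronglyMeasurable ?_
  filter_upwards [ae_restrict_mem measurableSet_Ioi] with w hw
  exact norm_fc_le c hc s hs u w (le_of_lt hw) (hb u (Metric.mem_ball_self hδ) w)

lemma Jc_hasDerivAt (s : ℝ) (hs : 1/2 ≤ s) (u : ℂ) (hu : u ∈ SU) :
    HasDerivAt (Jc s) (s * Jc (s+1) u) u := by
  obtain ⟨c, hc, δ, hδ, hsub, hb⟩ := Dc_lower u hu
  have key := hasDerivAt_integral_of_dominated_loc_of_deriv_le (μ := volume.restrict (Ioi (0:ℝ)))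
    (F := fun u w => fc s u w) (F' := fun u w => (s:ℂ) * fc (s+1) u w) (x₀ := u) (s := Metric.ball u δ)
    (bound := fun w => |s| * (c^(-(s+1)) * (2 * exp (-(2/3) * w)))) (Metric.ball_mem_nhds u hδ)
    ?_ (fc_int s hs u hu) ?_ ?_ ?_ ?_
  · have := key.2
    rw [integral_const_mul] at this
    exact this
  · filter_upwards [SU_open.mem_nhds hu] with v hv
    exact (fc_cont s v hv).aestronglyMeasurable
  · exact (continuous_const.mul (fc_cont (s+1) u hu)).aestronglyMeasurable
  · filter_upwards [ae_restrict_mem measurableSet_Ioi] with w hw v hv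
    rw [norm_mul, Complex.norm_real, Real.norm_eq_abs]
    gcongr
    exact norm_fc_le c hc (s+1) (by linarith) v w (le_of_lt hw) (hb v hv w)
  · exact (exp_int (c^(-(s+1)))).const_mul _
  · filter_upwards with w v hv
    unfold fc
    have h1 : HasDerivAt (fun v => Dc w v) (-1) v := by
      exact (hasDerivAt_id v).const_sub ((cosh w ^ 2 : ℝ) : ℂ)
    have h2 := (h1.cpow_const (c := ((-s:ℝ):ℂ)) (Dc_slit w v (hsub hv))).const_mul ((cosh (w/3) : ℝ) : ℂ)
    refine h2.congr_deriv ?_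
    rw [show (((-(s+1):ℝ)):ℂ) = ((-s:ℝ):ℂ) - 1 by push_cast; ring]
    push_cast; ring

/-- the real Legendre-type function -/
noncomputable def JR (s : ℝ) (u : ℝ) : ℝ :=
  ∫ w in Ioi (0:ℝ), cosh (w/3) * (cosh w ^ 2 - u) ^ (-s)

lemma fc_ofReal (s u w : ℝ) (hu : u < 1) :
    fc s u w = ((cosh (w/3) * (cosh w ^ 2 - u) ^ (-s) : ℝ) : ℂ) := by
  unfold fc Dc
  have h1 := one_le_cosh_sq w
  rw [Complex.ofReal_mul, Complex.ofReal_cpow (by linarith)]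
  push_cast; rfl

lemma ofReal_SU (u : ℝ) (hu : u < 1) : (u:ℂ) ∈ SU := Or.inl (by simpa using hu)

lemma Jc_ofReal (s u : ℝ) (hu : u < 1) : Jc s u = (JR s u : ℂ) := by
  unfold Jc JR
  rw [← integral_complex_ofReal]
  congr 1; ext w; exact fc_ofReal s u w hu

lemma JR_int (s : ℝ) (hs : 1/2 ≤ s) (u : ℝ) (hu : u < 1) :
    IntegrableOn (fun w => cosh (w/3) * (cosh w ^ 2 - u) ^ (-s)) (Ioi 0) := by
  have := (fc_int s hs u (ofReal_SU u hu)).re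
  refine this.congr (Filter.Eventually.of_forall fun w => ?_)
  change (fc s u w).re = _
  rw [fc_ofReal s u w hu, Complex.ofReal_re]

lemma JR_hasDerivAt (s : ℝ) (hs : 1/2 ≤ s) (u : ℝ) (hu : u < 1) :
    HasDerivAt (JR s) (s * JR (s+1) u) u := by
  have h := (Jc_hasDerivAt s hs u (ofReal_SU u hu)).real_of_complex
  rw [Jc_ofReal _ _ hu] at h
  have h2 : HasDerivAt (fun x : ℝ => (Jc s x).re) (s * JR (s+1) u) u := by
    convert h using 1
    rw [← Complex.ofReal_mul, Complex.ofReal_re]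
  refine h2.congr_of_eventuallyEq ?_
  filter_upwards [Iio_mem_nhds hu] with v hv
  rw [Jc_ofReal _ _ hv, Complex.ofReal_re]

open Filter Topology in
lemma JR_ode (u : ℝ) (hu : u < 1) :
    u * (1-u) * (1/2 * (3/2 * JR (5/2) u)) + (1 - 2*u) * (1/2 * JR (3/2) u) - 2/9 * JR (1/2) u = 0 := by
  have i1 := JR_int (1/2) (by norm_num) u hu
  have i2 := JR_int (3/2) (by norm_num) u hu
  have i3 := JR_int (5/2) (by norm_num) u hu
  set X : ℝ → ℝ := fun w => cosh w ^ 2 - u with hX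
  have hXp : ∀ w, 0 < X w := fun w => by have := one_le_cosh_sq w; change 0 < cosh w ^ 2 - u; linarith
  set F : ℝ → ℝ := fun w => 1/12 * (sinh (w/3) * X w ^ (-(1/2):ℝ))
      + 1/4 * (cosh (w/3) * sinh w * cosh w * X w ^ (-(3/2):ℝ)) with hF
  have hd : ∀ w, HasDerivAt F (u * (1-u) * (1/2 * (3/2 * (cosh (w/3) * X w ^ (-(5/2):ℝ))))
      + (1 - 2*u) * (1/2 * (cosh (w/3) * X w ^ (-(3/2):ℝ))) - 2/9 * (cosh (w/3) * X w ^ (-(1/2):ℝ))) w := by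
    intro w
    have dX : HasDerivAt X (2 * cosh w * sinh w) w := by
      have := ((Real.hasDerivAt_cosh w).pow 2).sub_const u
      refine this.congr_deriv ?_; simp
    have dX1 := dX.rpow_const (p := -(1/2)) (Or.inl (hXp w).ne')
    have dX3 := dX.rpow_const (p := -(3/2)) (Or.inl (hXp w).ne')
    have ds : HasDerivAt (fun w : ℝ => sinh (w/3)) (cosh (w/3) * (1/3)) w :=
      ((hasDerivAt_id w).div_const 3).sinh
    have dc : HasDerivAt (fun w : ℝ => cosh (w/3)) (sinh (w/3) * (1/3)) w :=
      ((hasDerivAt_id w).div_const 3).cosh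
    have := ((ds.mul dX1).const_mul (1/12)).add
      ((((dc.mul (Real.hasDerivAt_sinh w)).mul (Real.hasDerivAt_cosh w)).mul dX3).const_mul (1/4))
    refine this.congr_deriv ?_
    have e5 : X w ^ (-(1/2) : ℝ) = X w ^ (-(5/2):ℝ) * X w ^ 2 := by
      rw [← Real.rpow_natCast, ← Real.rpow_add (hXp w)]; norm_num
    have e3 : X w ^ (-(3/2) : ℝ) = X w ^ (-(5/2):ℝ) * X w := by
      rw [← Real.rpow_add_one (hXp w).ne']; norm_num
    have e1 : (-(1/2):ℝ) - 1 = -(3/2) := by norm_num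
    have e2 : (-(3/2):ℝ) - 1 = -(5/2) := by norm_num
    rw [e1, e2]
    simp only [Pi.mul_apply]
    rw [e5, e3]
    have hs := Real.sinh_sq w
    have hXw : X w = cosh w^2 - u := rfl
    rw [hXw]
    have hs4 : sinh w ^ 2 = cosh w^2 - 1 := hs
    generalize (cosh w^2 - u) ^ (-(5/2):ℝ) = Z
    generalize cosh w = c at *
    generalize sinh w = s at *
    generalize cosh (w/3) = c3
    generalize sinh (w/3) = s3
    grind
  have hint : IntegrableOn (fun w => u * (1-u) * (1/2 * (3/2 * (cosh (w/3) * X w ^ (-(5/2):ℝ))))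
      + (1 - 2*u) * (1/2 * (cosh (w/3) * X w ^ (-(3/2):ℝ))) - 2/9 * (cosh (w/3) * X w ^ (-(1/2):ℝ))) (Ioi 0) :=
    ((((i3.const_mul (3/2)).const_mul (1/2)).const_mul _).add ((i2.const_mul (1/2)).const_mul _)).sub (i1.const_mul (2/9))
  have hlim : Tendsto F atTop (𝓝 0) := by
    have hb : ∀ᶠ w in atTop, ‖F w‖ ≤ (1/12 * (1 * cosh (w/3) * (X w)^(-(1/2):ℝ)) + 1/4 * (cosh (w/3) * (cosh w^2 * X w ^ (-(3/2):ℝ)))) := by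
      filter_upwards [eventually_ge_atTop 0] with w hw
      have h1 : 0 ≤ sinh w := Real.sinh_nonneg_iff.mpr hw
      have h2 : 0 ≤ sinh (w/3) := Real.sinh_nonneg_iff.mpr (by positivity)
      have h3 := (Real.sinh_lt_cosh w).le
      have h4 := (Real.sinh_lt_cosh (w/3)).le
      have h5 := cosh_pos w
      have h6 := cosh_pos (w/3)
      have h7 := Real.rpow_nonneg (hXp w).le (-(1/2))
      have h8 := Real.rpow_nonneg (hXp w).le (-(3/2))
      rw [norm_of_nonneg (by simp only [hF]; positivity)]
      simp only [hF]
      rw [one_mul, sq]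
      have k1 : sinh (w/3) * X w ^ (-(1/2):ℝ) ≤ cosh (w/3) * X w ^ (-(1/2):ℝ) := by gcongr
      have k2 : cosh (w/3) * sinh w * cosh w * X w ^ (-(3/2):ℝ) ≤
        cosh (w/3) * cosh w * cosh w * X w ^ (-(3/2):ℝ) := by gcongr
      nlinarith
    obtain ⟨c, hc, δ, hδ, -, hlow⟩ := Dc_lower u (ofReal_SU u hu)
    have hlow' : ∀ w, c * cosh w^2 ≤ X w := by
      intro w
      have := hlow u (Metric.mem_ball_self hδ) w
      unfold Dc at this
      rw [← Complex.ofReal_sub, Complex.norm_real, norm_of_nonneg (hXp w).le] at this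
      exact this
    have hb2 : ∀ᶠ w in atTop, ‖F w‖ ≤ (1/12 * c^(-(1/2):ℝ) + 1/4 * (c⁻¹ * c^(-(1/2):ℝ))) * (2 * exp (-(2/3) * w)) := by
      filter_upwards [hb, eventually_ge_atTop 0] with w hw hw0
      refine hw.trans ?_
      have a1 : X w ^ (-(1/2):ℝ) ≤ c^(-(1/2):ℝ) * (cosh w)⁻¹ :=
        (rpow_le_rpow_of_nonpos (by have := cosh_pos w; positivity) (hlow' w) (by norm_num)).trans
          (pow_cosh_le c hc (1/2) le_rfl w)
      have a2 : cosh w^2 * X w ^ (-(3/2):ℝ) ≤ c⁻¹ * X w ^ (-(1/2):ℝ) := by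
        have e : X w ^ (-(1/2):ℝ) = X w ^ (-(3/2):ℝ) * X w := by
          rw [← Real.rpow_add_one (hXp w).ne']; norm_num
        rw [e]
        have h8 := Real.rpow_nonneg (hXp w).le (-(3/2))
        have : cosh w^2 ≤ c⁻¹ * X w := by
          rw [inv_mul_eq_div, le_div_iff₀ hc]; linarith [hlow' w]
        nlinarith
      have a3 := cosh_ratio_le w hw0
      have h6 := cosh_pos (w/3)
      have hcc := Real.rpow_nonneg hc.le (-(1/2))
      have a5 : cosh (w/3) * X w ^ (-(1/2):ℝ) ≤ c^(-(1/2):ℝ) * (2 * exp (-(2/3) * w)) := by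
        calc _ ≤ cosh (w/3) * (c^(-(1/2):ℝ) * (cosh w)⁻¹) := by gcongr
          _ = c^(-(1/2):ℝ) * (cosh (w/3) * (cosh w)⁻¹) := by ring
          _ ≤ _ := by gcongr
      have a6 : cosh (w/3) * (cosh w^2 * X w ^ (-(3/2):ℝ)) ≤ c⁻¹ * (c^(-(1/2):ℝ) * (2 * exp (-(2/3) * w))) := by
        calc _ ≤ cosh (w/3) * (c⁻¹ * X w ^ (-(1/2):ℝ)) := by gcongr
          _ = c⁻¹ * (cosh (w/3) * X w ^ (-(1/2):ℝ)) := by ring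
          _ ≤ _ := by gcongr
      nlinarith
    have hz : Tendsto (fun w : ℝ => (1/12 * c^(-(1/2):ℝ) + 1/4 * (c⁻¹ * c^(-(1/2):ℝ))) * (2 * exp (-(2/3) * w))) atTop (𝓝 0) := by
      have : Tendsto (fun w : ℝ => exp (-(2/3) * w)) atTop (𝓝 0) := by
        apply Real.tendsto_exp_atBot.comp
        exact tendsto_id.const_mul_atTop_of_neg (by norm_num)
      simpa using (this.const_mul 2).const_mul _
    exact squeeze_zero_norm' hb2 hz
  have h := integral_Ioi_of_hasDerivAt_of_tendsto (a := 0) (hd 0).continuousAt.continuousWithinAt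
    (fun w _ => hd w) hint hlim
  have F0 : F 0 = 0 := by simp [hF]
  rw [F0, sub_zero] at h
  rw [integral_sub, integral_add, integral_const_mul, integral_const_mul, integral_const_mul, integral_const_mul,
    integral_const_mul, integral_const_mul] at h
  · exact h
  · exact ((i3.const_mul (3/2)).const_mul (1/2)).const_mul _
  · exact (i2.const_mul (1/2)).const_mul _
  · exact (((i3.const_mul (3/2)).const_mul (1/2)).const_mul _).add ((i2.const_mul (1/2)).const_mul _)
  · exact i1.const_mul (2/9)

open Filter Topology in
lemma tanh_lim : Tendsto (fun w : ℝ => sinh w / cosh w) atTop (𝓝 1) := by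
  have h : Tendsto (fun w : ℝ => exp (-2 * w)) atTop (𝓝 0) :=
    Real.tendsto_exp_atBot.comp (tendsto_id.const_mul_atTop_of_neg (by norm_num))
  have h2 : Tendsto (fun w : ℝ => (1 - exp (-2 * w)) / (1 + exp (-2 * w))) atTop (𝓝 ((1 - 0) / (1 + 0))) :=
    (h.const_sub 1).div (h.const_add 1) (by norm_num)
  norm_num at h2
  refine h2.congr fun w => ?_
  have e : exp (-(2 * w)) = exp (-w) * exp (-w) := by rw [← Real.exp_add]; ring_nf
  have e2 : exp w * exp (-w) = 1 := by rw [← Real.exp_add]; simp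
  have := exp_pos w
  have := exp_pos (-w)
  rw [Real.sinh_eq, Real.cosh_eq, e, div_eq_div_iff (by positivity) (by positivity)]
  linear_combination (-(exp (-w)) ) * e2

lemma tanh_deriv (w : ℝ) : HasDerivAt (fun w : ℝ => sinh w / cosh w) (1 / cosh w ^ 2) w := by
  have h := cosh_pos w
  refine ((Real.hasDerivAt_sinh w).div (Real.hasDerivAt_cosh w) h.ne').congr_deriv ?_
  have := cosh_sq w
  congr 1; linarith

lemma cosh_third (s : ℝ) : cosh s = cosh (s/3) * (1 + 4 * sinh (s/3)^2) := by
  have := Real.cosh_three_mul (s/3)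
  rw [show 3 * (s/3) = s by ring] at this
  rw [this, Real.sinh_sq]; ring

lemma B_aux (s : ℝ) : cosh (s/3) / cosh s = 1 / (1 + 4 * sinh (s/3)^2) := by
  rw [cosh_third s]
  have := cosh_pos (s/3)
  field_simp

open Filter Topology in
lemma B_int : IntegrableOn (fun s : ℝ => cosh (s/3) / cosh s) (Ioi 0) ∧
    ∫ s in Ioi (0:ℝ), cosh (s/3) / cosh s = π / √3 := by
  have s3 : √3 * √3 = 3 := Real.mul_self_sqrt (by norm_num)
  have hd : ∀ s ∈ Ici (0:ℝ), HasDerivAt (fun s : ℝ => √3 * Real.arctan (√3 * (sinh (s/3) / cosh (s/3))))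
      (cosh (s/3) / cosh s) s := by
    intro s _
    have h0 : HasDerivAt (fun s : ℝ => s/3) (1/3) s := (hasDerivAt_id s).div_const 3
    have h1 := (tanh_deriv (s/3)).comp s h0
    refine (((h1.const_mul √3).arctan).const_mul √3).congr_deriv ?_
    rw [B_aux]
    have hc := cosh_pos (s/3)
    have hs := cosh_sq (s/3)
    simp only [Function.comp, mul_pow, Real.sq_sqrt (show (0:ℝ) ≤ 3 by norm_num), div_pow]
    have e : 1 + 3 * (sinh (s/3)^2 / cosh (s/3)^2) = (1 + 4 * sinh (s/3)^2) / cosh (s/3)^2 := by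
      field_simp; rw [hs]; ring
    rw [e]
    have : 0 < 1 + 4 * sinh (s/3)^2 := by positivity
    field_simp; nlinarith
  have hl : Tendsto (fun s : ℝ => √3 * Real.arctan (√3 * (sinh (s/3) / cosh (s/3)))) atTop (𝓝 (π / √3)) := by
    have h := tanh_lim.comp (tendsto_id.atTop_div_const (show (0:ℝ) < 3 by norm_num))
    have h2 := (((Real.continuous_arctan.tendsto _).comp (h.const_mul √3))).const_mul √3
    rw [mul_one, Real.arctan_sqrt_three] at h2
    have e : √3 * (π / 3) = π / √3 := by field_simp; nlinarith
    rw [e] at h2; exact h2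
  have hp : ∀ s ∈ Ioi (0:ℝ), 0 ≤ cosh (s/3) / cosh s := fun s _ => by
    have := cosh_pos (s/3); have := cosh_pos s; positivity
  refine ⟨integrableOn_Ioi_deriv_of_nonneg' hd hp hl, ?_⟩
  rw [integral_Ioi_of_hasDerivAt_of_nonneg' hd hp hl]
  simp

open Filter Topology in
lemma F30_int : ∫ w in Ioi (0:ℝ), 1 / (1 + 2 * cosh w) = π / (3 * √3) := by
  have s3 : √3 * √3 = 3 := Real.mul_self_sqrt (by norm_num)
  have hd : ∀ s ∈ Ici (0:ℝ), HasDerivAt (fun s : ℝ => 2 / √3 * Real.arctan (1 / √3 * (sinh (s/2) / cosh (s/2))))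
      (1 / (1 + 2 * cosh s)) s := by
    intro s _
    have h0 : HasDerivAt (fun s : ℝ => s/2) (1/2) s := (hasDerivAt_id s).div_const 2
    have h1 := (tanh_deriv (s/2)).comp s h0
    refine (((h1.const_mul (1/√3)).arctan).const_mul (2/√3)).congr_deriv ?_
    have hc := cosh_pos (s/2)
    have hs := cosh_sq (s/2)
    have h2 := Real.cosh_two_mul (s/2)
    rw [show 2 * (s/2) = s by ring] at h2
    simp only [Function.comp, mul_pow, div_pow, Real.sq_sqrt (show (0:ℝ) ≤ 3 by norm_num)]
    have e : 1 + 1 ^ 2 / 3 * (sinh (s/2)^2 / cosh (s/2)^2) = (1 + 2 * cosh s) / (3 * cosh (s/2)^2) := by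
      rw [h2]; field_simp; rw [hs]; ring
    rw [e]
    have : 0 < 1 + 2 * cosh s := by have := cosh_pos s; positivity
    field_simp; nlinarith
  have hl : Tendsto (fun s : ℝ => 2 / √3 * Real.arctan (1 / √3 * (sinh (s/2) / cosh (s/2)))) atTop (𝓝 (π / (3 * √3))) := by
    have h := tanh_lim.comp (tendsto_id.atTop_div_const (show (0:ℝ) < 2 by norm_num))
    have h2 := (((Real.continuous_arctan.tendsto _).comp (h.const_mul (1/√3)))).const_mul (2/√3)
    rw [mul_one, one_div, Real.arctan_inv_sqrt_three] at h2
    have e : 2 / √3 * (π / 6) = π / (3 * √3) := by field_simp; norm_num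
    rw [e] at h2
    refine h2.congr fun s => ?_
    simp
  rw [integral_Ioi_of_hasDerivAt_of_nonneg' hd (fun s _ => by have := cosh_pos s; positivity) hl]
  simp

lemma wronsk {a b f f' g g' : ℝ → ℝ} {s : Set ℝ} (hs : s.OrdConnected) (x0 : ℝ) (hx0 : x0 ∈ s)
    (ha0 : a x0 = 0) (hane : ∀ x ∈ s, x ≠ x0 → a x ≠ 0)
    (hf : ∀ x ∈ s, HasDerivAt f (f' x) x) (hg : ∀ x ∈ s, HasDerivAt g (g' x) x)
    (haf : ∀ x ∈ s, HasDerivAt (fun x => a x * f' x) (b x * f x) x)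
    (hag : ∀ x ∈ s, HasDerivAt (fun x => a x * g' x) (b x * g x) x)
    (hg0 : ∀ x ∈ s, g x ≠ 0) (h0 : f x0 = g x0) : ∀ x ∈ s, f x = g x := by
  have key : ∀ (F F' : ℝ → ℝ), (∀ x ∈ s, ContinuousAt F x) → (∀ x ∈ s, x ≠ x0 → HasDerivAt F (F' x) x) →
      (∀ x ∈ s, x ≠ x0 → F' x = 0) → ∀ x ∈ s, F x = F x0 := by
    intro F F' hc hF hF' x hx
    rcases lt_trichotomy x x0 with h | h | h
    · have hsub : Icc x x0 ⊆ s := hs.out hx hx0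
      obtain ⟨c, hc1, hc2⟩ := exists_hasDerivAt_eq_slope F F' h (fun y hy => (hc y (hsub hy)).continuousWithinAt)
        (fun y hy => hF y (hsub (Ioo_subset_Icc_self hy)) hy.2.ne)
      rw [hF' c (hsub (Ioo_subset_Icc_self hc1)) hc1.2.ne, eq_comm, div_eq_zero_iff] at hc2
      rcases hc2 with h1 | h1 <;> linarith
    · rw [h]
    · have hsub : Icc x0 x ⊆ s := hs.out hx0 hx
      obtain ⟨c, hc1, hc2⟩ := exists_hasDerivAt_eq_slope F F' h (fun y hy => (hc y (hsub hy)).continuousWithinAt)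
        (fun y hy => hF y (hsub (Ioo_subset_Icc_self hy)) hy.1.ne')
      rw [hF' c (hsub (Ioo_subset_Icc_self hc1)) hc1.1.ne', eq_comm, div_eq_zero_iff] at hc2
      rcases hc2 with h1 | h1 <;> linarith
  have hW : ∀ x ∈ s, HasDerivAt (fun x => a x * f' x * g x - a x * g' x * f x) 0 x := by
    intro x hx
    refine (((haf x hx).mul (hg x hx)).sub ((hag x hx).mul (hf x hx))).congr_deriv ?_
    ring
  have hW0 := key _ (fun _ => 0) (fun x hx => (hW x hx).continuousAt) (fun x hx _ => hW x hx) (fun _ _ _ => rfl)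
  have hq := key (fun x => f x / g x) _ (fun x hx => (hf x hx).continuousAt.div (hg x hx).continuousAt (hg0 x hx))
    (fun x hx _ => (hf x hx).div (hg x hx) (hg0 x hx)) (by
      intro x hx hne
      have h1 := hW0 x hx
      simp only [ha0] at h1
      have h2 : a x * (f' x * g x - f x * g' x) = 0 := by linarith
      rcases mul_eq_zero.mp h2 with h3 | h3
      · exact absurd h3 (hane x hx hne)
      · rw [h3, zero_div])
  intro x hx
  have := hq x hx
  rw [h0, div_self (hg0 x0 hx0), div_eq_one_iff_eq (hg0 x hx)] at this
  exact this

/-- normalised function -/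
noncomputable def PP (u : ℝ) : ℝ := √3 / π * JR (1/2) u
noncomputable def PP1 (u : ℝ) : ℝ := √3 / π * (1/2 * JR (3/2) u)

lemma PP_deriv (u : ℝ) (hu : u < 1) : HasDerivAt PP (PP1 u) u := by
  have := (JR_hasDerivAt (1/2) le_rfl u hu).const_mul (√3/π)
  refine this.congr_deriv ?_
  unfold PP1; norm_num

lemma PP_deriv2 (u : ℝ) (hu : u < 1) : HasDerivAt (fun u => u * (1-u) * PP1 u) (2/9 * PP u) u := by
  have h := ((JR_hasDerivAt (3/2) (by norm_num) u hu).const_mul (1/2)).const_mul (√3/π)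
  have h2 := ((hasDerivAt_id u).mul ((hasDerivAt_id u).const_sub 1)).mul h
  refine h2.congr_deriv ?_
  have := JR_ode u hu
  rw [show (3/2:ℝ)+1 = 5/2 by norm_num]
  simp only [PP, id, Pi.mul_apply]
  linear_combination (√3/π) * this

lemma JR_pos (s : ℝ) (hs : 1/2 ≤ s) (u : ℝ) (hu : u < 1) : 0 < JR s u := by
  unfold JR
  have hp : ∀ w : ℝ, 0 < cosh (w/3) * (cosh w ^ 2 - u) ^ (-s) := fun w => by
    have := cosh_pos (w/3)
    have := one_le_cosh_sq w
    have : 0 < cosh w ^ 2 - u := by linarith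
    positivity
  rw [setIntegral_pos_iff_support_of_nonneg_ae (Filter.Eventually.of_forall fun w => (hp w).le) (JR_int s hs u hu)]
  rw [show Function.support (fun w : ℝ => cosh (w/3) * (cosh w ^ 2 - u) ^ (-s)) = univ from
    eq_univ_of_forall fun w => (hp w).ne']
  simp

lemma PP_pos (u : ℝ) (hu : u < 1) : 0 < PP u := by
  have := JR_pos (1/2) le_rfl u hu
  have := pi_pos
  unfold PP; positivity

lemma PP_zero : PP 0 = 1 := by
  unfold PP JR
  have : ∀ w : ℝ, cosh (w/3) * (cosh w ^ 2 - 0) ^ (-(1/2):ℝ) = cosh (w/3) / cosh w := by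
    intro w
    rw [sub_zero, Real.rpow_neg (by positivity), ← sqrt_eq_rpow, Real.sqrt_sq (cosh_pos w).le]
    exact (div_eq_mul_inv _ _).symm
  simp_rw [this]
  rw [B_int.2]
  have := pi_pos
  field_simp

noncomputable def uu (r : ℝ) : ℝ := r^2 * (3-r)/4
noncomputable def pf (r : ℝ) : ℝ := PP (uu r)
noncomputable def pf1 (r : ℝ) : ℝ := PP1 (uu r) * (3 * r * (2-r)/4)

lemma uu_lt (r : ℝ) (h1 : -1 < r) (h2 : r ≠ 2) : uu r < 1 := by
  have h : 0 < (1+r) * (2-r)^2 := mul_pos (by linarith) (by have : 2 - r ≠ 0 := sub_ne_zero.mpr h2.symm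
                                                            positivity)
  unfold uu; nlinarith

lemma uu_deriv (r : ℝ) : HasDerivAt uu (3 * r * (2-r)/4) r := by
  have := (((hasDerivAt_id r).pow 2).mul ((hasDerivAt_id r).const_sub 3)).div_const 4
  refine this.congr_deriv ?_
  simp; ring

lemma pf_deriv (r : ℝ) (h1 : -1 < r) (h2 : r ≠ 2) : HasDerivAt pf (pf1 r) r :=
  (PP_deriv _ (uu_lt r h1 h2)).comp r (uu_deriv r)

lemma pf_A (r : ℝ) : r*(3-r)*(1+r)*(2-r) * pf1 r = 12 * (uu r * (1 - uu r) * PP1 (uu r)) := by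
  unfold pf1; generalize PP1 (uu r) = Z; unfold uu; ring

lemma pf_deriv2 (r : ℝ) (h1 : -1 < r) (h2 : r ≠ 2) :
    HasDerivAt (fun r => r*(3-r)*(1+r)*(2-r) * pf1 r) (2*r*(2-r) * pf r) r := by
  simp_rw [pf_A]
  have := ((PP_deriv2 _ (uu_lt r h1 h2)).comp r (uu_deriv r)).const_mul 12
  refine this.congr_deriv ?_
  unfold pf; ring

lemma pf_pos (r : ℝ) (h1 : -1 < r) (h2 : r ≠ 2) : 0 < pf r := PP_pos _ (uu_lt r h1 h2)
lemma pf_zero : pf 0 = 1 := by unfold pf uu; norm_num; exact PP_zero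
lemma pf_three : pf 3 = 1 := by unfold pf uu; norm_num; exact PP_zero

/-- the symmetry relation -/
lemma pf_W (r : ℝ) (hr : 2 < r) : pf ((r-3)/(r-1)) = (r-1)/2 * pf r := by
  have hlo : ∀ x ∈ Ioi (2:ℝ), -1 < (x-3)/(x-1) := fun x hx => by
    have : 0 < x - 1 := by linarith [hx.out]
    rw [lt_div_iff₀ this]; linarith [hx.out]
  have hhi : ∀ x ∈ Ioi (2:ℝ), (x-3)/(x-1) ≠ 2 := fun x hx => by
    have : 0 < x - 1 := by linarith [hx.out]
    rw [Ne, div_eq_iff this.ne']; intro h; linarith [hx.out]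
  have dm : ∀ x ∈ Ioi (2:ℝ), HasDerivAt (fun x : ℝ => (x-3)/(x-1)) (2/(x-1)^2) x := fun x hx => by
    have : 0 < x - 1 := by linarith [hx.out]
    refine (((hasDerivAt_id x).sub_const 3).div ((hasDerivAt_id x).sub_const 1) this.ne').congr_deriv ?_
    simp only [id]; congr 1; ring
  have di : ∀ x ∈ Ioi (2:ℝ), HasDerivAt (fun x : ℝ => 2/(x-1)) (-2/(x-1)^2) x := fun x hx => by
    have : 0 < x - 1 := by linarith [hx.out]
    refine ((hasDerivAt_const x (2:ℝ)).div ((hasDerivAt_id x).sub_const 1) this.ne').congr_deriv ?_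
    simp only [id]; congr 1; ring
  have hW := wronsk (a := fun r => r*(3-r)*(1+r)*(2-r)) (b := fun r => 2*r*(2-r))
    (f := fun x => 2/(x-1) * pf ((x-3)/(x-1)))
    (f' := fun x => -2/(x-1)^2 * pf ((x-3)/(x-1)) + 2/(x-1) * (pf1 ((x-3)/(x-1)) * (2/(x-1)^2)))
    (g := pf) (g' := pf1) (s := Ioi 2) ordConnected_Ioi 3 (by norm_num [mem_Ioi]) (by norm_num) ?_
    (fun x hx => (di x hx).mul (HasDerivAt.comp (h₂ := pf) x (pf_deriv _ (hlo x hx) (hhi x hx)) (dm x hx)))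
    (fun x hx => pf_deriv x (by linarith [hx.out]) hx.out.ne')
    ?_ (fun x hx => pf_deriv2 x (by linarith [hx.out]) hx.out.ne')
    (fun x hx => (pf_pos x (by linarith [hx.out]) hx.out.ne').ne') (by norm_num [pf_three, pf_zero]) r hr
  · have : 0 < r - 1 := by linarith
    rw [← hW]; field_simp
  · intro x hx hne
    have : (2:ℝ) < x := hx
    have h3 : 3 - x ≠ 0 := sub_ne_zero.mpr hne.symm
    have h2 : 2 - x ≠ 0 := by linarith [hx.out] |> fun h : 2 - x < 0 => h.ne
    have h1 : 1 + x ≠ 0 := by positivity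
    have h0 : x ≠ 0 := by positivity
    positivity
  · intro x hx
    have hx1 : 0 < x - 1 := by linarith [hx.out]
    have e : ∀ y ∈ Ioi (2:ℝ), y*(3-y)*(1+y)*(2-y) * (-2/(y-1)^2 * pf ((y-3)/(y-1)) + 2/(y-1) * (pf1 ((y-3)/(y-1)) * (2/(y-1)^2)))
      = (-2 * (y*(3-y)*(1+y)*(2-y))/(y-1)^2) * pf ((y-3)/(y-1)) + (y-1) *
        (((y-3)/(y-1))*(3-((y-3)/(y-1)))*(1+((y-3)/(y-1)))*(2-((y-3)/(y-1))) * pf1 ((y-3)/(y-1))) := by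
      intro y hy
      have : 0 < y - 1 := by linarith [hy.out]
      generalize hZ : pf1 ((y-3)/(y-1)) = Z
      generalize pf ((y-3)/(y-1)) = Z2
      field_simp
      ring
    have dp : HasDerivAt (fun y : ℝ => -2 * (y*(3-y)*(1+y)*(2-y))/(y-1)^2)
        (-2 * (6 + 2*x - 12*x^2 + 4*x^3)/(x-1)^2 + 4 * (x*(3-x)*(1+x)*(2-x))/(x-1)^3) x := by
      have i := hasDerivAt_id x
      have := ((((i.mul (i.const_sub 3)).mul (i.const_add 1)).mul (i.const_sub 2)).const_mul (-2)).div
        ((i.sub_const 1).pow 2) (pow_ne_zero 2 hx1.ne')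
      refine this.congr_deriv ?_
      simp only [id, Pi.mul_apply, Pi.pow_apply]
      field_simp; ring
    have d := (dp.mul ((pf_deriv _ (hlo x hx) (hhi x hx)).comp x (dm x hx))).add
      (((hasDerivAt_id x).sub_const 1).mul ((pf_deriv2 _ (hlo x hx) (hhi x hx)).comp x (dm x hx)))
    have d2 := d.congr_of_eventuallyEq (Filter.eventually_of_mem (Ioi_mem_nhds hx.out) e)
    refine d2.congr_deriv ?_
    simp only [Function.comp, id]
    generalize hZ : pf1 ((x-3)/(x-1)) = Z
    generalize pf ((x-3)/(x-1)) = Z2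
    field_simp
    ring

noncomputable def QE (y w : ℝ) : ℝ := (1 + y + 2 * cosh w)^2 + 4*y
noncomputable def fe0 (y w : ℝ) : ℝ := QE y w ^ (-(1/2):ℝ)
noncomputable def fe1 (y w : ℝ) : ℝ := -(3+y+2*cosh w) / QE y w * QE y w ^ (-(1/2):ℝ)
noncomputable def fe2 (y w : ℝ) : ℝ :=
  (-1 / QE y w + 3 * (3+y+2*cosh w)^2 / QE y w ^ 2) * QE y w ^ (-(1/2):ℝ)

lemma QE_low (ε : ℝ) (h0 : 0 < ε) (h1 : ε ≤ 1) (y : ℝ) (hy : ε - 1 ≤ y) (w : ℝ) :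
    ε * cosh w ^ 2 ≤ QE y w := by
  have hc := Real.one_le_cosh w
  unfold QE
  have h : 0 ≤ y + 1 - ε := by linarith
  nlinarith [mul_nonneg h (by linarith : (0:ℝ) ≤ cosh w), sq_nonneg (y+1), mul_nonneg h0.le (by linarith : (0:ℝ) ≤ cosh w - 1), mul_nonneg (by linarith : 0 ≤ 1 - ε) (by nlinarith : 0 ≤ cosh w^2 - 1)]

lemma QE_pos (y : ℝ) (hy : -1 < y) (w : ℝ) : 0 < QE y w := by
  have := QE_low (min 1 (y+1)) (by simp; linarith) (min_le_left _ _) y (by linarith [min_le_right 1 (y+1)]) w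
  have h2 : 0 < min 1 (y+1) := by simp; linarith
  have := cosh_pos w
  nlinarith [mul_pos h2 (pow_pos this 2)]

lemma QE_dy (y w : ℝ) : HasDerivAt (fun y => QE y w) (2 * (3+y+2*cosh w)) y := by
  have := ((((hasDerivAt_id y).const_add 1).add_const (2 * cosh w)).pow 2).add ((hasDerivAt_id y).const_mul 4)
  refine this.congr_deriv ?_
  simp; ring

lemma QE_dw (y w : ℝ) : HasDerivAt (fun w => QE y w) (4 * (1+y+2*cosh w) * sinh w) w := by
  have := (((((Real.hasDerivAt_cosh w).const_mul 2).const_add (1+y))).pow 2).add_const (4*y)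
  refine this.congr_deriv ?_
  simp; ring

lemma fe0_dy (y : ℝ) (hy : -1 < y) (w : ℝ) : HasDerivAt (fun y => fe0 y w) (fe1 y w) y := by
  have hQ := QE_pos y hy w
  have := (QE_dy y w).rpow_const (p := -(1/2)) (Or.inl hQ.ne')
  refine this.congr_deriv ?_
  rw [Real.rpow_sub_one hQ.ne']; unfold fe1
  field_simp

lemma fe1_dy (y : ℝ) (hy : -1 < y) (w : ℝ) : HasDerivAt (fun y => fe1 y w) (fe2 y w) y := by
  have hQ := QE_pos y hy w
  have := ((((((hasDerivAt_id y).const_add 3).add_const (2 * cosh w)).neg).div (QE_dy y w) hQ.ne').mul (fe0_dy y hy w))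
  refine this.congr_deriv ?_
  simp only [id, fe0, fe1, fe2, Pi.neg_apply, Pi.div_apply]
  generalize QE y w ^ (-(1/2):ℝ) = Z
  field_simp
  ring

lemma QE_cont (y : ℝ) : Continuous (QE y) := by unfold QE; fun_prop

lemma fe0_cont (y : ℝ) (hy : -1 < y) : Continuous (fe0 y) :=
  (QE_cont y).rpow_const fun w => Or.inl (QE_pos y hy w).ne'

lemma fe1_cont (y : ℝ) (hy : -1 < y) : Continuous (fe1 y) := by
  refine Continuous.mul (Continuous.div ?_ (QE_cont y) fun w => (QE_pos y hy w).ne') (fe0_cont y hy)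
  fun_prop

lemma fe2_cont (y : ℝ) (hy : -1 < y) : Continuous (fe2 y) := by
  refine Continuous.mul (Continuous.add (Continuous.div continuous_const (QE_cont y) fun w => (QE_pos y hy w).ne')
    (Continuous.div ?_ ((QE_cont y).pow 2) fun w => (pow_pos (QE_pos y hy w) 2).ne')) (fe0_cont y hy)
  fun_prop

lemma fe_bounds (ε B : ℝ) (h0 : 0 < ε) (h1 : ε ≤ 1) : ∃ C : ℝ, 0 ≤ C ∧ ∀ y ∈ Icc (ε-1) B, ∀ w : ℝ,
    |fe0 y w| ≤ C * (2 * exp (-w)) ∧ |fe1 y w| ≤ C * (2 * exp (-w)) ∧ |fe2 y w| ≤ C * (2 * exp (-w))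
    ∧ cosh w ^ 2 / QE y w ≤ C := by
  set K : ℝ := (5+B)^2/ε + 1/ε with hK
  have hK0 : 0 ≤ K := by positivity
  refine ⟨ (1 + K + (K + 3*K^2)) * ε^(-(1/2):ℝ) + K, by positivity, fun y hy w => ?_⟩
  have hy1 : -1 < y := by linarith [hy.1]
  have hQ := QE_pos y hy1 w
  have hQl := QE_low ε h0 h1 y hy.1 w
  have hc := Real.one_le_cosh w
  have f0b : fe0 y w ≤ ε^(-(1/2):ℝ) * (2 * exp (-w)) := by
    unfold fe0
    calc _ ≤ (ε * cosh w^2)^(-(1/2):ℝ) := rpow_le_rpow_of_nonpos (by positivity) hQl (by norm_num)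
      _ ≤ ε^(-(1/2):ℝ) * (cosh w)⁻¹ := pow_cosh_le ε h0 (1/2) le_rfl w
      _ ≤ _ := by gcongr; exact inv_cosh_le w
  have f0p : 0 < fe0 y w := by unfold fe0; positivity
  set T := 3 + y + 2 * cosh w with hT
  have hT1 : 1 ≤ T := by linarith
  have hB : y ≤ B := hy.2
  have hT2 : T ≤ (5+B) * cosh w := by nlinarith
  have hTQ : T^2 / QE y w ≤ K := by
    rw [div_le_iff₀ hQ]
    have : T^2 ≤ (5+B)^2 * cosh w^2 := by rw [← mul_pow]; exact pow_le_pow_left₀ (by linarith) hT2 2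
    have e : (5+B)^2 * cosh w^2 = (5+B)^2/ε * (ε * cosh w^2) := by field_simp
    have : (5+B)^2/ε * (ε * cosh w^2) ≤ (5+B)^2/ε * QE y w := by gcongr
    have : 0 ≤ 1/ε * QE y w := by positivity
    rw [hK]; nlinarith
  have h1Q : 1 / QE y w ≤ T^2 / QE y w := by gcongr; nlinarith
  have hTQ1 : T / QE y w ≤ K := le_trans (by gcongr; nlinarith) hTQ
  have hcQ : cosh w ^ 2 / QE y w ≤ K := by
    rw [div_le_iff₀ hQ, hK]
    have : 1/ε * (ε * cosh w^2) ≤ 1/ε * QE y w := by gcongr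
    have e : 1/ε * (ε * cosh w^2) = cosh w^2 := by field_simp
    have : 0 ≤ (5+B)^2/ε * QE y w := by positivity
    nlinarith
  set M := ε^(-(1/2):ℝ) with hM
  have hMp : 0 < M := by positivity
  have hE := exp_pos (-w)
  have a1 : |fe1 y w| ≤ K * fe0 y w := by
    change |(-T) / QE y w * fe0 y w| ≤ _
    rw [abs_mul, abs_of_pos f0p, neg_div, abs_neg, abs_of_pos (by positivity)]; gcongr
  have a2 : |fe2 y w| ≤ (K + 3*K^2) * fe0 y w := by
    change |(-1 / QE y w + 3 * T^2 / QE y w ^ 2) * fe0 y w| ≤ _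
    rw [abs_mul, abs_of_pos f0p]; gcongr
    have e : 3 * T^2 / QE y w ^ 2 = 3 * ((T / QE y w)^2) := by ring
    have : (T / QE y w)^2 ≤ K^2 := pow_le_pow_left₀ (by positivity) hTQ1 2
    have : 0 < 1 / QE y w := by positivity
    have : 0 ≤ (T / QE y w)^2 := by positivity
    rw [e, neg_div, abs_le]; constructor <;> nlinarith
  have k1 : 0 ≤ K * M := by positivity
  have k2 : 0 ≤ K^2 * M := by positivity
  have k0 : 0 ≤ 2 * exp (-w) := by positivity
  have e : (1 + K + (K + 3*K^2)) * M + K = M + 2 * (K * M) + 3 * (K^2 * M) + K := by ring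
  rw [e]
  clear_value K M T
  refine ⟨?_, ?_, ?_, ?_⟩
  · rw [abs_of_pos f0p]; exact f0b.trans (mul_le_mul_of_nonneg_right (by linarith) k0)
  · refine a1.trans ((mul_le_mul_of_nonneg_left f0b hK0).trans ?_)
    rw [← mul_assoc]; exact mul_le_mul_of_nonneg_right (by linarith) k0
  · refine a2.trans ((mul_le_mul_of_nonneg_left f0b (by positivity)).trans ?_)
    rw [← mul_assoc]; refine mul_le_mul_of_nonneg_right ?_ k0
    rw [add_mul, mul_assoc]; linarith
  · linarith

lemma exp_int1 (C : ℝ) : IntegrableOn (fun w : ℝ => C * (2 * exp (-w))) (Ioi 0) :=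
  ((integrableOn_exp_neg_Ioi 0).const_mul 2).const_mul C

lemma fe_ints (y : ℝ) (hy : -1 < y) : IntegrableOn (fe0 y) (Ioi 0) ∧ IntegrableOn (fe1 y) (Ioi 0) ∧ IntegrableOn (fe2 y) (Ioi 0) := by
  obtain ⟨C, hC, h⟩ := fe_bounds (min 1 (y+1)) y (by simp; linarith) (min_le_left _ _)
  have hh := h y ⟨by linarith [min_le_right 1 (y+1)], le_rfl⟩
  exact ⟨Integrable.mono' (exp_int1 C) (fe0_cont y hy).aestronglyMeasurable (Filter.Eventually.of_forall fun w => (hh w).1),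
    Integrable.mono' (exp_int1 C) (fe1_cont y hy).aestronglyMeasurable (Filter.Eventually.of_forall fun w => (hh w).2.1),
    Integrable.mono' (exp_int1 C) (fe2_cont y hy).aestronglyMeasurable (Filter.Eventually.of_forall fun w => (hh w).2.2.1)⟩

noncomputable def F3 (y : ℝ) : ℝ := ∫ w in Ioi (0:ℝ), fe0 y w
noncomputable def F31 (y : ℝ) : ℝ := ∫ w in Ioi (0:ℝ), fe1 y w
noncomputable def F32 (y : ℝ) : ℝ := ∫ w in Ioi (0:ℝ), fe2 y w

lemma F3_derivs (y : ℝ) (hy : -1 < y) : HasDerivAt F3 (F31 y) y ∧ HasDerivAt F31 (F32 y) y := by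
  obtain ⟨C, hC, h⟩ := fe_bounds (min 1 ((y+1)/2)) (y+1) (by simp; linarith) (min_le_left _ _)
  have hs : Ioo ((y+1)/2 - 1) (y+1) ∈ nhds y := Ioo_mem_nhds (by linarith) (by linarith)
  have hb : ∀ x ∈ Ioo ((y+1)/2 - 1) (y+1), x ∈ Icc (min 1 ((y+1)/2) - 1) (y+1) := fun x hx =>
    ⟨by linarith [min_le_right 1 ((y+1)/2), hx.1], hx.2.le⟩
  have hl : ∀ x ∈ Ioo ((y+1)/2 - 1) (y+1), -1 < x := fun x hx => by linarith [hx.1]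
  have hi := fe_ints y hy
  constructor
  · refine (hasDerivAt_integral_of_dominated_loc_of_deriv_le (bound := fun w => C * (2 * exp (-w))) hs ?_ hi.1
      hi.2.1.aestronglyMeasurable ?_ (exp_int1 C) ?_).2
    · filter_upwards [hs] with x hx using (fe0_cont x (hl x hx)).aestronglyMeasurable
    · exact Filter.Eventually.of_forall fun w x hx => (h x (hb x hx) w).2.1
    · exact Filter.Eventually.of_forall fun w x hx => fe0_dy x (hl x hx) w
  · refine (hasDerivAt_integral_of_dominated_loc_of_deriv_le (bound := fun w => C * (2 * exp (-w))) hs ?_ hi.2.1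
      hi.2.2.aestronglyMeasurable ?_ (exp_int1 C) ?_).2
    · filter_upwards [hs] with x hx using (fe1_cont x (hl x hx)).aestronglyMeasurable
    · exact Filter.Eventually.of_forall fun w x hx => (h x (hb x hx) w).2.2.1
    · exact Filter.Eventually.of_forall fun w x hx => fe1_dy x (hl x hx) w

open Filter Topology in
lemma F3_ode (y : ℝ) (hy : -1 < y) :
    y*(y+1)*(y+9) * F32 y + (3*y^2+20*y+9) * F31 y + (y+3) * F3 y = 0 := by
  obtain ⟨i0, i1, i2⟩ := fe_ints y hy
  have hd : ∀ w ∈ Ici (0:ℝ), HasDerivAt (fun w => sinh w * (-(2*y^2+6) - 4*(y+3)*cosh w) / QE y w * fe0 y w)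
      (y*(y+1)*(y+9) * fe2 y w + (3*y^2+20*y+9) * fe1 y w + (y+3) * fe0 y w) w := by
    intro w _
    have hQ := QE_pos y hy w
    have d1 := ((QE_dw y w).rpow_const (p := -(1/2)) (Or.inl hQ.ne'))
    have d2 := (((Real.hasDerivAt_sinh w).mul (((Real.hasDerivAt_cosh w).const_mul (4*(y+3))).const_sub (-(2*y^2+6)))).div
      (QE_dw y w) hQ.ne').mul d1
    refine d2.congr_deriv ?_
    rw [Real.rpow_sub_one hQ.ne']
    simp only [Pi.mul_apply, Pi.div_apply, fe0, fe1, fe2]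
    generalize QE y w ^ (-(1/2):ℝ) = Z
    have hs := Real.sinh_sq w
    have hq : QE y w = (1 + y + 2 * cosh w)^2 + 4*y := rfl
    have hQn := hQ.ne'
    generalize QE y w = q at *
    generalize cosh w = c at *
    generalize sinh w = s at *
    field_simp
    grind
  have hint := ((i2.const_mul (y*(y+1)*(y+9))).add (i1.const_mul (3*y^2+20*y+9))).add (i0.const_mul (y+3))
  have hlim : Tendsto (fun w => sinh w * (-(2*y^2+6) - 4*(y+3)*cosh w) / QE y w * fe0 y w) atTop (𝓝 0) := by
    obtain ⟨C, hC, h⟩ := fe_bounds (min 1 (y+1)) y (by simp; linarith) (min_le_left _ _)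
    have hh := h y ⟨by linarith [min_le_right 1 (y+1)], le_rfl⟩
    have hz : Tendsto (fun w : ℝ => ((2*y^2+6) + 4*(y+3)) * C * (C * (2 * exp (-w)))) atTop (𝓝 0) := by
      have : Tendsto (fun w : ℝ => exp (-w)) atTop (𝓝 0) := Real.tendsto_exp_neg_atTop_nhds_zero
      simpa using ((this.const_mul 2).const_mul C).const_mul (((2*y^2+6) + 4*(y+3)) * C)
    refine squeeze_zero_norm' ?_ hz
    filter_upwards [eventually_ge_atTop 0] with w hw
    have hQ := QE_pos y hy w
    rw [norm_mul, Real.norm_eq_abs, Real.norm_eq_abs]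
    refine mul_le_mul ?_ (hh w).1 (abs_nonneg _) (by have : 0 < y+3 := by linarith
                                                     positivity)
    rw [abs_div, abs_of_pos hQ, abs_mul]
    have hc := Real.one_le_cosh w
    have y3 : 0 < y + 3 := by linarith
    have s1 : |sinh w| ≤ cosh w := by
      rw [abs_of_nonneg (Real.sinh_nonneg_iff.mpr hw)]; exact (Real.sinh_lt_cosh w).le
    have s2 : |(-(2*y^2+6) - 4*(y+3)*cosh w)| ≤ ((2*y^2+6) + 4*(y+3)) * cosh w := by
      rw [abs_le]; constructor <;> nlinarith [mul_nonneg y3.le (by linarith : 0 ≤ cosh w), sq_nonneg y]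
    calc _ ≤ cosh w * (((2*y^2+6) + 4*(y+3)) * cosh w) / QE y w := by gcongr
      _ = ((2*y^2+6) + 4*(y+3)) * (cosh w^2 / QE y w) := by ring
      _ ≤ _ := by gcongr; exact (hh w).2.2.2
  have h := integral_Ioi_of_hasDerivAt_of_tendsto' hd hint hlim
  rw [integral_add, integral_add, integral_const_mul, integral_const_mul, integral_const_mul] at h
  · unfold F3 F31 F32; rw [h]; simp
  · exact i2.const_mul _
  · exact i1.const_mul _
  · exact (i2.const_mul _).add (i1.const_mul _)
  · exact i0.const_mul _

lemma F3_zero : F3 0 = π / (3 * √3) := by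
  rw [← F30_int]; unfold F3 fe0 QE
  congr 1; ext w
  have := cosh_pos w
  rw [Real.rpow_neg (by positivity), ← sqrt_eq_rpow, mul_zero, add_zero, Real.sqrt_sq (by positivity), add_zero, one_div]

lemma F3_eq (y : ℝ) (hy : -1 < y) : F3 y = π / √3 * (1/(3+y) * pf (2*y/(3+y))) := by
  have h3 : ∀ x ∈ Ioi (-1:ℝ), 0 < 3 + x := fun x hx => by linarith [hx.out]
  have hlo : ∀ x ∈ Ioi (-1:ℝ), -1 < 2*x/(3+x) := fun x hx => by
    rw [lt_div_iff₀ (h3 x hx)]; linarith [hx.out]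
  have hhi : ∀ x ∈ Ioi (-1:ℝ), 2*x/(3+x) ≠ 2 := fun x hx => by
    rw [Ne, div_eq_iff (h3 x hx).ne']; intro h; linarith [hx.out]
  have dm : ∀ x ∈ Ioi (-1:ℝ), HasDerivAt (fun x : ℝ => 2*x/(3+x)) (6/(3+x)^2) x := fun x hx => by
    refine (((hasDerivAt_id x).const_mul 2).div ((hasDerivAt_id x).const_add 3) (h3 x hx).ne').congr_deriv ?_
    simp only [id]; congr 1; ring
  have di : ∀ x ∈ Ioi (-1:ℝ), HasDerivAt (fun x : ℝ => 1/(3+x)) (-1/(3+x)^2) x := fun x hx => by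
    refine ((hasDerivAt_const x (1:ℝ)).div ((hasDerivAt_id x).const_add 3) (h3 x hx).ne').congr_deriv ?_
    simp only [id]; congr 1; ring
  have hpi : π / √3 ≠ 0 := by have := pi_pos; positivity
  refine wronsk (a := fun y => y*(y+1)*(y+9)) (b := fun y => -(y+3))
    (g := fun x => π / √3 * (1/(3+x) * pf (2*x/(3+x))))
    (g' := fun x => π / √3 * (-1/(3+x)^2 * pf (2*x/(3+x)) + 1/(3+x) * (pf1 (2*x/(3+x)) * (6/(3+x)^2))))
    (f := F3) (f' := F31) (s := Ioi (-1)) ordConnected_Ioi 0 (by norm_num [mem_Ioi]) (by norm_num) ?_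
    (fun x hx => (F3_derivs x hx).1)
    (fun x hx => ((di x hx).mul (HasDerivAt.comp (h₂ := pf) x (pf_deriv _ (hlo x hx) (hhi x hx)) (dm x hx))).const_mul _)
    ?_ ?_ ?_ ?_ y hy
  · intro x hx hne
    have : (-1:ℝ) < x := hx
    have h1 : x + 1 ≠ 0 := by linarith |> fun h : 0 < x + 1 => h.ne'
    have h2 : x + 9 ≠ 0 := by linarith |> fun h : 0 < x + 9 => h.ne'
    positivity
  · intro x hx
    have i := hasDerivAt_id x
    refine (((i.mul (i.add_const 1)).mul (i.add_const 9)).mul (F3_derivs x hx).2).congr_deriv ?_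
    simp only [id, Pi.mul_apply]
    linear_combination F3_ode x hx
  · intro x hx
    have hx1 := h3 x hx
    have e : ∀ y ∈ Ioi (-1:ℝ), y*(y+1)*(y+9) * (π / √3 * (-1/(3+y)^2 * pf (2*y/(3+y)) + 1/(3+y) * (pf1 (2*y/(3+y)) * (6/(3+y)^2))))
      = π / √3 * ((-1 * (y*(y+1)*(y+9))/(3+y)^2) * pf (2*y/(3+y)) + (3+y)/6 *
        ((2*y/(3+y))*(3-(2*y/(3+y)))*(1+(2*y/(3+y)))*(2-(2*y/(3+y))) * pf1 (2*y/(3+y)))) := by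
      intro y hy
      have : 0 < 3 + y := h3 y hy
      generalize hZ : pf1 (2*y/(3+y)) = Z
      generalize pf (2*y/(3+y)) = Z2
      generalize π / √3 = Z3
      field_simp
      ring
    have dp : HasDerivAt (fun y : ℝ => -1 * (y*(y+1)*(y+9))/(3+y)^2)
        (-1 * (3*x^2+20*x+9)/(3+x)^2 + 2 * (x*(x+1)*(x+9))/(3+x)^3) x := by
      have i := hasDerivAt_id x
      have := ((((i.mul (i.add_const 1)).mul (i.add_const 9))).const_mul (-1)).div
        ((i.const_add 3).pow 2) (pow_ne_zero 2 hx1.ne')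
      refine this.congr_deriv ?_
      simp only [id, Pi.mul_apply, Pi.pow_apply]
      field_simp; ring
    have d := ((dp.mul (HasDerivAt.comp (h₂ := pf) x (pf_deriv _ (hlo x hx) (hhi x hx)) (dm x hx))).add
      ((((hasDerivAt_id x).const_add 3).div_const 6).mul ((pf_deriv2 _ (hlo x hx) (hhi x hx)).comp x (dm x hx)))).const_mul (π / √3)
    have d2 := d.congr_of_eventuallyEq (Filter.eventually_of_mem (Ioi_mem_nhds hx.out) e)
    refine d2.congr_deriv ?_
    simp only [Function.comp, id]
    generalize hZ : pf1 (2*x/(3+x)) = Z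
    generalize pf (2*x/(3+x)) = Z2
    generalize π / √3 = Z3
    field_simp
    ring
  · intro x hx
    have := pf_pos _ (hlo x hx) (hhi x hx)
    have := h3 x hx
    have := pi_pos
    positivity
  · simp [F3_zero, pf_zero]; ring

noncomputable def psr (c : ℕ → ℝ) (v : ℝ) : ℝ := ∑' n, c n * v^n

lemma psr_summable (c : ℕ → ℝ) (k : ℕ) (hc : ∀ n, |c n| ≤ (n+1:ℝ)^k) (v : ℝ) (hv : |v| < 1) :
    Summable (fun n => ‖c n * v^n‖) := by
  by_cases h0 : v = 0
  · subst h0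
    refine summable_of_ne_finset_zero (s := {0}) fun n hn => ?_
    simp at hn; simp [hn]
  have h := summable_pow_mul_geometric_of_norm_lt_one (R := ℝ) k (r := |v|) (by simpa using hv)
  have h2 := ((summable_nat_add_iff 1).mpr h).mul_left (|v|⁻¹)
  refine Summable.of_nonneg_of_le (fun _ => norm_nonneg _) (fun n => ?_) h2
  have hp : 0 < |v| := abs_pos.mpr h0
  rw [norm_mul, norm_pow, Real.norm_eq_abs, Real.norm_eq_abs]
  have e : |v|⁻¹ * (((n+1:ℕ):ℝ)^k * |v|^(n+1)) = (n+1:ℝ)^k * |v|^n := by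
    push_cast; field_simp; ring
  rw [e]; gcongr; exact hc n

lemma psr_deriv (c : ℕ → ℝ) (k : ℕ) (hc : ∀ n, |c n| ≤ (n+1:ℝ)^k) (v : ℝ) (hv : |v| < 1) :
    HasDerivAt (psr c) (psr (fun n => ((n:ℝ)+1) * c (n+1)) v) v := by
  obtain ⟨r, hr1, hr2⟩ := exists_between hv
  have hr0 : 0 < r := lt_of_le_of_lt (abs_nonneg v) hr1
  have hs := psr_summable (fun n => ((n:ℝ)+1)^(k+1)) (k+1) (fun n => by rw [abs_of_nonneg (by positivity)]) r (by rwa [abs_of_pos hr0])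
  have hs2 : Summable (fun n : ℕ => r⁻¹ * ‖((n:ℝ)+1)^(k+1) * r^n‖) := hs.mul_left _
  have hterm : ∀ (n : ℕ) (y : ℝ), |y| ≤ r → ‖c n * (n * y^(n-1))‖ ≤ r⁻¹ * ‖((n:ℝ)+1)^(k+1) * r^n‖ := by
    intro n y hy'
    rcases n with _ | n
    · simp; positivity
    · rw [norm_of_nonneg (show (0:ℝ) ≤ (((n+1:ℕ):ℝ)+1)^(k+1) * r^(n+1) by positivity), norm_mul, norm_mul, norm_pow]
      simp only [Nat.add_sub_cancel, Real.norm_eq_abs]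
      have e : r⁻¹ * ((((n+1:ℕ):ℝ)+1)^(k+1) * r^(n+1)) = (((n+1:ℕ):ℝ)+1)^k * ((((n+1:ℕ):ℝ)+1) * r^n) := by
        field_simp; ring
      rw [e]
      gcongr
      · exact hc _
      · rw [abs_of_nonneg (by positivity)]; linarith
  have key := hasDerivAt_tsum_of_isPreconnected (g := fun n v => c n * v^n) (g' := fun n v => c n * (n * v^(n-1)))
    (t := Ioo (-r) r) (y₀ := 0) (y := v) hs2 isOpen_Ioo isPreconnected_Ioo
    (fun n y _ => (hasDerivAt_pow n y).const_mul (c n)) (fun n y hy => hterm n y (abs_lt.mpr hy).le) ⟨by linarith, hr0⟩ ?_ (abs_lt.mp hr1)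
  · refine key.congr_deriv ?_
    unfold psr
    have hsum : Summable (fun n : ℕ => c n * (n * v^(n-1))) :=
      Summable.of_norm_bounded hs2 fun n => hterm n v hr1.le
    rw [hsum.tsum_eq_zero_add]
    simp only [Nat.cast_zero, zero_mul, mul_zero, zero_add, Nat.add_sub_cancel]
    apply tsum_congr; intro n; push_cast; ring
  · refine summable_of_ne_finset_zero (s := {0}) fun n hn => ?_
    simp at hn; simp [hn]

noncomputable def gc (n : ℕ) : ℝ := ris (1/6) n * ris (1/3) n / (ris 1 n)^2

lemma gc_zero : gc 0 = 1 := by simp [gc, ris_zero]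
lemma gc_succ (n : ℕ) : ((n:ℝ)+1)^2 * gc (n+1) = (n + 1/6) * (n+1/3) * gc n := by
  unfold gc; rw [ris_succ, ris_succ, ris_succ]
  have := ris_pos 1 one_pos n
  have : (0:ℝ) < n + 1 := by positivity
  field_simp; ring
lemma gc_pos (n : ℕ) : 0 < gc n := by
  have := ris_pos 1 one_pos n
  have := ris_pos (1/6) (by norm_num) n
  have := ris_pos (1/3) (by norm_num) n
  unfold gc; positivity
lemma gc_le (n : ℕ) : gc n ≤ 1 := by
  induction n with
  | zero => rw [gc_zero]
  | succ n ih =>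
    have h := gc_succ n
    have hp := gc_pos n
    have hn : (0:ℝ) ≤ n := Nat.cast_nonneg n
    have : ((n:ℝ)+1)^2 * gc (n+1) ≤ ((n:ℝ)+1)^2 * 1 := by rw [h]; nlinarith [mul_nonneg hn hp.le]
    exact le_of_mul_le_mul_left this (by positivity)

noncomputable def fcoef (n : ℕ) : ℝ := ris (1/3) n * ris (1/2) n * ris (2/3) n / (ris 1 n)^3

lemma fcoef_succ (n : ℕ) : ((n:ℝ)+1)^3 * fcoef (n+1) = (n + 1/3) * (n+1/2) * (n+2/3) * fcoef n := by
  unfold fcoef; rw [ris_succ, ris_succ, ris_succ, ris_succ]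
  have := ris_pos 1 one_pos n
  have : (0:ℝ) < n + 1 := by positivity
  field_simp; ring

open PowerSeries in
lemma clausen (n : ℕ) : ∑ kl ∈ Finset.HasAntidiagonal.antidiagonal n, gc kl.1 * gc kl.2 = fcoef n := by
  set g : PowerSeries ℝ := PowerSeries.mk gc with hg
  set D := PowerSeries.derivative ℝ with hD
  set θ : PowerSeries ℝ → PowerSeries ℝ := fun f => X * D f with hθ
  have cθ : ∀ f n, coeff n (θ f) = n * coeff n f := by
    intro f n
    rcases n with _ | n
    · simp [hθ]
    · simp only [hθ]; rw [coeff_succ_X_mul, hD, coeff_derivative]; push_cast; ring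
  have θmul : ∀ f g, θ (f * g) = θ f * g + f * θ g := by
    intro f g; simp only [hθ, Derivation.leibniz, smul_eq_mul]; ring
  have θadd : ∀ f g, θ (f + g) = θ f + θ g := by
    intro f g; simp only [hθ, map_add]; ring
  have θX : θ X = X := by simp [hθ, hD]
  have θC : ∀ r : ℝ, θ (C r) = 0 := by intro r; simp [hθ, hD]
  clear_value θ
  have hode : θ (θ g) = X * (θ (θ g) + C (1/2) * θ g + C (1/18) * g) := by
    ext n
    rw [cθ, cθ]
    rcases n with _ | n
    · simp
    · rw [coeff_succ_X_mul]
      simp only [map_add, coeff_C_mul, cθ, hg, coeff_mk]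
      have := gc_succ n
      push_cast
      linear_combination this
  have hode2 := congrArg θ hode
  rw [θmul, θX, θadd, θadd, θmul, θmul, θC, θC] at hode2
  set g1 := θ g
  set g2 := θ g1
  set g3 := θ g2
  have c1 : C (1/2 : ℝ) * 2 = 1 := by
    rw [show (2 : PowerSeries ℝ) = C (2:ℝ) from (map_ofNat C 2).symm, ← map_mul]; norm_num
  have c2 : C (1/18 : ℝ) * 18 = 1 := by
    rw [show (18 : PowerSeries ℝ) = C (18:ℝ) from (map_ofNat C 18).symm, ← map_mul]; norm_num
  have c3 : C (1/9 : ℝ) * 9 = 1 := by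
    rw [show (9 : PowerSeries ℝ) = C (9:ℝ) from (map_ofNat C 9).symm, ← map_mul]; norm_num
  have hG : θ (θ (θ (g*g))) = X * (θ (θ (θ (g*g))) + 3 * C (1/2) * θ (θ (g*g)) + 13 * C (1/18) * θ (g*g) + C (1/9) * (g*g)) := by
    have e1 : θ (g*g) = 2 * (g * g1) := by rw [θmul]; ring
    have e2 : θ (θ (g*g)) = 2 * (g1*g1 + g*g2) := by
      rw [e1, two_mul, θadd, θmul]; ring
    have e3 : θ (θ (θ (g*g))) = 2 * (3 * g1 * g2 + g*g3) := by
      rw [e2, two_mul, θadd, θadd, θmul, θmul]; ring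
    rw [e3, e2, e1]
    have d1 : C (1/2 : ℝ) = 9 * C (1/18:ℝ) := by
      rw [show (9 : PowerSeries ℝ) = C (9:ℝ) from (map_ofNat C 9).symm, ← map_mul]; norm_num
    have d2 : C (1/9 : ℝ) = 2 * C (1/18:ℝ) := by
      rw [show (2 : PowerSeries ℝ) = C (2:ℝ) from (map_ofNat C 2).symm, ← map_mul]; norm_num
    rw [d1] at hode hode2
    rw [d1, d2]
    linear_combination 6 * g1 * hode + 2 * g * hode2 - 2 * X * g * g2 * c2
  have hrec : ∀ n : ℕ, ((n:ℝ)+1)^3 * coeff (n+1) (g*g) = (n + 1/3) * (n+1/2) * (n+2/3) * coeff n (g*g) := by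
    intro n
    have h := congrArg (coeff (n+1)) hG
    rw [cθ, cθ, cθ, coeff_succ_X_mul] at h
    rw [show (3 : PowerSeries ℝ) * C (1/2) = C (3/2) by rw [show (3 : PowerSeries ℝ) = C (3:ℝ) from (map_ofNat C 3).symm, ← map_mul]; norm_num,
      show (13 : PowerSeries ℝ) * C (1/18) = C (13/18) by rw [show (13 : PowerSeries ℝ) = C (13:ℝ) from (map_ofNat C 13).symm, ← map_mul]; norm_num] at h
    simp only [map_add, coeff_C_mul, cθ] at h
    push_cast at h
    linear_combination h
  have hc : ∀ n, coeff n (g*g) = fcoef n := by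
    intro n
    induction n with
    | zero => simp [hg, gc_zero, fcoef, ris_zero]
    | succ n ih =>
      have h1 := hrec n
      rw [ih, ← fcoef_succ] at h1
      exact mul_left_cancel₀ (by positivity) h1
  rw [← hc n, coeff_mul]
  simp [hg]

lemma gc_bd (n : ℕ) : |gc n| ≤ (n+1:ℝ)^0 := by
  rw [abs_of_pos (gc_pos n), pow_zero]; exact gc_le n

lemma clausen_sum (v : ℝ) (hv : |v| < 1) : psr gc v ^ 2 = ∑' n, fcoef n * v^n := by
  have hs := psr_summable gc 0 gc_bd v hv
  rw [sq]; unfold psr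
  rw [tsum_mul_tsum_eq_tsum_sum_antidiagonal_of_summable_norm hs hs]
  apply tsum_congr; intro n
  rw [← clausen, Finset.sum_mul]
  apply Finset.sum_congr rfl
  intro kl hkl
  rw [← Finset.HasAntidiagonal.mem_antidiagonal.mp hkl, pow_add]; ring

lemma PP_gc (u : ℝ) (h0 : -(1/10) < u) (h1 : u < 1/2) : PP u = psr gc (4*u*(1-u)) := by
  have hv : ∀ u ∈ Ioo (-(1/10):ℝ) (1/2), |4*u*(1-u)| < 1 := by
    intro u hu
    rw [abs_lt]; constructor <;> nlinarith [hu.1, hu.2, sq_nonneg (1-2*u)]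
  have hvd : ∀ u : ℝ, HasDerivAt (fun u : ℝ => 4*u*(1-u)) (4*(1-2*u)) u := by
    intro u
    refine (((hasDerivAt_id u).const_mul 4).mul ((hasDerivAt_id u).const_sub 1)).congr_deriv ?_
    simp; ring
  set e : ℕ → ℝ := fun n => n * gc n with he
  have hebd : ∀ n, |e n| ≤ (n+1:ℝ)^1 := by
    intro n
    rw [he, abs_of_nonneg (by have := gc_pos n; positivity), pow_one]
    have := gc_le n; have := gc_pos n
    nlinarith [Nat.cast_nonneg (α := ℝ) n]
  set g1 := psr (fun n => ((n:ℝ)+1) * gc (n+1)) with hg1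
  set E1 := psr (fun n => ((n:ℝ)+1) * e (n+1)) with hE1
  have hEg : ∀ v, |v| < 1 → psr e v = v * g1 v := by
    intro v hv
    have hs := (psr_summable e 1 hebd v hv).of_norm
    rw [hg1]; unfold psr
    rw [hs.tsum_eq_zero_add, ← tsum_mul_left]
    simp only [he, Nat.cast_zero, zero_mul, zero_add]
    apply tsum_congr; intro n; push_cast; ring
  have hE : ∀ v, |v| < 1 → E1 v = v * E1 v + 1/2 * psr e v + 1/18 * psr gc v := by
    intro v hv
    have hs := (psr_summable e 1 hebd v hv).of_norm
    have hs0 := (psr_summable gc 0 gc_bd v hv).of_norm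
    have hs2 : Summable (fun n : ℕ => (n:ℝ) * e n * v^n) := by
      refine (psr_summable (fun n => n * e n) 2 (fun n => ?_) v hv).of_norm
      rw [abs_mul, abs_of_nonneg (by positivity)]
      have := hebd n
      calc _ ≤ ((n:ℝ)+1) * (n+1)^1 := by gcongr; linarith
        _ = _ := by ring
    have h1 : v * E1 v = ∑' n : ℕ, (n:ℝ) * e n * v^n := by
      rw [hs2.tsum_eq_zero_add, hE1]; unfold psr; rw [← tsum_mul_left]
      simp only [Nat.cast_zero, zero_mul, zero_add]
      apply tsum_congr; intro n; push_cast; ring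
    rw [h1]; rw [hE1]; unfold psr
    rw [← tsum_mul_left, ← tsum_mul_left, ← hs2.tsum_add (hs.mul_left _), ← (hs2.add (hs.mul_left _)).tsum_add (hs0.mul_left _)]
    apply tsum_congr; intro n
    have := gc_succ n
    simp only [he]; push_cast
    linear_combination v^n * this
  refine (wronsk (a := fun u => u*(1-u)) (b := fun _ => 2/9) (f := fun u => psr gc (4*u*(1-u)))
    (f' := fun u => g1 (4*u*(1-u)) * (4*(1-2*u))) (g := PP) (g' := PP1) (s := Ioo (-(1/10)) (1/2)) ordConnected_Ioo 0
    (by norm_num) (by norm_num) ?_ ?_ (fun x hx => PP_deriv x (by linarith [hx.2])) ?_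
    (fun x hx => PP_deriv2 x (by linarith [hx.2])) (fun x hx => (PP_pos x (by linarith [hx.2])).ne') ?_ u ⟨h0, h1⟩).symm
  · intro x hx hne
    exact mul_ne_zero hne (by linarith [hx.2] |> fun h : 0 < 1 - x => h.ne')
  · intro x hx
    exact HasDerivAt.comp (h₂ := psr gc) x (psr_deriv gc 0 gc_bd _ (hv x hx)) (hvd x)
  · intro x hx
    have d := HasDerivAt.comp (h₂ := psr e) x (psr_deriv e 1 hebd _ (hv x hx)) (hvd x)
    have d2 := (((hasDerivAt_id x).const_mul 2).const_sub 1).mul d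
    have e1 : ∀ y ∈ Ioo (-(1/10):ℝ) (1/2), y*(1-y) * (g1 (4*y*(1-y)) * (4*(1-2*y))) = (1 - 2*y) * psr e (4*y*(1-y)) := by
      intro y hy; rw [hEg _ (hv y hy)]; ring
    have d3 := d2.congr_of_eventuallyEq (Filter.eventually_of_mem (Ioo_mem_nhds hx.1 hx.2) e1)
    refine d3.congr_deriv ?_
    have h := hE _ (hv x hx)
    simp only [Function.comp, id]
    change _ * _ + (1 - 2*x) * (E1 _ * _) = _
    linear_combination 4 * h
  · rw [PP_zero]; unfold psr
    rw [tsum_eq_single 0 (by intro n hn; simp [hn])]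
    simp [gc_zero]

noncomputable def vt (t : ℝ) : ℝ := (1-t^2)^2*(4-t^2)/4
lemma vt_int (n : ℕ) : ∫ t in (0:ℝ)..1, vt t ^ n = ris 1 n * ris (1/2) n / (ris (5/6) n * ris (7/6) n) := by
  induction n with
  | zero => simp [ris_zero]
  | succ n ih =>
    have hd : ∀ t : ℝ, HasDerivAt (fun t : ℝ => vt t ^ n * (vt t * t/6 - (2*n+2) * ((t*(3-t^2)/2)*(1-t^2/4)*(1-t^2))))
       (-(3/2) * (((2*n+2)^2 - 1/9) * vt t^(n+1) - (2*n+2)*(2*n+1) * vt t^n)) t := by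
      intro t
      have i := hasDerivAt_id t
      have i2 : HasDerivAt (fun t : ℝ => t^2) (2*t) t := by simpa using hasDerivAt_pow 2 t
      have hv : HasDerivAt vt (-(3/2) * t*(1-t^2)*(3-t^2)) t := by
        refine ((((i2.const_sub 1).pow 2).mul (i2.const_sub 4)).div_const 4).congr_deriv ?_
        simp; ring
      have hq : HasDerivAt (fun t : ℝ => vt t * t/6 - (2*n+2) * ((t*(3-t^2)/2)*(1-t^2/4)*(1-t^2)))
          (-(3/2) * t*(1-t^2)*(3-t^2) * t/6 + vt t/6 - (2*n+2) * ((12-57*t^2+40*t^4-7*t^6)/8)) t := by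
        refine (((hv.mul i).div_const 6).sub ((((((i.mul (i2.const_sub 3)).div_const 2).mul ((i2.div_const 4).const_sub 1)).mul (i2.const_sub 1))).const_mul (2*n+2:ℝ))).congr_deriv ?_
        simp only [id, Pi.mul_apply]
        ring
      have hvn : (n:ℝ) * vt t^(n-1) * vt t = n * vt t^n := by
        rcases n with _ | n
        · simp
        · simp only [Nat.add_sub_cancel]; ring
      refine ((hv.pow n).mul hq).congr_deriv ?_
      simp only [Pi.pow_apply]
      rw [pow_succ (vt t) n]
      generalize vt t ^ n = V at *
      generalize vt t ^ (n-1) = V1 at *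
      have hvt : vt t = (1-t^2)^2*(4-t^2)/4 := rfl
      rw [hvt] at hvn ⊢
      linear_combination (-(3/2) * t*(1-t^2)*(3-t^2) * t/6 + (2*n+2) * (3/4) * t^2 * (3-t^2)^2) * hvn
    have hc : ∀ m, Continuous fun t => vt t ^ m := fun m => by unfold vt; fun_prop
    have h := intervalIntegral.integral_eq_sub_of_hasDerivAt (a := 0) (b := 1) (fun t _ => hd t)
      ((continuous_const.mul ((continuous_const.mul (hc (n+1))).sub (continuous_const.mul (hc n)))).intervalIntegrable _ _)
    have i1 := (hc (n+1)).intervalIntegrable (μ := volume) 0 1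
    have i2 := (hc n).intervalIntegrable (μ := volume) 0 1
    rw [intervalIntegral.integral_const_mul, intervalIntegral.integral_sub (i1.const_mul _) (i2.const_mul _),
      intervalIntegral.integral_const_mul, intervalIntegral.integral_const_mul, ih] at h
    have e1 : vt 1 = 0 := by norm_num [vt]
    have e0 : vt 0 = 1 := by norm_num [vt]
    rw [e1, e0] at h
    norm_num at h
    have hp1 := ris_pos 1 one_pos n
    have hp5 := ris_pos (5/6) (by norm_num) n
    have hp7 := ris_pos (7/6) (by norm_num) n
    rw [ris_succ, ris_succ, ris_succ, ris_succ]
    have hn : (0:ℝ) ≤ n := Nat.cast_nonneg n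
    generalize (∫ t in (0:ℝ)..1, vt t ^ (n+1)) = Z at h ⊢
    field_simp at h ⊢
    linear_combination 2 * h

lemma fcoef_pos (n : ℕ) : 0 < fcoef n := by
  have := ris_pos 1 one_pos n
  have := ris_pos (1/3) (by norm_num) n
  have := ris_pos (1/2) (by norm_num) n
  have := ris_pos (2/3) (by norm_num) n
  unfold fcoef; positivity

lemma LR0_pos : 0 < LR 0 := by rw [G_consts.1]; have := pi_pos; positivity

lemma h_int : ∫ r in (0:ℝ)..1, pf r ^ 2 = pFq [1/3, 1/2, 1/2, 2/3] [5/6, 1, 7/6] 1 := by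
  have hvc : Continuous vt := by unfold vt; fun_prop
  have hvp : ∀ t ∈ Ioc (0:ℝ) 1, 0 ≤ vt t ∧ vt t < 1 := by
    intro t ht
    have h2 : t^2 ≤ 1 := by nlinarith [ht.1, ht.2]
    have h3 : 0 < t^2 := by have := ht.1; positivity
    unfold vt
    constructor
    · have : 0 ≤ 4 - t^2 := by linarith
      positivity
    · nlinarith [mul_pos h3 h3, mul_nonneg h3.le (sub_nonneg.mpr h2), mul_nonneg (sq_nonneg (t^2)) (sub_nonneg.mpr h2), sq_nonneg (t*(3-t^2)), mul_pos h3 (by nlinarith : 0 < (3-t^2)^2)]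
  have hint : ∀ n : ℕ, ∫ t in Ioc (0:ℝ) 1, fcoef n * vt t ^ n = (LR 0)⁻¹ * LR (0 + n) := by
    intro n
    rw [← intervalIntegral.integral_of_le (by norm_num), intervalIntegral.integral_const_mul, vt_int, LR_nat _ (by norm_num)]
    have h0 := LR0_pos
    rw [inv_mul_cancel_left₀ h0.ne']
    have := ris_pos 1 one_pos n
    have := ris_pos (5/6) (by norm_num) n
    have := ris_pos (7/6) (by norm_num) n
    norm_num [fcoef]
    field_simp
  have hs := hasSum_integral_of_summable_integral_norm (μ := volume.restrict (Ioc (0:ℝ) 1)) (F := fun n t => fcoef n * vt t^n)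
    (fun n => ((continuous_const.mul (hvc.pow n)).integrableOn_Icc (a := 0) (b := 1)).mono_set Ioc_subset_Icc_self) ?_
  · have h1 : HasSum (fun n : ℕ => (LR 0)⁻¹ * LR (0+n)) ((LR 0)⁻¹ * (LR 0 * pFq [1/3, 1/2, 1/2, 2/3] [5/6, 1, 7/6] 1)) := Lam0.mul_left _
    rw [inv_mul_cancel_left₀ LR0_pos.ne'] at h1
    simp_rw [hint] at hs
    rw [← hs.unique h1, ← intervalIntegral.integral_of_le (by norm_num)]
    have e := intervalIntegral.integral_comp_sub_left (a := 0) (b := 1) (fun r => pf r ^ 2) 1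
    norm_num at e
    rw [← e]
    apply intervalIntegral.integral_congr_ae
    refine Filter.Eventually.of_forall fun t ht => ?_
    rw [uIoc_of_le (by norm_num)] at ht
    have hv := hvp t ht
    have hw : 4 * uu (1-t) * (1 - uu (1-t)) = vt t := by unfold uu vt; ring
    have hu : uu (1-t) < 1/2 := by unfold uu; nlinarith [ht.1, ht.2, mul_pos ht.1 ht.1, mul_nonneg ht.1.le (sub_nonneg.mpr ht.2)]
    have hu0 : 0 ≤ uu (1-t) := by
      unfold uu; have : 0 ≤ 3 - (1-t) := by linarith [ht.1]
      positivity
    unfold pf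
    rw [PP_gc _ (by linarith) hu, hw, clausen_sum _ (by rw [abs_of_nonneg hv.1]; exact hv.2)]
  · have : ∀ n : ℕ, ∫ t in Ioc (0:ℝ) 1, ‖fcoef n * vt t ^ n‖ = (LR 0)⁻¹ * LR (0 + n) := by
      intro n
      rw [← hint n]
      refine setIntegral_congr_fun measurableSet_Ioc fun t ht => ?_
      have := fcoef_pos n
      have := (hvp t ht).1
      exact norm_of_nonneg (by positivity)
    simp_rw [this]
    exact (Lam0.mul_left _).summable

open Filter Topology in
lemma theta_int (a c : ℝ) (ha : 0 < a) (hc : 0 < c) :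
    ∫ θ in (0:ℝ)..(π/2), 1 / (a^2 * cos θ^2 + c^2 * sin θ^2) = π / (2*a*c) := by
  have hpos : ∀ θ : ℝ, 0 < a^2 * cos θ^2 + c^2 * sin θ^2 := by
    intro θ
    have h := Real.sin_sq_add_cos_sq θ
    by_cases h0 : cos θ = 0
    · rw [h0] at h ⊢
      have : sin θ^2 = 1 := by linarith
      rw [this]; positivity
    · positivity
  have h := intervalIntegral.integral_eq_sub_of_hasDerivAt_of_tendsto (a := 0) (b := π/2)
    (f := fun θ => Real.arctan (c/a * Real.tan θ) / (a*c))
    (f' := fun θ => 1 / (a^2 * cos θ^2 + c^2 * sin θ^2)) (fa := 0) (fb := π/2/(a*c))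
    (by positivity) ?_ ?_ ?_ ?_
  · rw [h]; field_simp; ring
  · intro x hx
    have hcx : 0 < cos x := Real.cos_pos_of_mem_Ioo ⟨by linarith [hx.1, pi_pos], hx.2⟩
    have h1 := (((Real.hasDerivAt_tan hcx.ne').const_mul (c/a)).arctan).div_const (a*c)
    refine h1.congr_deriv ?_
    have := hpos x
    rw [Real.tan_eq_sin_div_cos]
    have h3 : 1 + (c/a * (sin x / cos x))^2 = (a^2 * cos x^2 + c^2 * sin x^2)/(a^2*cos x^2) := by
      field_simp
    rw [h3]
    field_simp
  · apply Continuous.intervalIntegrable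
    exact continuous_const.div (by fun_prop) (fun θ => (hpos θ).ne')
  · have : ContinuousAt (fun θ => Real.arctan (c/a * Real.tan θ) / (a*c)) 0 := by
      have : ContinuousAt Real.tan 0 := Real.continuousAt_tan.mpr (by simp)
      exact ((Real.continuous_arctan.continuousAt.comp (continuousAt_const.mul this))).div_const _
    have h2 := this.tendsto
    simp only [Real.tan_zero, mul_zero, Real.arctan_zero, zero_div] at h2
    exact h2.mono_left nhdsWithin_le_nhds
  · have h1 : Tendsto (fun θ => c/a * Real.tan θ) (𝓝[<] (π/2)) atTop :=
      Real.tendsto_tan_pi_div_two.const_mul_atTop (by positivity)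
    exact ((Real.tendsto_arctan_atTop.mono_right nhdsWithin_le_nhds).comp h1).div_const _

lemma even_int (g : ℝ → ℝ) (hg : ∀ x, g (-x) = g x) (hi : IntegrableOn g (Ioi 0)) :
    Integrable g ∧ ∫ x, g x = 2 * ∫ x in Ioi (0:ℝ), g x := by
  have e : ∀ x, g |x| = g x := by
    intro x; rcases abs_choice x with h | h <;> rw [h]; exact hg x
  constructor
  · rw [← integrableOn_univ, ← Iic_union_Ioi (a := (0:ℝ)), integrableOn_union]
    refine ⟨?_, hi⟩
    rw [integrableOn_Iic_iff_integrableOn_Iio]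
    have h := hi.comp_neg
    simp only [hg] at h
    refine h.mono_set ?_
    intro x hx; simpa using hx
  · rw [← integral_comp_abs]; simp only [e]

lemma odd_int (g : ℝ → ℝ) (hg : ∀ x, g (-x) = - g x) : ∫ x, g x = 0 := by
  have h := integral_neg_eq_self g (volume : Measure ℝ)
  simp only [hg, integral_neg] at h
  linarith

lemma cosh_even (x : ℝ) : cosh (-x/3) = cosh (x/3) := by rw [neg_div, Real.cosh_neg]

lemma shift_B (b : ℝ) : Integrable (fun w => cosh (w/3) / cosh (w-b)) ∧
    ∫ w, cosh (w/3) / cosh (w-b) = 2 * (π/√3) * cosh (b/3) := by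
  obtain ⟨i1, e1⟩ := even_int (fun s => cosh (s/3) / cosh s)
    (fun x => by simp only [cosh_even, Real.cosh_neg]) B_int.1
  rw [B_int.2] at e1
  have i2 : Integrable (fun s => sinh (s/3) / cosh s) := by
    refine i1.mono' ?_ (Filter.Eventually.of_forall fun s => ?_)
    · apply Continuous.aestronglyMeasurable
      exact (by fun_prop : Continuous fun s => sinh (s/3)).div (by fun_prop) (fun s => (cosh_pos s).ne')
    · have h0 := cosh_pos s
      rw [norm_div, norm_of_nonneg h0.le]
      gcongr
      rw [Real.norm_eq_abs, abs_le]
      constructor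
      · have := Real.sinh_lt_cosh (-(s/3)); rw [Real.sinh_neg, Real.cosh_neg] at this; linarith
      · exact (Real.sinh_lt_cosh _).le
  have e2 : ∫ s, sinh (s/3) / cosh s = 0 := odd_int _ (fun x => by
    rw [neg_div, Real.sinh_neg, Real.cosh_neg, neg_div])
  have hs : (fun s => cosh ((s+b)/3) / cosh s) =
      fun s => cosh (b/3) * (cosh (s/3) / cosh s) + sinh (b/3) * (sinh (s/3) / cosh s) := by
    ext s; rw [add_div, Real.cosh_add]; ring
  have i3 : Integrable (fun s => cosh ((s+b)/3) / cosh s) := by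
    rw [hs]; exact (i1.const_mul _).add (i2.const_mul _)
  have hc : (fun w => cosh (w/3) / cosh (w-b)) = fun w => (fun s => cosh ((s+b)/3) / cosh s) (w-b) := by
    ext w; simp
  constructor
  · rw [hc]; exact i3.comp_sub_right b
  · rw [hc, integral_sub_right_eq_self (fun s => cosh ((s+b)/3) / cosh s) b, hs,
      integral_add (i1.const_mul _) (i2.const_mul _), integral_const_mul, integral_const_mul, e1, e2]
    ring

lemma k_alg (w b : ℝ) : cosh (w/3) * cosh w / (cosh w^2 + sinh b^2) =
    1 / (2 * cosh b) * (cosh (w/3) / cosh (w-b) + cosh (w/3) / cosh (w-(-b))) := by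
  have h1 := cosh_pos (w-b)
  have h2 := cosh_pos (w-(-b))
  have h3 := cosh_pos b
  have h4 := cosh_pos w
  have e : cosh (w-b) * cosh (w-(-b)) = cosh w^2 + sinh b^2 := by
    rw [sub_neg_eq_add, Real.cosh_add, Real.cosh_sub]
    have := cosh_sq w; have := cosh_sq b
    grind
  have e2 : cosh (w-b) + cosh (w-(-b)) = 2 * (cosh w * cosh b) := by
    rw [sub_neg_eq_add, Real.cosh_add, Real.cosh_sub]; ring
  rw [← e]
  field_simp
  linear_combination (-1/1) * e2

lemma k_int (b : ℝ) : ∫ w in Ioi (0:ℝ), cosh (w/3) * cosh w / (cosh w^2 + sinh b^2)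
    = π/√3 * cosh (b/3) / cosh b := by
  obtain ⟨i1, e1⟩ := shift_B b
  obtain ⟨i2, e2⟩ := shift_B (-b)
  have hi : Integrable (fun w => cosh (w/3) * cosh w / (cosh w^2 + sinh b^2)) := by
    simp only [k_alg]; exact (i1.add i2).const_mul _
  obtain ⟨_, e3⟩ := even_int (fun w => cosh (w/3) * cosh w / (cosh w^2 + sinh b^2))
    (fun x => by simp only [cosh_even, Real.cosh_neg]) hi.integrableOn
  have e4 : ∫ w, cosh (w/3) * cosh w / (cosh w^2 + sinh b^2) =
     1 / (2 * cosh b) * (2 * (π/√3) * cosh (b/3) + 2 * (π/√3) * cosh (b/3)) := by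
    simp only [k_alg]
    rw [integral_const_mul, integral_add i1 i2, e1, e2, cosh_even]
  rw [e4] at e3
  have := cosh_pos b
  have e5 := e3.symm
  rw [mul_comm] at e5
  rw [eq_div_of_mul_eq two_ne_zero e5]
  field_simp; ring

lemma JR_theta (S : ℝ) : JR (1/2) (-S^2) =
    2/√3 * ∫ θ in (0:ℝ)..(π/2), cosh (arsinh (S * sin θ) / 3) / cosh (arsinh (S * sin θ)) := by
  have h1 : ∀ w : ℝ, cosh (w/3) * (cosh w^2 - -S^2)^(-(1/2:ℝ)) =
     2/π * ∫ θ in (0:ℝ)..(π/2), cosh (w/3) * cosh w / (cosh w^2 + (S * sin θ)^2) := by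
    intro w
    have hc := cosh_pos w
    have hp : 0 < cosh w^2 + S^2 := by positivity
    have ht := theta_int (cosh w) (√(cosh w^2+S^2)) hc (Real.sqrt_pos.mpr hp)
    rw [Real.sq_sqrt hp.le] at ht
    have : ∀ θ : ℝ, cosh (w/3) * cosh w / (cosh w^2 + (S * sin θ)^2) =
      cosh (w/3) * cosh w * (1 / (cosh w^2 * cos θ^2 + (cosh w^2 + S^2) * sin θ^2)) := by
      intro θ; rw [mul_one_div]; congr 1; linear_combination (-cosh w^2) * Real.sin_sq_add_cos_sq θ
    simp only [this]
    rw [intervalIntegral.integral_const_mul, ht, sub_neg_eq_add, Real.rpow_neg hp.le, ← sqrt_eq_rpow]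
    have := Real.sqrt_pos.mpr hp
    have := pi_pos
    field_simp
  have hpi : (0:ℝ) ≤ π/2 := by positivity
  unfold JR
  simp only [h1]
  rw [integral_const_mul]
  simp only [intervalIntegral.integral_of_le hpi]
  rw [integral_integral_swap]
  · have : ∀ θ : ℝ, ∫ w in Ioi (0:ℝ), cosh (w/3) * cosh w / (cosh w^2 + (S * sin θ)^2) =
      π/√3 * (cosh (arsinh (S * sin θ) / 3) / cosh (arsinh (S * sin θ))) := by
      intro θ
      have := k_int (arsinh (S * sin θ))
      rw [Real.sinh_arsinh] at this
      rw [this, mul_div_assoc]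
    simp only [this]
    rw [integral_const_mul]
    have := pi_pos
    field_simp
  · haveI : IsFiniteMeasure (volume.restrict (Ioc (0:ℝ) (π/2))) := inferInstance
    have hb : Integrable (fun p : ℝ × ℝ => cosh (p.1/3) / cosh p.1)
        ((volume.restrict (Ioi (0:ℝ))).prod (volume.restrict (Ioc (0:ℝ) (π/2)))) :=
      Integrable.comp_fst (f := fun s => cosh (s/3) / cosh s) B_int.1 _
    refine hb.mono' ?_ (Filter.Eventually.of_forall fun p => ?_)
    · apply Continuous.aestronglyMeasurable
      refine Continuous.div (by fun_prop) (by fun_prop) (fun p => ?_)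
      have := cosh_pos p.1; positivity
    · have h0 := cosh_pos p.1
      have h3 := cosh_pos (p.1/3)
      change ‖cosh (p.1/3) * cosh p.1 / (cosh p.1^2 + (S * sin p.2)^2)‖ ≤ _
      rw [norm_of_nonneg (by positivity), div_le_div_iff₀ (by positivity) h0]
      have : 0 ≤ cosh (p.1/3) * (S * sin p.2)^2 := by positivity
      nlinarith

lemma MD (b : ℝ) (hb : 0 < b) :
    ∫ w in Ioo 0 b, cosh (w/3) * (cosh b^2 - cosh w^2)^(-(1/2:ℝ)) = √3/2 * JR (1/2) (-sinh b^2) := by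
  have hS : 0 < sinh b := sinh_pos_iff.mpr hb
  set S := sinh b with hSd
  have hpi : (0:ℝ) ≤ π/2 := by positivity
  have him : (fun θ => arsinh (S * sin θ)) '' Ioo 0 (π/2) = Ioo 0 b := by
    ext x; constructor
    · rintro ⟨θ, hθ, rfl⟩
      have h1 : 0 < sin θ := Real.sin_pos_of_pos_of_lt_pi hθ.1 (by linarith [hθ.2, pi_pos])
      have h2 : sin θ < 1 := by
        have := Real.sin_lt_sin_of_lt_of_le_pi_div_two (x := θ) (y := π/2) (by linarith [hθ.1]) le_rfl hθ.2
        simpa using this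
      constructor
      · exact Real.arsinh_pos_iff.mpr (by positivity)
      · rw [← Real.arsinh_sinh b]; apply Real.arsinh_lt_arsinh.mpr; nlinarith
    · rintro ⟨h1, h2⟩
      have h3 : 0 < sinh x := sinh_pos_iff.mpr h1
      have h4 : sinh x < S := Real.sinh_lt_sinh.mpr h2
      have h5 : sinh x / S < 1 := (div_lt_one hS).mpr h4
      have h6 : 0 < sinh x / S := by positivity
      refine ⟨Real.arcsin (sinh x / S), ⟨Real.arcsin_pos.mpr h6, Real.arcsin_lt_pi_div_two.mpr h5⟩, ?_⟩
      simp only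
      rw [Real.sin_arcsin (by linarith) h5.le, mul_div_cancel₀ _ hS.ne', Real.arsinh_sinh]
  have hcv := integral_image_eq_integral_abs_deriv_smul (s := Ioo 0 (π/2)) measurableSet_Ioo
    (f := fun θ => arsinh (S * sin θ)) (f' := fun θ => (√(1+(S * sin θ)^2))⁻¹ * (S * cos θ))
    (fun θ _ => by
      have := ((Real.hasDerivAt_sin θ).const_mul S).arsinh
      exact this.hasDerivWithinAt)
    (by
      intro x hx y hy hxy
      have := Real.arsinh_injective hxy
      have := mul_left_cancel₀ hS.ne' this
      exact Real.injOn_sin ⟨by linarith [hx.1], hx.2.le⟩ ⟨by linarith [hy.1], hy.2.le⟩ this)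
    (fun w => cosh (w/3) * (cosh b^2 - cosh w^2)^(-(1/2:ℝ)))
  rw [him] at hcv
  rw [hcv, JR_theta, intervalIntegral.integral_of_le hpi, integral_Ioc_eq_integral_Ioo]
  have h3 : (√3/2) * (2/√3) = (1:ℝ) := by field_simp
  rw [← mul_assoc, h3, one_mul]
  refine setIntegral_congr_fun measurableSet_Ioo ?_
  intro θ hθ
  have hc : 0 < cos θ := Real.cos_pos_of_mem_Ioo ⟨by linarith [hθ.1], hθ.2⟩
  simp only [smul_eq_mul]
  rw [Real.cosh_arsinh]
  have hq : 0 < √(1 + (S * sin θ)^2) := Real.sqrt_pos.mpr (by positivity)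
  rw [abs_of_pos (by positivity), Real.sq_sqrt (by positivity), cosh_sq b, ← hSd]
  have e : S^2 + 1 - (1 + (S * sin θ)^2) = (S * cos θ)^2 := by
    linear_combination (-S^2) * Real.sin_sq_add_cos_sq θ
  rw [e, Real.rpow_neg (by positivity), ← sqrt_eq_rpow, Real.sqrt_sq (by positivity)]
  field_simp

noncomputable def KK (s : ℝ) : ℝ := exp (|s|/3) * |sinh s| ^ (-(7/12):ℝ)
noncomputable def kap : ℝ := ∫ s, KK s
noncomputable def mm (y : ℝ) : ℝ := sinh (y/2) ^ (-(5/12):ℝ) * exp (-y/24)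
noncomputable def NN (y : ℝ) : ℝ := sinh (y/2) ^ (-(5/6):ℝ) * exp (y/4)

lemma KK_nonneg (s : ℝ) : 0 ≤ KK s := by unfold KK; positivity

lemma sinh_low (s : ℝ) (hs : 1 ≤ s) : exp s / 4 ≤ sinh s := by
  rw [Real.sinh_eq]
  have h1 : 2 ≤ exp s := by linarith [Real.add_one_le_exp s]
  have h2 : exp (-s) = (exp s)⁻¹ := Real.exp_neg s
  have h3 : (exp s)⁻¹ ≤ 1 := inv_le_one_of_one_le₀ (by linarith)
  rw [h2]; linarith

lemma self_le_sinh' (s : ℝ) (hs : 0 ≤ s) : s ≤ sinh s := Real.self_le_sinh_iff.mpr hs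

lemma KK_int : Integrable KK := by
  have hm : Measurable KK := by unfold KK; fun_prop
  refine (even_int KK (fun x => by unfold KK; rw [abs_neg, Real.sinh_neg, abs_neg]) ?_).1
  rw [← Ioc_union_Ioi_eq_Ioi (zero_le_one), integrableOn_union]
  constructor
  · have h1 : IntegrableOn (fun x : ℝ => exp 1 * x ^ (-(7/12):ℝ)) (Ioc 0 1) := by
      have := intervalIntegral.intervalIntegrable_rpow' (a := 0) (b := 1) (r := -(7/12)) (by norm_num)
      exact ((intervalIntegrable_iff_integrableOn_Ioc_of_le zero_le_one).mp this).const_mul _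
    refine Integrable.mono' h1 hm.aestronglyMeasurable ?_
    filter_upwards [ae_restrict_mem measurableSet_Ioc] with s hs
    rw [norm_of_nonneg (KK_nonneg s)]
    unfold KK
    have hsh := self_le_sinh' s hs.1.le
    rw [abs_of_pos hs.1, abs_of_nonneg (by linarith [hs.1])]
    have hsp : 0 ≤ sinh s ^ (-(7/12):ℝ) := Real.rpow_nonneg (by linarith [hs.1]) _
    gcongr ?_ * ?_
    · exact Real.exp_le_exp.mpr (by linarith [hs.2])
    · exact rpow_le_rpow_of_nonpos hs.1 hsh (by norm_num)
  · have h1 : IntegrableOn (fun x : ℝ => 4 ^ (7/12:ℝ) * exp (-(1/4)*x)) (Ioi 1) :=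
      (exp_neg_integrableOn_Ioi 1 (by norm_num : (0:ℝ) < 1/4)).const_mul _
    refine Integrable.mono' h1 hm.aestronglyMeasurable ?_
    filter_upwards [ae_restrict_mem measurableSet_Ioi] with s hs
    have hs : 1 < s := hs
    rw [norm_of_nonneg (KK_nonneg s)]
    unfold KK
    have hsh := sinh_low s hs.le
    have hE := exp_pos s
    rw [abs_of_pos (by linarith : 0 < s), abs_of_nonneg (by linarith)]
    calc _ ≤ exp (s/3) * (exp s / 4) ^ (-(7/12):ℝ) := by
          gcongr ?_ * ?_
          exact rpow_le_rpow_of_nonpos (by positivity) hsh (by norm_num)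
      _ = _ := by
          rw [Real.div_rpow hE.le (by norm_num), ← Real.exp_mul, Real.rpow_neg (by norm_num) (7/12), div_inv_eq_mul,
            ← mul_assoc, ← Real.exp_add, mul_comm]
          congr 2; ring

lemma kap_nonneg : 0 ≤ kap := integral_nonneg KK_nonneg

lemma kb1 (w y d : ℝ) (hw : 0 < w) (hy : 0 < y) (hne : w ≠ y/2)
    (hd : |sinh (w - y/2)| * sinh (w+y/2) ≤ d) :
    cosh (w/3) * d ^ (-(1/2):ℝ) ≤ mm y * KK (w - y/2) := by
  have hp : 0 < |sinh (w-y/2)| := abs_pos.mpr (by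
    intro h; exact hne (by linarith [Real.sinh_eq_zero.mp h]))
  have hs : 0 < sinh (y/2) := sinh_pos_iff.mpr (by linarith)
  have hq : exp w * sinh (y/2) ≤ sinh (w+y/2) := by
    rw [Real.sinh_add, ← Real.cosh_add_sinh w]
    have := Real.sinh_lt_cosh (y/2)
    have := sinh_pos_iff.mpr hw
    nlinarith
  have hpq : |sinh (w-y/2)| ≤ sinh (w+y/2) := by
    rw [abs_le]
    constructor
    · rw [← Real.sinh_neg]; exact Real.sinh_le_sinh.mpr (by linarith)
    · exact Real.sinh_le_sinh.mpr (by linarith)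
  set p := |sinh (w-y/2)|
  set q := sinh (w+y/2)
  have hq0 : 0 < q := by linarith
  have e1 : d ^ (-(1/2):ℝ) ≤ (p*q) ^ (-(1/2):ℝ) := rpow_le_rpow_of_nonpos (by positivity) hd (by norm_num)
  have e2 : (p*q) ^ (-(1/2):ℝ) ≤ p ^ (-(7/12):ℝ) * (exp (-(5/12)*w) * sinh (y/2) ^ (-(5/12):ℝ)) := by
    rw [Real.mul_rpow hp.le hq0.le]
    have a1 : q ^ (-(1/2):ℝ) = q ^ (-(1/12):ℝ) * q ^ (-(5/12):ℝ) := by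
      rw [← Real.rpow_add hq0]; norm_num
    have a2 : p ^ (-(7/12):ℝ) = p ^ (-(1/2):ℝ) * p ^ (-(1/12):ℝ) := by
      rw [← Real.rpow_add hp]; norm_num
    have a3 : q ^ (-(1/12):ℝ) ≤ p ^ (-(1/12):ℝ) := rpow_le_rpow_of_nonpos hp hpq (by norm_num)
    have a4 : q ^ (-(5/12):ℝ) ≤ exp (-(5/12)*w) * sinh (y/2) ^ (-(5/12):ℝ) := by
      have := rpow_le_rpow_of_nonpos (by positivity) hq (by norm_num : (-(5/12):ℝ) ≤ 0)
      rwa [Real.mul_rpow (exp_pos w).le hs.le, ← Real.exp_mul, mul_comm w] at this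
    rw [a1, a2, mul_assoc]
    gcongr
  have e3 : cosh (w/3) ≤ exp (w/3) := cosh_le_exp _ (by linarith)
  have e4 : exp (w/3) * exp (-(5/12)*w) ≤ exp (-y/24) * exp (|w-y/2|/3) := by
    rw [← Real.exp_add, ← Real.exp_add]
    apply Real.exp_le_exp.mpr
    have := neg_abs_le (w-y/2)
    have := abs_nonneg (w-y/2)
    linarith
  have hpp : 0 ≤ p ^ (-(7/12):ℝ) := Real.rpow_nonneg hp.le _
  have hss : 0 ≤ sinh (y/2) ^ (-(5/12):ℝ) := Real.rpow_nonneg hs.le _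
  calc _ ≤ exp (w/3) * (p ^ (-(7/12):ℝ) * (exp (-(5/12)*w) * sinh (y/2) ^ (-(5/12):ℝ))) := by
        have : 0 ≤ d ^ (-(1/2):ℝ) := Real.rpow_nonneg (le_trans (by positivity) hd) _
        gcongr; exact e1.trans e2
    _ = (exp (w/3) * exp (-(5/12)*w)) * (p ^ (-(7/12):ℝ) * sinh (y/2) ^ (-(5/12):ℝ)) := by ring
    _ ≤ (exp (-y/24) * exp (|w-y/2|/3)) * (p ^ (-(7/12):ℝ) * sinh (y/2) ^ (-(5/12):ℝ)) := by
        gcongr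
    _ = _ := by unfold mm KK; ring

lemma kb2 (w s d : ℝ) (hw : 0 < w) (hs : 0 < s) (hd : sinh w^2 + s^2 ≤ d) :
    cosh (w/3) * d ^ (-(1/2):ℝ) ≤ s ^ (-(5/12):ℝ) * KK w := by
  have hp : 0 < sinh w := sinh_pos_iff.mpr hw
  have e1 : d ^ (-(1/2):ℝ) ≤ sinh w ^ (-(7/12):ℝ) * s ^ (-(5/12):ℝ) := by
    have hd0 : 0 < d := lt_of_lt_of_le (by positivity) hd
    have a1 : d ^ (-(1/2):ℝ) = d ^ (-(7/24):ℝ) * d ^ (-(5/24):ℝ) := by rw [← Real.rpow_add hd0]; norm_num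
    have a2 : sinh w ^ (-(7/12):ℝ) = (sinh w^2) ^ (-(7/24):ℝ) := by
      rw [← Real.rpow_natCast, ← Real.rpow_mul hp.le]; norm_num
    have a3 : s ^ (-(5/12):ℝ) = (s^2) ^ (-(5/24):ℝ) := by
      rw [← Real.rpow_natCast, ← Real.rpow_mul hs.le]; norm_num
    rw [a1, a2, a3]
    gcongr ?_ * ?_
    · exact rpow_le_rpow_of_nonpos (by positivity) (by nlinarith) (by norm_num)
    · exact rpow_le_rpow_of_nonpos (by positivity) (by nlinarith) (by norm_num)
  have e3 : cosh (w/3) ≤ exp (w/3) := cosh_le_exp _ (by linarith)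
  calc _ ≤ exp (w/3) * (sinh w ^ (-(7/12):ℝ) * s ^ (-(5/12):ℝ)) := by
        have : 0 ≤ d ^ (-(1/2):ℝ) := Real.rpow_nonneg (le_trans (by positivity) hd) _
        gcongr
    _ = _ := by unfold KK; rw [abs_of_pos hw, abs_of_pos hp]; ring

/-- argument functions -/
noncomputable def uA (z : ℂ) : ℂ := (1 - Complex.cos z)/2
noncomputable def uB (z : ℂ) : ℂ := (1 + Complex.cos z)/2

lemma cos_re (x y : ℝ) : (Complex.cos (x + y * Complex.I)).re = cos x * cosh y := by
  rw [Complex.cos_add_mul_I, ← Complex.ofReal_cos, ← Complex.ofReal_cosh, ← Complex.ofReal_sin, ← Complex.ofReal_sinh]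
  simp only [Complex.sub_re, Complex.mul_re, Complex.sub_im, Complex.mul_im, Complex.ofReal_re, Complex.ofReal_im, Complex.I_re, Complex.I_im]
  ring
lemma cos_im (x y : ℝ) : (Complex.cos (x + y * Complex.I)).im = -(sin x * sinh y) := by
  rw [Complex.cos_add_mul_I, ← Complex.ofReal_cos, ← Complex.ofReal_cosh, ← Complex.ofReal_sin, ← Complex.ofReal_sinh]
  simp only [Complex.sub_re, Complex.mul_re, Complex.sub_im, Complex.mul_im, Complex.ofReal_re, Complex.ofReal_im, Complex.I_re, Complex.I_im]
  ring

lemma uA_re (x y : ℝ) : (uA (x + y * Complex.I)).re = (1 - cos x * cosh y)/2 := by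
  unfold uA; rw [Complex.div_ofNat_re, Complex.sub_re, cos_re]; simp
lemma uA_im (x y : ℝ) : (uA (x + y * Complex.I)).im = (sin x * sinh y)/2 := by
  unfold uA; rw [Complex.div_ofNat_im, Complex.sub_im, cos_im]; simp
lemma uB_re (x y : ℝ) : (uB (x + y * Complex.I)).re = (1 + cos x * cosh y)/2 := by
  unfold uB; rw [Complex.div_ofNat_re, Complex.add_re, cos_re]; simp
lemma uB_im (x y : ℝ) : (uB (x + y * Complex.I)).im = -(sin x * sinh y)/2 := by
  unfold uB; rw [Complex.div_ofNat_im, Complex.add_im, cos_im]; simp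

lemma cos_lt1 (x : ℝ) (h0 : 0 < x) (h1 : x < π) : cos x < 1 ∧ -1 < cos x := by
  have h := Real.sin_pos_of_pos_of_lt_pi h0 h1
  have := Real.sin_sq_add_cos_sq x
  constructor <;> nlinarith [sq_nonneg (cos x)]

lemma uA_SU (z : ℂ) (h0 : 0 < z.re) (h1 : z.re < π) : uA z ∈ SU := by
  rw [← Complex.re_add_im z]
  have hs := Real.sin_pos_of_pos_of_lt_pi h0 h1
  by_cases hy : z.im = 0
  · left; rw [uA_re, hy, Real.cosh_zero]; linarith [(cos_lt1 _ h0 h1).2]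
  · right; rw [uA_im]; have := mt Real.sinh_eq_zero.mp hy; positivity
lemma uB_SU (z : ℂ) (h0 : 0 < z.re) (h1 : z.re < π) : uB z ∈ SU := by
  rw [← Complex.re_add_im z]
  have hs := Real.sin_pos_of_pos_of_lt_pi h0 h1
  by_cases hy : z.im = 0
  · left; rw [uB_re, hy, Real.cosh_zero]; linarith [(cos_lt1 _ h0 h1).1]
  · right; rw [uB_im]; have := mt Real.sinh_eq_zero.mp hy
    exact div_ne_zero (neg_ne_zero.mpr (mul_ne_zero hs.ne' this)) two_ne_zero

lemma D_low_alg (C Y c sg : ℝ) (hC : 1 ≤ C) (hY : 1 ≤ Y) (hc1 : -1 ≤ c) (hc2 : c ≤ 1) (hsg : sg = 1 ∨ sg = -1) :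
    (C - Y)^2 ≤ (C + sg * (c * Y))^2 + (1-c^2)*(Y^2-1) := by
  have h : 1 ≤ C * Y := by nlinarith
  rcases hsg with rfl | rfl
  · have : 0 ≤ (1+c) * (2*(C*Y) - 1 + c) := mul_nonneg (by linarith) (by linarith)
    nlinarith
  · have : 0 ≤ (1-c) * (2*(C*Y) - 1 - c) := mul_nonneg (by linarith) (by linarith)
    nlinarith

lemma sinh_prod (w y : ℝ) : sinh (w-y/2) * sinh (w+y/2) = (cosh (2*w) - cosh y)/2 := by
  have h1 : cosh y = cosh (2*(y/2)) := by congr 1; ring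
  rw [h1, Real.cosh_two_mul, Real.cosh_two_mul, Real.sinh_sub, Real.sinh_add]
  have := cosh_sq w; have := cosh_sq (y/2)
  grind

lemma D_low (x y w sg : ℝ) (hw : 0 < w) (hy : 0 < y) (hsg : sg = 1 ∨ sg = -1) (u : ℂ)
    (hre : u.re = (1 - sg * (cos x * cosh y))/2) (him : u.im = sg * (sin x * sinh y)/2) :
    |sinh (w - y/2)| * sinh (w+y/2) ≤ ‖Dc w u‖ := by
  have hq : 0 < sinh (w+y/2) := sinh_pos_iff.mpr (by linarith)
  rw [← abs_of_pos hq, ← abs_mul, sinh_prod]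
  rw [← Real.sqrt_sq_eq_abs, ← Real.sqrt_sq (norm_nonneg (Dc w u))]
  apply Real.sqrt_le_sqrt
  rw [← Complex.normSq_eq_norm_sq, Complex.normSq_apply]
  have e1 : (Dc w u).re = cosh w^2 - u.re := by unfold Dc; rw [Complex.sub_re, Complex.ofReal_re]
  have e2 : (Dc w u).im = - u.im := by unfold Dc; rw [Complex.sub_im, Complex.ofReal_im, zero_sub]
  rw [e1, e2, hre, him]
  have h2 := D_low_alg (cosh (2*w)) (cosh y) (cos x) sg (Real.one_le_cosh _) (Real.one_le_cosh _)
    (Real.neg_one_le_cos x) (Real.cos_le_one x) hsg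
  have h3 : cosh w^2 = (1 + cosh (2*w))/2 := by
    rw [Real.cosh_two_mul]; linarith [cosh_sq w]
  have h4 := cosh_sq y
  have h5 := Real.sin_sq_add_cos_sq x
  have h6 : sg * sg = 1 := by rcases hsg with rfl | rfl <;> norm_num
  have h7 : (1 - cos x^2)*(cosh y^2-1) = (sg * (sin x * sinh y))^2 := by
    rw [h4]; linear_combination (-sinh y^2) * h5 - sin x^2*sinh y^2 * h6
  rw [h7] at h2
  rw [h3]
  nlinarith

lemma norm_fc_half (u : ℂ) (w : ℝ) : ‖fc (1/2) u w‖ = cosh (w/3) * ‖Dc w u‖ ^ (-(1/2):ℝ) := by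
  unfold fc
  rw [norm_mul, Complex.norm_real, norm_of_nonneg (cosh_pos _).le, Complex.norm_cpow_real]

lemma fc_bdA (x y w : ℝ) (hw : 0 < w) (hy : 0 < y) (hne : w ≠ y/2) :
    ‖fc (1/2) (uA (x + y * Complex.I)) w‖ ≤ mm y * KK (w-y/2) := by
  rw [norm_fc_half]
  exact kb1 w y _ hw hy hne (D_low x y w 1 hw hy (Or.inl rfl) _ (by rw [uA_re]; ring) (by rw [uA_im]; ring))
lemma fc_bdB (x y w : ℝ) (hw : 0 < w) (hy : 0 < y) (hne : w ≠ y/2) :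
    ‖fc (1/2) (uB (x + y * Complex.I)) w‖ ≤ mm y * KK (w-y/2) := by
  rw [norm_fc_half]
  exact kb1 w y _ hw hy hne (D_low x y w (-1) hw hy (Or.inr rfl) _ (by rw [uB_re]; ring) (by rw [uB_im]; ring))

lemma mm_nonneg (y : ℝ) (hy : 0 < y) : 0 ≤ mm y := by
  have hs : 0 < sinh (y/2) := sinh_pos_iff.mpr (by linarith)
  unfold mm; positivity

lemma Jc_bd (f : ℝ → ℂ) (c a : ℝ) (hc : 0 ≤ c) (h : ∀ w, 0 < w → w ≠ a → ‖f w‖ ≤ c * KK (w-a)) :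
    ‖∫ w in Ioi (0:ℝ), f w‖ ≤ c * kap := by
  have hi : Integrable (fun w => c * KK (w - a)) := (KK_int.comp_sub_right a).const_mul c
  calc _ ≤ ∫ w in Ioi (0:ℝ), c * KK (w-a) := by
        refine norm_integral_le_of_norm_le hi.integrableOn ?_
        filter_upwards [ae_restrict_mem measurableSet_Ioi, Measure.ae_ne (volume.restrict (Ioi (0:ℝ))) a] with w hw hn
        exact h w hw hn
    _ ≤ ∫ w, c * KK (w-a) := setIntegral_le_integral hi (Filter.Eventually.of_forall fun w => mul_nonneg hc (KK_nonneg _))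
    _ = _ := by rw [integral_const_mul, integral_sub_right_eq_self KK a]; rfl

lemma JA_bd (x y : ℝ) (hy : 0 < y) : ‖Jc (1/2) (uA (x + y * Complex.I))‖ ≤ mm y * kap :=
  Jc_bd _ _ (y/2) (mm_nonneg y hy) (fun w hw hn => fc_bdA x y w hw hy hn)
lemma JB_bd (x y : ℝ) (hy : 0 < y) : ‖Jc (1/2) (uB (x + y * Complex.I))‖ ≤ mm y * kap :=
  Jc_bd _ _ (y/2) (mm_nonneg y hy) (fun w hw hn => fc_bdB x y w hw hy hn)

lemma JR_bd (s : ℝ) (hs : 0 < s) : JR (1/2) (1 - s^2) ≤ s ^ (-(5/12):ℝ) * kap := by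
  have h1 : (1 - s^2 : ℝ) < 1 := by nlinarith
  have h := Jc_bd (fc (1/2) ((1-s^2:ℝ):ℂ)) (s ^ (-(5/12):ℝ)) 0 (by positivity) (fun w hw _ => by
    rw [norm_fc_half, sub_zero]
    refine kb2 w s _ hw hs ?_
    unfold Dc
    rw [← Complex.ofReal_sub, Complex.norm_real]
    refine le_trans (le_of_eq ?_) (le_abs_self _)
    rw [cosh_sq]; ring)
  change ‖Jc (1/2) ((1-s^2:ℝ):ℂ)‖ ≤ _ at h
  rw [Jc_ofReal _ _ h1, Complex.norm_real] at h
  exact (le_abs_self _).trans h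

lemma NN_eq (y : ℝ) (hy : 0 < y) : mm y^2 * exp (y/3) = NN y := by
  have hs : 0 < sinh (y/2) := sinh_pos_iff.mpr (by linarith)
  unfold mm NN
  rw [mul_pow, ← Real.rpow_natCast, ← Real.rpow_mul hs.le, ← Real.exp_nat_mul, mul_assoc, ← Real.exp_add]
  congr 2 <;> · push_cast; ring

lemma NN_int (R : ℝ) (hR : 0 < R) : IntervalIntegrable NN volume 0 R := by
  have h1 : IntervalIntegrable (fun y : ℝ => 2 ^ (5/6:ℝ) * exp (R/4) * y ^ (-(5/6):ℝ)) volume 0 R :=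
    (intervalIntegral.intervalIntegrable_rpow' (by norm_num)).const_mul _
  refine h1.mono_fun' ?_ ?_
  · have : Measurable NN := by unfold NN; fun_prop
    exact this.aestronglyMeasurable
  · filter_upwards [ae_restrict_mem measurableSet_uIoc] with y hy
    rw [uIoc_of_le hR.le] at hy
    have hs : 0 < sinh (y/2) := sinh_pos_iff.mpr (by linarith [hy.1])
    have h2 := self_le_sinh' (y/2) (by linarith [hy.1])
    have hy0 := hy.1
    unfold NN
    rw [norm_of_nonneg (by positivity)]
    have h3 := rpow_le_rpow_of_nonpos (by positivity) h2 (by norm_num : (-(5/6):ℝ) ≤ 0)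
    rw [Real.div_rpow hy0.le (by norm_num), Real.rpow_neg (by norm_num : (0:ℝ) ≤ 2), div_inv_eq_mul] at h3
    have h4 : exp (y/4) ≤ exp (R/4) := Real.exp_le_exp.mpr (by linarith [hy.2])
    calc _ ≤ (y ^ (-(5/6):ℝ) * 2 ^ (5/6:ℝ)) * exp (R/4) := by gcongr
      _ = _ := by ring

open Filter Topology in
lemma NN_lim : Tendsto NN atTop (𝓝 0) := by
  have h1 : Tendsto (fun y : ℝ => (4:ℝ)^(5/6:ℝ) * exp (-(1/6)*y)) atTop (𝓝 0) := by
    have : Tendsto (fun y : ℝ => exp (-(1/6)*y)) atTop (𝓝 0) :=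
      Real.tendsto_exp_atBot.comp (tendsto_id.const_mul_atTop_of_neg (by norm_num))
    simpa using this.const_mul ((4:ℝ)^(5/6:ℝ))
  refine squeeze_zero' ?_ ?_ h1
  · filter_upwards [eventually_gt_atTop 0] with y hy
    have hs : 0 < sinh (y/2) := sinh_pos_iff.mpr (by linarith)
    unfold NN; positivity
  · filter_upwards [eventually_ge_atTop 2] with y hy
    have h2 := sinh_low (y/2) (by linarith)
    have h3 := rpow_le_rpow_of_nonpos (by positivity) h2 (by norm_num : (-(5/6):ℝ) ≤ 0)
    unfold NN
    calc _ ≤ (exp (y/2) / 4) ^ (-(5/6):ℝ) * exp (y/4) := by gcongr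
      _ = _ := by
        rw [Real.div_rpow (exp_pos _).le (by norm_num), ← Real.exp_mul, Real.rpow_neg (by norm_num : (0:ℝ) ≤ 4), div_inv_eq_mul,
            mul_comm _ ((4:ℝ)^(5/6:ℝ)), mul_assoc, ← Real.exp_add]
        congr 2; ring

noncomputable def Om (z : ℂ) : ℂ :=
  Complex.cos ((π - z)/3) * Jc (1/2) (uA z)^2 + Complex.cos (z/3) * Jc (1/2) (uB z)^2
   - 2 * Complex.I * (√3:ℝ) * Complex.sin (z/3 - π/6) * (Jc (1/2) (uA z) * Jc (1/2) (uB z))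

lemma JA_diff (z : ℂ) (h : uA z ∈ SU) : DifferentiableAt ℂ (fun z => Jc (1/2) (uA z)) z :=
  DifferentiableAt.comp z (g := Jc (1/2)) (Jc_hasDerivAt _ le_rfl _ h).differentiableAt (by unfold uA; fun_prop)
lemma JB_diff (z : ℂ) (h : uB z ∈ SU) : DifferentiableAt ℂ (fun z => Jc (1/2) (uB z)) z :=
  DifferentiableAt.comp z (g := Jc (1/2)) (Jc_hasDerivAt _ le_rfl _ h).differentiableAt (by unfold uB; fun_prop)

lemma Om_diff (z : ℂ) (h0 : 0 < z.re) (h1 : z.re < π) : DifferentiableAt ℂ Om z := by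
  have hA := JA_diff z (uA_SU z h0 h1)
  have hB := JB_diff z (uB_SU z h0 h1)
  have c1 : DifferentiableAt ℂ (fun z : ℂ => Complex.cos ((π - z)/3)) z := by fun_prop
  have c2 : DifferentiableAt ℂ (fun z : ℂ => Complex.cos (z/3)) z := by fun_prop
  have c3 : DifferentiableAt ℂ (fun z : ℂ => 2 * Complex.I * (√3:ℝ) * Complex.sin (z/3 - π/6)) z := by fun_prop
  exact ((c1.mul (hA.pow 2)).add (c2.mul (hB.pow 2))).sub (c3.mul (hA.mul hB))

lemma exp_norm_le (z : ℂ) (r : ℝ) (h : |z.im| ≤ r) : ‖Complex.exp (z * Complex.I)‖ ≤ exp r ∧ ‖Complex.exp (-z * Complex.I)‖ ≤ exp r := by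
  have := abs_le.mp h
  rw [Complex.norm_exp, Complex.norm_exp]
  constructor <;> · apply Real.exp_le_exp.mpr; simp; linarith
lemma norm_cos_le' (z : ℂ) (r : ℝ) (h : |z.im| ≤ r) : ‖Complex.cos z‖ ≤ exp r := by
  obtain ⟨h1, h2⟩ := exp_norm_le z r h
  unfold Complex.cos
  rw [norm_div, Complex.norm_ofNat, div_le_iff₀ (by norm_num)]
  linarith [norm_add_le (Complex.exp (z * Complex.I)) (Complex.exp (-z * Complex.I))]
lemma norm_sin_le' (z : ℂ) (r : ℝ) (h : |z.im| ≤ r) : ‖Complex.sin z‖ ≤ exp r := by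
  obtain ⟨h1, h2⟩ := exp_norm_le z r h
  unfold Complex.sin
  rw [norm_div, Complex.norm_ofNat, div_le_iff₀ (by norm_num), norm_mul, Complex.norm_I, mul_one]
  linarith [norm_sub_le (Complex.exp (-z * Complex.I)) (Complex.exp (z * Complex.I))]

lemma Om_bd (x y : ℝ) (hy : 0 < y) : ‖Om (x + y * Complex.I)‖ ≤ 6 * kap^2 * NN y := by
  have hA := JA_bd x y hy
  have hB := JB_bd x y hy
  rw [← NN_eq y hy]
  unfold Om
  set A := Jc (1/2) (uA (x + y * Complex.I))
  set B := Jc (1/2) (uB (x + y * Complex.I))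
  have c1 : ‖Complex.cos ((π - (x + y * Complex.I))/3)‖ ≤ exp (y/3) := norm_cos_le' _ _ (by
    rw [Complex.div_ofNat_im]; simp; rw [abs_div, abs_neg, abs_of_pos hy]; norm_num)
  have c2 : ‖Complex.cos ((x + y * Complex.I)/3)‖ ≤ exp (y/3) := norm_cos_le' _ _ (by
    rw [Complex.div_ofNat_im]; simp; rw [abs_div, abs_of_pos hy]; norm_num)
  have c3 : ‖Complex.sin ((x + y * Complex.I)/3 - π/6)‖ ≤ exp (y/3) := norm_sin_le' _ _ (by
    rw [Complex.sub_im, Complex.div_ofNat_im, Complex.div_ofNat_im]; simp; rw [abs_div, abs_of_pos hy]; norm_num)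
  have h3 : √3 ≤ 2 := by rw [Real.sqrt_le_left] <;> norm_num
  have hM : 0 ≤ mm y * kap := mul_nonneg (mm_nonneg y hy) kap_nonneg
  set M := mm y * kap with hMd
  have t1 : ‖Complex.cos ((π - (x + y * Complex.I))/3) * A^2‖ ≤ exp (y/3) * M^2 := by
    rw [norm_mul, norm_pow]; gcongr
  have t2 : ‖Complex.cos ((x + y * Complex.I)/3) * B^2‖ ≤ exp (y/3) * M^2 := by
    rw [norm_mul, norm_pow]; gcongr
  have t3 : ‖2 * Complex.I * (√3:ℝ) * Complex.sin ((x + y * Complex.I)/3 - π/6) * (A*B)‖ ≤ 4 * (exp (y/3) * M^2) := by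
    rw [norm_mul, norm_mul, norm_mul, norm_mul, norm_mul, Complex.norm_I, Complex.norm_real, norm_of_nonneg (Real.sqrt_nonneg 3), Complex.norm_ofNat]
    calc _ ≤ 2 * 1 * 2 * exp (y/3) * (M * M) := by gcongr
      _ = _ := by ring
  calc _ ≤ exp (y/3) * M^2 + exp (y/3) * M^2 + 4 * (exp (y/3) * M^2) :=
        (norm_sub_le _ _).trans (add_le_add ((norm_add_le _ _).trans (add_le_add t1 t2)) t3)
    _ = _ := by rw [hMd]; ring

noncomputable def AR (x : ℝ) : ℝ := JR (1/2) ((1 - cos x)/2)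

lemma JA_real (x : ℝ) (h0 : 0 < x) (h1 : x < π) : Jc (1/2) (uA x) = AR x := by
  have e : uA x = (((1 - cos x)/2 : ℝ) : ℂ) := by unfold uA; push_cast; ring
  rw [e, Jc_ofReal _ _ (by linarith [(cos_lt1 x h0 h1).2])]; rfl
lemma JB_real (x : ℝ) (h0 : 0 < x) (h1 : x < π) : Jc (1/2) (uB x) = AR (π - x) := by
  have e : uB x = (((1 - cos (π - x))/2 : ℝ) : ℂ) := by unfold uB; rw [Real.cos_pi_sub]; push_cast; ring
  rw [e, Jc_ofReal _ _ (by rw [Real.cos_pi_sub]; linarith [(cos_lt1 x h0 h1).1])]; rfl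

noncomputable def ph (x : ℝ) : ℝ := cos ((π - x)/3) * AR x^2

lemma Om_real (x : ℝ) (h0 : 0 < x) (h1 : x < π) : (Om x).re = ph x + ph (π - x) := by
  unfold Om ph
  rw [JA_real x h0 h1, JB_real x h0 h1]
  have e1 : Complex.cos ((π - x)/3) = (cos ((π-x)/3) : ℝ) := by push_cast; rfl
  have e2 : Complex.cos ((x:ℂ)/3) = (cos ((π-(π-x))/3) : ℝ) := by push_cast; congr 1; ring
  have e3 : Complex.sin ((x:ℂ)/3-π/6) = (sin (x/3-π/6) : ℝ) := by push_cast; rfl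
  rw [e1, e2, e3]
  have e4 : ((cos ((π-x)/3) : ℝ):ℂ) * (AR x:ℂ)^2 + (cos ((π-(π-x))/3) : ℝ) * (AR (π-x):ℂ)^2
    - 2 * Complex.I * (√3:ℝ) * (sin (x/3-π/6) : ℝ) * ((AR x:ℂ) * (AR (π-x):ℂ)) =
    ((cos ((π-x)/3) * AR x^2 + cos ((π-(π-x))/3) * AR (π-x)^2 : ℝ):ℂ) +
     ((-(2 * √3 * sin (x/3-π/6) * (AR x * AR (π-x))) : ℝ):ℂ) * Complex.I := by
    simp only [Complex.ofReal_add, Complex.ofReal_mul, Complex.ofReal_pow, Complex.ofReal_neg, Complex.ofReal_ofNat]; ring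
  rw [e4]; simp only [Complex.add_re, Complex.re_ofReal_mul, Complex.I_re, Complex.ofReal_re, mul_zero, add_zero]

lemma Jc_conj (u : ℂ) (hu : u ∈ SU) : Jc (1/2) ((starRingEnd ℂ) u) = (starRingEnd ℂ) (Jc (1/2) u) := by
  unfold Jc
  rw [← integral_conj]
  congr 1; ext w
  unfold fc
  rw [map_mul, Complex.conj_ofReal]
  congr 1
  have e : Dc w ((starRingEnd ℂ) u) = (starRingEnd ℂ) (Dc w u) := by unfold Dc; rw [map_sub, Complex.conj_ofReal]
  have hs : Dc w ((starRingEnd ℂ) u) ∈ Complex.slitPlane := by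
    refine Dc_slit w _ ?_
    rcases hu with h | h
    · left; simpa using h
    · right; simpa using h
  have h := Complex.cpow_conj (Dc w ((starRingEnd ℂ) u)) ((-(1/2:ℝ):ℝ):ℂ) (Complex.mem_slitPlane_iff_arg.mp hs).1
  rw [Complex.conj_ofReal] at h
  rw [h, e, Complex.conj_conj]

lemma Om_mid (y : ℝ) : (Om ((π/2:ℝ) + y * Complex.I)).im = 0 := by
  have hpi := pi_pos
  have hu := uA_SU ((π/2:ℝ) + y * Complex.I) (by simp; positivity) (by simp; linarith)
  have e : uB ((π/2:ℝ) + y * Complex.I) = (starRingEnd ℂ) (uA ((π/2:ℝ) + y * Complex.I)) := by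
    apply Complex.ext
    · rw [uB_re, Complex.conj_re, uA_re, Real.cos_pi_div_two]; ring
    · rw [uB_im, Complex.conj_im, uA_im]; ring
  unfold Om
  rw [e, Jc_conj _ hu]
  set A := Jc (1/2) (uA ((π/2:ℝ) + y * Complex.I))
  have e1 : ((π/2:ℝ) + y * Complex.I)/3 = (starRingEnd ℂ) ((π - ((π/2:ℝ) + y * Complex.I))/3) := by
    rw [map_div₀, map_sub, map_add, map_mul, Complex.conj_ofReal, Complex.conj_ofReal, Complex.conj_ofReal, Complex.conj_I, map_ofNat]
    push_cast; ring
  have e2 : Complex.sin (((π/2:ℝ) + y * Complex.I)/3 - π/6) = (sinh (y/3):ℝ) * Complex.I := by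
    rw [Complex.ofReal_sinh, ← Complex.sin_mul_I]; congr 1; push_cast; ring
  rw [e2, e1, Complex.cos_conj]
  set c := Complex.cos ((π - ((π/2:ℝ) + y * Complex.I))/3)
  have e3 : c * A^2 + (starRingEnd ℂ) c * (starRingEnd ℂ) A^2 = c * A^2 + (starRingEnd ℂ) (c * A^2) := by
    rw [map_mul, map_pow]
  rw [e3, Complex.add_conj, Complex.mul_conj]
  have e4 : ((2 * (c * A^2).re : ℝ):ℂ) - 2 * Complex.I * (√3:ℝ) * ((sinh (y/3):ℝ) * Complex.I) * ((Complex.normSq A : ℝ):ℂ) =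
    ((2 * (c * A^2).re + 2 * √3 * sinh (y/3) * Complex.normSq A : ℝ) : ℂ) := by
    simp only [Complex.ofReal_add, Complex.ofReal_mul, Complex.ofReal_ofNat]
    linear_combination (-2 * (√3:ℝ) * (sinh (y/3):ℝ) * (Complex.normSq A : ℂ)) * Complex.I_sq
  rw [e4, Complex.ofReal_im]

noncomputable def aR (y : ℝ) : ℝ := JR (1/2) (-sinh (y/2)^2)

lemma cosh_half (y : ℝ) : cosh y = 2 * cosh (y/2)^2 - 1 ∧ cosh y = 2 * sinh (y/2)^2 + 1 := by
  have h1 : cosh y = cosh (2*(y/2)) := by congr 1; ring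
  have := cosh_sq (y/2)
  rw [h1, Real.cosh_two_mul]; constructor <;> linarith

lemma uA_zero (y : ℝ) : uA ((0:ℝ) + y * Complex.I) = ((-sinh (y/2)^2 : ℝ):ℂ) := by
  apply Complex.ext
  · rw [uA_re, Complex.ofReal_re, Real.cos_zero, (cosh_half y).2]; ring
  · rw [uA_im, Complex.ofReal_im, Real.sin_zero]; ring
lemma uB_zero (y : ℝ) : uB ((0:ℝ) + y * Complex.I) = ((cosh (y/2)^2 : ℝ):ℂ) := by
  apply Complex.ext
  · rw [uB_re, Complex.ofReal_re, Real.cos_zero, (cosh_half y).1]; ring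
  · rw [uB_im, Complex.ofReal_im, Real.sin_zero]; ring

lemma nsq_lt (y : ℝ) : -sinh (y/2)^2 < 1 := by nlinarith [sq_nonneg (sinh (y/2))]

lemma JA_zero (y : ℝ) : Jc (1/2) (uA ((0:ℝ) + y * Complex.I)) = aR y := by
  rw [uA_zero, Jc_ofReal _ _ (nsq_lt y)]; rfl

lemma Dc_B0 (y w : ℝ) : Dc w (uB ((0:ℝ) + y * Complex.I)) = ((cosh w^2 - cosh (y/2)^2 : ℝ):ℂ) := by
  rw [uB_zero]; unfold Dc; rw [Complex.ofReal_sub]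

lemma fcB0_im (y w : ℝ) (hy : 0 < y) (hw : 0 < w) : (fc (1/2) (uB ((0:ℝ) + y * Complex.I)) w).im =
    if w < y/2 then -(cosh (w/3) * (cosh (y/2)^2 - cosh w^2)^(-(1/2:ℝ))) else 0 := by
  unfold fc
  rw [Dc_B0, Complex.im_ofReal_mul]
  have hc0 := cosh_pos w
  split_ifs with h
  · have h1 : cosh w < cosh (y/2) := Real.cosh_lt_cosh.mpr (by rw [abs_of_pos hw, abs_of_pos (by linarith)]; exact h)
    have h2 : cosh w^2 - cosh (y/2)^2 < 0 := by nlinarith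
    rw [Complex.ofReal_cpow_of_nonpos h2.le, ← Complex.ofReal_neg, ← Complex.ofReal_cpow (by linarith)]
    have e : Complex.exp (π * Complex.I * ((-(1/2:ℝ):ℝ):ℂ)) = -Complex.I := by
      rw [show (π * Complex.I * ((-(1/2:ℝ):ℝ):ℂ)) = -(π/2 * Complex.I) by push_cast; ring, Complex.exp_neg,
        Complex.exp_pi_div_two_mul_I, Complex.inv_I]
    rw [e, neg_sub, Complex.im_ofReal_mul, Complex.neg_im, Complex.I_im]; ring
  · push Not at h
    have h1 : cosh (y/2) ≤ cosh w := Real.cosh_le_cosh.mpr (by rw [abs_of_pos hw, abs_of_pos (by linarith)]; exact h)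
    have h3 := cosh_pos (y/2)
    have h2 : 0 ≤ cosh w^2 - cosh (y/2)^2 := by nlinarith
    rw [← Complex.ofReal_cpow h2, Complex.ofReal_im, mul_zero]

lemma fcB0_meas (u : ℂ) : Measurable (fc (1/2) u) := by
  unfold fc Dc
  have h1 : Measurable (fun w : ℝ => ((cosh (w/3) : ℝ):ℂ)) := by fun_prop
  have h2 : Measurable (fun w : ℝ => ((cosh w^2 : ℝ):ℂ) - u) := by
    exact (Complex.measurable_ofReal.comp (by fun_prop)).sub_const u
  exact h1.mul (h2.pow_const _)

lemma fcB_int0 (x y : ℝ) (hy : 0 < y) : IntegrableOn (fc (1/2) (uB (x + y * Complex.I))) (Ioi 0) := by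
  refine Integrable.mono' ((KK_int.comp_sub_right (y/2)).const_mul (mm y)).integrableOn (fcB0_meas _).aestronglyMeasurable ?_
  filter_upwards [ae_restrict_mem measurableSet_Ioi, Measure.ae_ne (volume.restrict (Ioi (0:ℝ))) (y/2)] with w hw hn
  exact fc_bdB x y w hw hy hn

lemma JB0_im (y : ℝ) (hy : 0 < y) : (Jc (1/2) (uB ((0:ℝ) + y * Complex.I))).im = -(√3/2 * aR y) := by
  have h1 : (Jc (1/2) (uB ((0:ℝ) + y * Complex.I))).im = ∫ w in Ioi (0:ℝ), (fc (1/2) (uB ((0:ℝ) + y * Complex.I)) w).im := by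
    unfold Jc
    exact (integral_im (fcB_int0 0 y hy)).symm
  rw [h1]
  have h2 : Ioo 0 (y/2) ⊆ Ioi (0:ℝ) := fun x hx => hx.1
  rw [setIntegral_congr_fun measurableSet_Ioi (fun w hw => fcB0_im y w hy hw),
    setIntegral_eq_of_subset_of_forall_sdiff_eq_zero measurableSet_Ioi h2]
  · have := MD (y/2) (by linarith)
    unfold aR
    rw [← this, ← integral_neg]
    refine setIntegral_congr_fun measurableSet_Ioo (fun w hw => ?_)
    simp only [if_pos hw.2]
  · intro w hw
    have : ¬ w < y/2 := fun h => hw.2 ⟨hw.1, h⟩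
    rw [if_neg this]

open Filter Topology in
lemma JB_lim (y : ℝ) (hy : 0 < y) : Tendsto (fun ε : ℝ => Jc (1/2) (uB (ε + y * Complex.I))) (𝓝[>] 0)
    (𝓝 (Jc (1/2) (uB ((0:ℝ) + y * Complex.I)))) := by
  unfold Jc
  refine tendsto_integral_filter_of_dominated_convergence (fun w => mm y * KK (w-y/2)) ?_ ?_ ?_ ?_
  · exact Eventually.of_forall fun ε => (fcB0_meas _).aestronglyMeasurable
  · refine Eventually.of_forall fun ε => ?_
    filter_upwards [ae_restrict_mem measurableSet_Ioi, Measure.ae_ne (volume.restrict (Ioi (0:ℝ))) (y/2)] with w hw hn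
    exact fc_bdB ε y w hw hy hn
  · exact ((KK_int.comp_sub_right (y/2)).const_mul (mm y)).integrableOn
  · filter_upwards [ae_restrict_mem measurableSet_Ioi, Measure.ae_ne (volume.restrict (Ioi (0:ℝ))) (y/2)] with w hw hn
    have hw : 0 < w := hw
    unfold fc
    refine Tendsto.const_mul _ ?_
    have hD : Tendsto (fun ε : ℝ => Dc w (uB (ε + y * Complex.I))) (𝓝[>] 0) (𝓝 (Dc w (uB ((0:ℝ) + y * Complex.I)))) := by
      have : Continuous (fun ε : ℝ => Dc w (uB (ε + y * Complex.I))) := by unfold Dc uB; fun_prop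
      exact (this.tendsto 0).mono_left nhdsWithin_le_nhds
    have hc0 := cosh_pos w
    have hc1 := cosh_pos (y/2)
    rcases lt_or_gt_of_ne hn with h | h
    · have h1 : cosh w < cosh (y/2) := Real.cosh_lt_cosh.mpr (by rw [abs_of_pos hw, abs_of_pos (by linarith)]; exact h)
      have h2 : cosh w^2 - cosh (y/2)^2 < 0 := by nlinarith
      have hD0 : Dc w (uB ((0:ℝ) + y * Complex.I)) ≠ 0 := by
        rw [Dc_B0]; exact_mod_cast h2.ne
      have hlog := Complex.continuousWithinAt_log_of_re_neg_of_im_zero (z := Dc w (uB ((0:ℝ) + y * Complex.I)))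
        (by rw [Dc_B0, Complex.ofReal_re]; exact h2) (by rw [Dc_B0, Complex.ofReal_im])
      have hlim := hlog.tendsto.comp (tendsto_nhdsWithin_iff.mpr ⟨hD, by
        have h3 : Iio π ∈ 𝓝 (0:ℝ) := Iio_mem_nhds pi_pos
        filter_upwards [self_mem_nhdsWithin, mem_nhdsWithin_of_mem_nhds h3] with ε hε hε2
        have hs := Real.sin_pos_of_pos_of_lt_pi hε hε2
        have hsh := sinh_pos_iff.mpr hy
        have : (Dc w (uB (ε + y * Complex.I))).im = (sin ε * sinh y)/2 := by
          unfold Dc; rw [Complex.sub_im, uB_im, Complex.ofReal_im]; ring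
        change 0 ≤ _
        rw [this]; positivity⟩)
      have he := (Complex.continuous_exp.tendsto _).comp (hlim.mul_const ((-(1/2:ℝ):ℝ):ℂ))
      rw [Complex.cpow_def_of_ne_zero hD0]
      refine he.congr' ?_
      filter_upwards [hD.eventually_ne hD0] with ε hε
      rw [Complex.cpow_def_of_ne_zero hε]; rfl
    · have h1 : cosh (y/2) < cosh w := Real.cosh_lt_cosh.mpr (by rw [abs_of_pos hw, abs_of_pos (by linarith)]; exact h)
      have h2 : 0 < cosh w^2 - cosh (y/2)^2 := by nlinarith
      have hs : Dc w (uB ((0:ℝ) + y * Complex.I)) ∈ Complex.slitPlane := by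
        rw [Dc_B0]; exact Complex.ofReal_mem_slitPlane.mpr h2
      exact (continuousAt_cpow_const hs).tendsto.comp hD

open Filter Topology in
lemma Om_lim (y : ℝ) (hy : 0 < y) : Tendsto (fun ε : ℝ => Om (ε + y * Complex.I)) (𝓝[>] 0)
    (𝓝 (Om ((0:ℝ) + y * Complex.I))) := by
  have hB := JB_lim y hy
  have hA : Tendsto (fun ε : ℝ => Jc (1/2) (uA (ε + y * Complex.I))) (𝓝[>] 0) (𝓝 (Jc (1/2) (uA ((0:ℝ) + y * Complex.I)))) := by
    have h1 : ContinuousAt (fun z => Jc (1/2) (uA z)) ((0:ℝ) + y * Complex.I) :=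
      (JA_diff _ (by rw [uA_zero]; exact ofReal_SU _ (nsq_lt y))).continuousAt
    have h2 : Tendsto (fun ε : ℝ => (ε + y * Complex.I : ℂ)) (𝓝[>] 0) (𝓝 ((0:ℝ) + y * Complex.I)) := by
      have : Continuous (fun ε : ℝ => (ε + y * Complex.I : ℂ)) := by fun_prop
      exact (this.tendsto 0).mono_left nhdsWithin_le_nhds
    exact h1.tendsto.comp h2
  have cc : ∀ f : ℝ → ℂ, Continuous f → Tendsto f (𝓝[>] 0) (𝓝 (f 0)) := fun f hf => (hf.tendsto 0).mono_left nhdsWithin_le_nhds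
  have c1 := cc (fun ε => Complex.cos ((π - (ε + y * Complex.I))/3)) (by fun_prop)
  have c2 := cc (fun ε => Complex.cos ((ε + y * Complex.I)/3)) (by fun_prop)
  have c3 := cc (fun ε => 2 * Complex.I * (√3:ℝ) * Complex.sin ((ε + y * Complex.I)/3 - π/6)) (by fun_prop)
  exact ((c1.mul (hA.pow 2)).add (c2.mul (hB.pow 2))).sub (c3.mul (hA.mul hB))

lemma Om_zero_im (y : ℝ) (hy : 0 < y) : (Om ((0:ℝ) + y * Complex.I)).im = -(√3 * (aR y^2 * sinh (y/3))) := by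
  unfold Om
  have hq := JB0_im y hy
  rw [JA_zero]
  set B := Jc (1/2) (uB ((0:ℝ) + y * Complex.I))
  have e1 : Complex.cos ((π - ((0:ℝ) + y * Complex.I))/3) = ((1/2 * cosh (y/3) : ℝ):ℂ) + ((√3/2 * sinh (y/3) : ℝ):ℂ) * Complex.I := by
    rw [show (π - ((0:ℝ) + y * Complex.I))/3 = ((π/3:ℝ):ℂ) + ((-(y/3):ℝ):ℂ) * Complex.I by push_cast; ring]
    apply Complex.ext
    · rw [cos_re, cos_pi_div_three, Real.cosh_neg]; simp only [Complex.add_re, Complex.re_ofReal_mul, Complex.I_re, Complex.ofReal_re, mul_zero, add_zero]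
    · rw [cos_im, Real.sin_pi_div_three, Real.sinh_neg]; simp only [Complex.add_im, Complex.im_ofReal_mul, Complex.I_im, Complex.ofReal_im]; ring
  have e2 : Complex.cos (((0:ℝ) + y * Complex.I)/3) = (cosh (y/3) : ℝ) := by
    rw [Complex.ofReal_cosh, ← Complex.cos_mul_I]; congr 1; push_cast; ring
  have e3 : Complex.sin (((0:ℝ) + y * Complex.I)/3 - π/6) = ((-(1/2) * cosh (y/3) : ℝ):ℂ) + ((√3/2 * sinh (y/3) : ℝ):ℂ) * Complex.I := by
    have : ((0:ℝ) + y * Complex.I)/3 - π/6 = π/2 - (((2*π/3 : ℝ):ℂ) + ((-(y/3):ℝ):ℂ) * Complex.I) := by push_cast; ring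
    rw [this, Complex.sin_pi_div_two_sub]
    have h2 : 2*π/3 = π - π/3 := by ring
    apply Complex.ext
    · rw [cos_re, h2, Real.cos_pi_sub, cos_pi_div_three, Real.cosh_neg]; simp only [Complex.add_re, Complex.re_ofReal_mul, Complex.I_re, Complex.ofReal_re, mul_zero, add_zero]
    · rw [cos_im, h2, Real.sin_pi_sub, Real.sin_pi_div_three, Real.sinh_neg]; simp only [Complex.add_im, Complex.im_ofReal_mul, Complex.I_im, Complex.ofReal_im]; ring
  rw [e1, e2, e3]
  have hB : B = (B.re:ℂ) + ((-(√3/2 * aR y) : ℝ):ℂ) * Complex.I := by rw [← hq, Complex.re_add_im]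
  rw [hB]
  generalize B.re = r
  generalize aR y = a
  generalize cosh (y/3) = c
  generalize sinh (y/3) = s
  have h3 : √3 * √3 = (3:ℝ) := Real.mul_self_sqrt (by norm_num)
  generalize √3 = t at *
  simp only [pow_two, Complex.add_im, Complex.sub_im, Complex.mul_im, Complex.mul_re, Complex.add_re, Complex.sub_re, Complex.ofReal_re, Complex.ofReal_im, Complex.I_re, Complex.I_im, Complex.re_ofNat, Complex.im_ofNat]
  ring_nf
  grind

lemma AR_nonneg (x : ℝ) (h0 : 0 < x) (h1 : x < π) : 0 < AR x :=
  JR_pos _ le_rfl _ (by linarith [(cos_lt1 x h0 h1).2])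

lemma AR_cont : ContinuousOn AR (Ioo 0 π) := by
  intro x hx
  have h := (JR_hasDerivAt (1/2) le_rfl ((1 - cos x)/2) (by linarith [(cos_lt1 x hx.1 hx.2).2])).continuousAt
  exact (ContinuousAt.comp (f := fun x => (1 - cos x)/2) (g := JR (1/2)) h (by fun_prop)).continuousWithinAt

lemma AR_bd (x : ℝ) (h0 : 0 < x) (h1 : x < π) : AR x^2 ≤ kap^2 * ((π - x)/π) ^ (-(5/6):ℝ) := by
  have hpi := pi_pos
  have hs : (π-x)/π ≤ cos (x/2) := by
    have := Real.mul_le_sin (x := π/2 - x/2) (by linarith) (by linarith)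
    rw [Real.sin_pi_div_two_sub] at this
    refine le_trans (le_of_eq ?_) this
    field_simp
  have hp : 0 < (π-x)/π := div_pos (by linarith) hpi
  have hc : 0 < cos (x/2) := lt_of_lt_of_le hp hs
  have hb := JR_bd (cos (x/2)) hc
  have e : 1 - cos (x/2)^2 = (1 - cos x)/2 := by
    have := Real.cos_sq (x/2); rw [show 2*(x/2) = x by ring] at this; rw [this]; ring
  rw [e] at hb
  change AR x ≤ _ at hb
  have h2 := rpow_le_rpow_of_nonpos hp hs (by norm_num : (-(5/12):ℝ) ≤ 0)
  have h3 : AR x ≤ ((π-x)/π) ^ (-(5/12):ℝ) * kap := hb.trans (mul_le_mul_of_nonneg_right h2 kap_nonneg)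
  have h4 := pow_le_pow_left₀ (AR_nonneg x h0 h1).le h3 2
  refine h4.trans (le_of_eq ?_)
  rw [mul_pow, ← Real.rpow_natCast, ← Real.rpow_mul hp.le, mul_comm]
  congr 2; norm_num

lemma AR2_int : IntegrableOn (fun x => AR x^2) (Ioo 0 π) := by
  have hpi := pi_pos
  have h1 : IntervalIntegrable (fun x : ℝ => x ^ (-(5/6):ℝ)) volume 0 1 := intervalIntegral.intervalIntegrable_rpow' (by norm_num)
  have h2 : IntervalIntegrable (fun x : ℝ => (π - x) ^ (-(5/6):ℝ)) volume 0 π := by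
    have := (intervalIntegral.intervalIntegrable_rpow' (a := 0) (b := π) (r := -(5/6)) (by norm_num)).comp_sub_left π
    simpa using this.symm
  have h3 := (intervalIntegrable_iff_integrableOn_Ioo_of_le hpi.le).mp h2
  refine Integrable.mono' (h3.const_mul (kap^2 * π ^ (5/6:ℝ))) ((AR_cont.pow 2).aestronglyMeasurable measurableSet_Ioo) ?_
  filter_upwards [ae_restrict_mem measurableSet_Ioo] with x hx
  rw [norm_of_nonneg (by positivity)]
  refine (AR_bd x hx.1 hx.2).trans (le_of_eq ?_)
  rw [Real.div_rpow (by linarith [hx.2]) hpi.le, Real.rpow_neg hpi.le, div_inv_eq_mul]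
  ring

lemma AR2_mul_int (f : ℝ → ℝ) (hf : Continuous f) (hb : ∀ x, |f x| ≤ 1) : IntegrableOn (fun x => f x * AR x^2) (Ioo 0 π) := by
  refine Integrable.mono' AR2_int ((hf.continuousOn.mul (AR_cont.pow 2)).aestronglyMeasurable measurableSet_Ioo) ?_
  refine Filter.Eventually.of_forall fun x => ?_
  rw [norm_mul, Real.norm_eq_abs, norm_of_nonneg (sq_nonneg (AR x))]
  nlinarith [hb x, sq_nonneg (AR x)]

lemma ph_int : IntervalIntegrable ph volume 0 π := by
  rw [intervalIntegrable_iff_integrableOn_Ioo_of_le pi_pos.le]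
  exact AR2_mul_int (fun x => cos ((π-x)/3)) (by fun_prop) (fun x => Real.abs_cos_le_one _)
lemma ph_int' : IntervalIntegrable (fun x => ph (π - x)) volume 0 π := by
  have := ph_int.comp_sub_left π
  simpa using this.symm

noncomputable def gg (x : ℝ) : ℝ := ph x + ph (π - x)
lemma gg_int : IntervalIntegrable gg volume 0 (π/2) := (ph_int.add ph_int').mono_set (by
  rw [uIcc_of_le (by positivity), uIcc_of_le (by positivity)]; exact Icc_subset_Icc_right (by linarith [pi_pos]))

lemma gg_fold : ∫ x in (0:ℝ)..(π/2), gg x = ∫ x in Ioo 0 π, ph x := by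
  have hpi := pi_pos
  have hs : uIcc 0 (π/2) ⊆ uIcc 0 π := by
    rw [uIcc_of_le (by positivity), uIcc_of_le (by positivity)]; exact Icc_subset_Icc_right (by linarith)
  have hs2 : uIcc (π/2) π ⊆ uIcc 0 π := by
    rw [uIcc_of_le (by linarith), uIcc_of_le (by positivity)]; exact Icc_subset_Icc_left (by linarith)
  unfold gg
  rw [intervalIntegral.integral_add (ph_int.mono_set hs) (ph_int'.mono_set hs),
    intervalIntegral.integral_comp_sub_left (fun x => ph x) π]
  rw [show π - π/2 = π/2 by ring, sub_zero, intervalIntegral.integral_add_adjacent_intervals (ph_int.mono_set hs) (ph_int.mono_set hs2),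
    intervalIntegral.integral_of_le hpi.le, integral_Ioc_eq_integral_Ioo]

lemma Om_cauchy (ε R : ℝ) (h0 : 0 < ε) (h1 : ε < π/2) (hR : 0 < R) :
    |(∫ x in ε..(π/2), gg x) + ∫ y in (0:ℝ)..R, (Om (ε + y * Complex.I)).im| ≤ 6 * kap^2 * NN R * (π/2) := by
  have hpi := pi_pos
  have hd : DifferentiableOn ℂ Om (uIcc ε (π/2) ×ℂ uIcc 0 R) := by
    intro z hz
    rw [uIcc_of_le h1.le] at hz
    have : z.re ∈ Icc ε (π/2) := hz.1
    exact (Om_diff z (by linarith [this.1]) (by linarith [this.2])).differentiableWithinAt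
  have h := Complex.integral_boundary_rect_eq_zero_of_differentiableOn Om (ε:ℂ) (((π/2:ℝ):ℂ) + R * Complex.I)
    (by simpa using hd)
  have e1 : (((π/2:ℝ):ℂ) + R * Complex.I).re = π/2 := by simp
  have e2 : (((π/2:ℝ):ℂ) + R * Complex.I).im = R := by simp
  rw [e1, e2, Complex.ofReal_re, Complex.ofReal_im] at h
  simp only [Complex.ofReal_zero, zero_mul, add_zero, smul_eq_mul] at h
  have cOm : ∀ z : ℂ, 0 < z.re → z.re < π → ContinuousAt Om z := fun z a b => (Om_diff z a b).continuousAt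
  have cv : ∀ x : ℝ, 0 < x → x < π → Continuous (fun y : ℝ => Om (x + y * Complex.I)) := by
    intro x a b
    rw [continuous_iff_continuousAt]; intro y
    exact ContinuousAt.comp (f := fun y : ℝ => (x + y * Complex.I : ℂ)) (cOm _ (by simpa using a) (by simpa using b)) (by fun_prop)
  have ch : ContinuousOn (fun x : ℝ => Om x) (uIcc ε (π/2)) := by
    intro x hx
    rw [uIcc_of_le h1.le] at hx
    exact (ContinuousAt.comp (f := fun x : ℝ => (x : ℂ)) (cOm _ (by simp; linarith [hx.1]) (by simp; linarith [hx.2])) (by fun_prop)).continuousWithinAt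
  have r1 : (∫ x in ε..(π/2), Om x).re = ∫ x in ε..(π/2), gg x := by
    have := Complex.reCLM.intervalIntegral_comp_comm (ch.intervalIntegrable (μ := volume))
    change _ = (∫ x in ε..(π/2), Om x).re at this
    rw [← this]
    refine intervalIntegral.integral_congr (fun x hx => ?_)
    rw [uIcc_of_le h1.le] at hx
    exact Om_real x (by linarith [hx.1]) (by linarith [hx.2])
  have imc : ∀ x : ℝ, 0 < x → x < π → (∫ y in (0:ℝ)..R, Om (x + y * Complex.I)).im = ∫ y in (0:ℝ)..R, (Om (x + y * Complex.I)).im := by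
    intro x a b
    have := Complex.imCLM.intervalIntegral_comp_comm ((cv x a b).intervalIntegrable (μ := volume) 0 R)
    exact this.symm
  have r2 := imc ε h0 (by linarith)
  have r3 : (∫ y in (0:ℝ)..R, Om ((π/2:ℝ) + y * Complex.I)).im = 0 := by
    rw [imc (π/2) (by linarith) (by linarith)]
    simp only [Om_mid, intervalIntegral.integral_zero]
  have top : ‖∫ x in ε..(π/2), Om (x + R * Complex.I)‖ ≤ 6 * kap^2 * NN R * (π/2) := by
    have := intervalIntegral.norm_integral_le_of_norm_le_const (a := ε) (b := π/2) (f := fun x : ℝ => Om (x + R * Complex.I)) (C := 6 * kap^2 * NN R)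
      (fun x _ => Om_bd x R hR)
    have h0' := (norm_nonneg _).trans (Om_bd 0 R hR)
    refine this.trans ?_
    rw [abs_of_pos (by linarith)]
    exact mul_le_mul_of_nonneg_left (by linarith) h0'
  have hre := congrArg Complex.re h
  simp only [Complex.sub_re, Complex.add_re, Complex.I_mul_re, Complex.zero_re] at hre
  rw [r1, r2, r3] at hre
  have : (∫ x in ε..(π/2), gg x) + ∫ y in (0:ℝ)..R, (Om (ε + y * Complex.I)).im = (∫ x in ε..(π/2), Om (x + R * Complex.I)).re := by linarith
  rw [this]
  exact (Complex.abs_re_le_norm _).trans top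

lemma aR_cont : Continuous aR := by
  rw [continuous_iff_continuousAt]; intro y
  exact ContinuousAt.comp (f := fun y => -sinh (y/2)^2) (g := JR (1/2)) (JR_hasDerivAt (1/2) le_rfl _ (nsq_lt y)).continuousAt (by fun_prop)

open Filter Topology in
lemma star_R (R : ℝ) (hR : 0 < R) :
    |(∫ x in Ioo 0 π, ph x) - √3 * ∫ y in (0:ℝ)..R, aR y^2 * sinh (y/3)| ≤ 6 * kap^2 * NN R * (π/2) := by
  have hpi := pi_pos
  have l1 : Tendsto (fun ε : ℝ => ∫ x in ε..(π/2), gg x) (𝓝[>] 0) (𝓝 (∫ x in (0:ℝ)..(π/2), gg x)) := by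
    have h1 : IntegrableOn gg (uIcc 0 (π/2)) := by
      rw [uIcc_of_le (by positivity), integrableOn_Icc_iff_integrableOn_Ioc]
      exact (intervalIntegrable_iff_integrableOn_Ioc_of_le (by positivity)).mp gg_int
    have := (intervalIntegral.continuousOn_primitive_interval_left h1) 0 left_mem_uIcc
    refine this.tendsto.mono_left ?_
    rw [uIcc_of_le (by positivity)]
    exact nhdsWithin_le_of_mem (Icc_mem_nhdsGT (by positivity))
  have l2 : Tendsto (fun ε : ℝ => ∫ y in (0:ℝ)..R, (Om (ε + y * Complex.I)).im) (𝓝[>] 0)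
      (𝓝 (∫ y in (0:ℝ)..R, -(√3 * (aR y^2 * sinh (y/3))))) := by
    refine intervalIntegral.tendsto_integral_filter_of_dominated_convergence (fun y => 6 * kap^2 * NN y) ?_ ?_ ?_ ?_
    · filter_upwards [self_mem_nhdsWithin, mem_nhdsWithin_of_mem_nhds (Iio_mem_nhds hpi)] with ε h0 h1
      apply Continuous.aestronglyMeasurable
      refine Complex.continuous_im.comp ?_
      rw [continuous_iff_continuousAt]; intro y
      exact ContinuousAt.comp (f := fun y : ℝ => (ε + y * Complex.I : ℂ)) (Om_diff _ (by simpa using h0) (by simpa using h1)).continuousAt (by fun_prop)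
    · refine Eventually.of_forall fun ε => Eventually.of_forall fun y hy => ?_
      rw [uIoc_of_le hR.le] at hy
      exact (Complex.abs_im_le_norm _).trans (Om_bd ε y hy.1)
    · exact (NN_int R hR).const_mul _
    · refine Eventually.of_forall fun y hy => ?_
      rw [uIoc_of_le hR.le] at hy
      rw [← Om_zero_im y hy.1]
      exact (Complex.continuous_im.tendsto _).comp (Om_lim y hy.1)
  have l3 := (l1.add l2).abs
  rw [intervalIntegral.integral_neg, intervalIntegral.integral_const_mul, gg_fold, ← sub_eq_add_neg] at l3
  refine le_of_tendsto l3 ?_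
  filter_upwards [self_mem_nhdsWithin, mem_nhdsWithin_of_mem_nhds (Iio_mem_nhds (by positivity : (0:ℝ) < π/2))] with ε h0 h1
  exact Om_cauchy ε R h0 h1 hR

open Filter Topology in
lemma star : IntegrableOn (fun y => aR y^2 * sinh (y/3)) (Ioi 0) ∧
    ∫ x in Ioo 0 π, ph x = √3 * ∫ y in Ioi (0:ℝ), aR y^2 * sinh (y/3) := by
  have hl : Tendsto (fun R : ℝ => √3 * ∫ y in (0:ℝ)..R, aR y^2 * sinh (y/3)) atTop (𝓝 (∫ x in Ioo 0 π, ph x)) := by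
    rw [tendsto_iff_dist_tendsto_zero]
    have h1 : Tendsto (fun R => 6 * kap^2 * NN R * (π/2)) atTop (𝓝 0) := by
      simpa using (NN_lim.const_mul (6*kap^2)).mul_const (π/2)
    refine squeeze_zero' (Eventually.of_forall fun _ => dist_nonneg) ?_ h1
    filter_upwards [eventually_gt_atTop 0] with R hR
    rw [dist_comm, Real.dist_eq]
    exact star_R R hR
  have h3 : (√3:ℝ) ≠ 0 := by positivity
  have hl2 : Tendsto (fun R : ℝ => ∫ y in (0:ℝ)..R, aR y^2 * sinh (y/3)) atTop (𝓝 ((∫ x in Ioo 0 π, ph x)/√3)) := by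
    have := hl.div_const (√3)
    refine this.congr fun R => ?_
    field_simp
  have hcont : Continuous (fun y => aR y^2 * sinh (y/3)) := (aR_cont.pow 2).mul (by fun_prop)
  have hi : IntegrableOn (fun y => aR y^2 * sinh (y/3)) (Ioi 0) := by
    refine integrableOn_Ioi_of_intervalIntegral_norm_tendsto ((∫ x in Ioo 0 π, ph x)/√3) 0 (b := fun R : ℝ => R) (l := atTop)
      (fun R => (hcont.integrableOn_Icc (a := 0) (b := R)).mono_set Ioc_subset_Icc_self) tendsto_id ?_
    refine hl2.congr' ?_
    filter_upwards [eventually_ge_atTop 0] with R hR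
    refine intervalIntegral.integral_congr fun y hy => ?_
    rw [uIcc_of_le hR] at hy
    have : 0 ≤ sinh (y/3) := Real.sinh_nonneg_iff.mpr (by linarith [hy.1])
    exact (norm_of_nonneg (by positivity)).symm
  refine ⟨hi, ?_⟩
  have := tendsto_nhds_unique (intervalIntegral_tendsto_integral_Ioi 0 hi tendsto_id) hl2
  rw [this]; field_simp

lemma cov (s t : Set ℝ) (hs : MeasurableSet s) (f f' inv g : ℝ → ℝ) (hf : ∀ x ∈ s, HasDerivAt f (f' x) x)
    (h1 : ∀ x ∈ s, f x ∈ t) (h2 : ∀ r ∈ t, inv r ∈ s) (h3 : ∀ x ∈ s, inv (f x) = x) (h4 : ∀ r ∈ t, f (inv r) = r) :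
    ∫ r in t, g r = ∫ x in s, |f' x| * g (f x) := by
  have him : f '' s = t := by
    ext r; constructor
    · rintro ⟨x, hx, rfl⟩; exact h1 x hx
    · intro hr; exact ⟨inv r, h2 r hr, h4 r hr⟩
  rw [← him]
  exact integral_image_eq_integral_abs_deriv_smul hs (fun x hx => (hf x hx).hasDerivWithinAt)
    (fun x hx y hy hxy => by rw [← h3 x hx, ← h3 y hy]; exact congrArg inv hxy) g

lemma cos_bd (x a b : ℝ) (h0 : 0 ≤ a) (hax : a < x) (hxb : x < b) (hb : b ≤ π) : cos x < cos a ∧ cos b < cos x :=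
  ⟨Real.cos_lt_cos_of_nonneg_of_le_pi h0 (by linarith) hax, Real.cos_lt_cos_of_nonneg_of_le_pi (by linarith) hb hxb⟩

lemma arccos_bd (c a b : ℝ) (h0 : 0 ≤ a) (hb : b ≤ π) (hab : a ≤ b) (h1 : cos b < c) (h2 : c < cos a) :
    a < Real.arccos c ∧ Real.arccos c < b ∧ cos (Real.arccos c) = c := by
  have l1 : -1 ≤ c := (Real.neg_one_le_cos b).trans h1.le
  have l2 : c ≤ 1 := h2.le.trans (Real.cos_le_one a)
  have e := Real.cos_arccos l1 l2
  refine ⟨?_, ?_, e⟩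
  · have := Real.arccos_lt_arccos l1 h2 (Real.cos_le_one a)
    rwa [Real.arccos_cos h0 (by linarith)] at this
  · have := Real.arccos_lt_arccos (Real.neg_one_le_cos b) h1 l2
    rwa [Real.arccos_cos (by linarith) hb] at this

lemma uu_c (c : ℝ) : uu (1 + 2 * c) = (1 - (4*c^3 - 3*c))/2 := by unfold uu; ring

lemma pf_AR (r x : ℝ) (h : uu r = (1 - cos x)/2) : pf r^2 = 3/π^2 * AR x^2 := by
  unfold pf PP AR; rw [h, mul_pow, div_pow, Real.sq_sqrt (by norm_num)]

lemma X_cov : ∫ r in Ioo (2:ℝ) 3, pf r^2 = 2/π^2 * ∫ x in Ioo 0 π, sin (x/3) * AR x^2 := by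
  have hpi := pi_pos
  rw [cov (Ioo 0 π) (Ioo 2 3) measurableSet_Ioo (fun x => 1 + 2 * cos (x/3)) (fun x => 2 * (-sin (x/3) * (1/3)))
    (fun r => 3 * Real.arccos ((r-1)/2)), ← integral_const_mul]
  · refine setIntegral_congr_fun measurableSet_Ioo fun x hx => ?_
    have hs : 0 < sin (x/3) := Real.sin_pos_of_pos_of_lt_pi (by linarith [hx.1]) (by linarith [hx.2])
    try simp only
    rw [pf_AR _ x (by rw [uu_c, ← Real.cos_three_mul]; congr 3; ring), abs_of_neg (by nlinarith)]
    ring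
  · intro x _
    exact (((Real.hasDerivAt_cos (x/3)).comp x ((hasDerivAt_id x).div_const 3)).const_mul 2).const_add 1
  · intro x hx
    have := cos_bd (x/3) 0 (π/3) le_rfl (by linarith [hx.1]) (by linarith [hx.2]) (by linarith)
    rw [Real.cos_zero, cos_pi_div_three] at this
    exact ⟨by linarith, by linarith⟩
  · intro r hr
    obtain ⟨a, b, -⟩ := arccos_bd ((r-1)/2) 0 (π/3) le_rfl (by linarith) (by linarith) (by rw [cos_pi_div_three]; linarith [hr.1]) (by rw [Real.cos_zero]; linarith [hr.2])
    exact ⟨by linarith, by linarith⟩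
  · intro x hx
    try simp only
    rw [show (1 + 2 * cos (x/3) - 1)/2 = cos (x/3) by ring, Real.arccos_cos (by linarith [hx.1]) (by linarith [hx.2])]; ring
  · intro r hr
    obtain ⟨-, -, c⟩ := arccos_bd ((r-1)/2) 0 (π/3) le_rfl (by linarith) (by linarith) (by rw [cos_pi_div_three]; linarith [hr.1]) (by rw [Real.cos_zero]; linarith [hr.2])
    try simp only
    rw [show 3 * Real.arccos ((r-1)/2)/3 = Real.arccos ((r-1)/2) by ring, c]; ring

lemma Y_cov : ∫ r in Ioo (-1:ℝ) 0, pf r^2 = 2/π^2 * ∫ x in Ioo 0 π, sin ((π-x)/3) * AR x^2 := by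
  have hpi := pi_pos
  rw [cov (Ioo 0 π) (Ioo (-1) 0) measurableSet_Ioo (fun x => 1 + 2 * -cos ((π-x)/3)) (fun x => 2 * -(-sin ((π-x)/3) * (-1/3)))
    (fun r => π - 3 * Real.arccos ((1-r)/2)), ← integral_const_mul]
  · refine setIntegral_congr_fun measurableSet_Ioo fun x hx => ?_
    have hs : 0 < sin ((π-x)/3) := Real.sin_pos_of_pos_of_lt_pi (by linarith [hx.2]) (by linarith [hx.1])
    try simp only
    rw [pf_AR _ x (by
      rw [uu_c, show 4 * (-cos ((π-x)/3))^3 - 3 * -cos ((π-x)/3) = -(4 * cos ((π-x)/3)^3 - 3 * cos ((π-x)/3)) by ring,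
        ← Real.cos_three_mul, show 3 * ((π-x)/3) = π - x by ring, Real.cos_pi_sub, neg_neg]), abs_of_neg (by nlinarith)]
    ring
  · intro x _
    exact ((((Real.hasDerivAt_cos ((π-x)/3)).comp x (((hasDerivAt_id x).const_sub π).div_const 3)).neg).const_mul 2).const_add 1
  · intro x hx
    have := cos_bd ((π-x)/3) 0 (π/3) le_rfl (by linarith [hx.2]) (by linarith [hx.1]) (by linarith)
    rw [Real.cos_zero, cos_pi_div_three] at this
    exact ⟨by linarith, by linarith⟩
  · intro r hr
    obtain ⟨a, b, -⟩ := arccos_bd ((1-r)/2) 0 (π/3) le_rfl (by linarith) (by linarith) (by rw [cos_pi_div_three]; linarith [hr.2]) (by rw [Real.cos_zero]; linarith [hr.1])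
    exact ⟨by linarith, by linarith⟩
  · intro x hx
    try simp only
    rw [show (1 - (1 + 2 * -cos ((π-x)/3)))/2 = cos ((π-x)/3) by ring, Real.arccos_cos (by linarith [hx.2]) (by linarith [hx.1])]; ring
  · intro r hr
    obtain ⟨-, -, c⟩ := arccos_bd ((1-r)/2) 0 (π/3) le_rfl (by linarith) (by linarith) (by rw [cos_pi_div_three]; linarith [hr.2]) (by rw [Real.cos_zero]; linarith [hr.1])
    try simp only
    rw [show (π - (π - 3 * Real.arccos ((1-r)/2)))/3 = Real.arccos ((1-r)/2) by ring, c]; ring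

lemma Z_cov : ∫ r in Ioo (0:ℝ) 2, pf r^2 = 2/π^2 * ∫ x in Ioo 0 π, sin ((π+x)/3) * AR x^2 := by
  have hpi := pi_pos
  have c23 : cos (2*π/3) = -1/2 := by rw [show 2*π/3 = π - π/3 by ring, Real.cos_pi_sub, cos_pi_div_three]; norm_num
  rw [cov (Ioo 0 π) (Ioo 0 2) measurableSet_Ioo (fun x => 1 + 2 * -cos ((π+x)/3)) (fun x => 2 * -(-sin ((π+x)/3) * (1/3)))
    (fun r => 3 * Real.arccos ((1-r)/2) - π), ← integral_const_mul]
  · refine setIntegral_congr_fun measurableSet_Ioo fun x hx => ?_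
    have hs : 0 < sin ((π+x)/3) := Real.sin_pos_of_pos_of_lt_pi (by linarith [hx.1]) (by linarith [hx.2])
    try simp only
    rw [pf_AR _ x (by
      rw [uu_c, show 4 * (-cos ((π+x)/3))^3 - 3 * -cos ((π+x)/3) = -(4 * cos ((π+x)/3)^3 - 3 * cos ((π+x)/3)) by ring,
        ← Real.cos_three_mul, show 3 * ((π+x)/3) = x + π by ring, Real.cos_add_pi, neg_neg]), abs_of_pos (by nlinarith)]
    ring
  · intro x _
    exact ((((Real.hasDerivAt_cos ((π+x)/3)).comp x (((hasDerivAt_id x).const_add π).div_const 3)).neg).const_mul 2).const_add 1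
  · intro x hx
    have := cos_bd ((π+x)/3) (π/3) (2*π/3) (by linarith) (by linarith [hx.1]) (by linarith [hx.2]) (by linarith)
    rw [c23, cos_pi_div_three] at this
    exact ⟨by linarith, by linarith⟩
  · intro r hr
    obtain ⟨a, b, -⟩ := arccos_bd ((1-r)/2) (π/3) (2*π/3) (by linarith) (by linarith) (by linarith) (by rw [c23]; linarith [hr.2]) (by rw [cos_pi_div_three]; linarith [hr.1])
    exact ⟨by linarith, by linarith⟩
  · intro x hx
    try simp only
    rw [show (1 - (1 + 2 * -cos ((π+x)/3)))/2 = cos ((π+x)/3) by ring, Real.arccos_cos (by linarith [hx.1]) (by linarith [hx.2])]; ring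
  · intro r hr
    obtain ⟨-, -, c⟩ := arccos_bd ((1-r)/2) (π/3) (2*π/3) (by linarith) (by linarith) (by linarith) (by rw [c23]; linarith [hr.2]) (by rw [cos_pi_div_three]; linarith [hr.1])
    try simp only
    rw [show (π + (3 * Real.arccos ((1-r)/2) - π))/3 = Real.arccos ((1-r)/2) by ring, c]; ring

lemma O_cov : ∫ r in Ioi (3:ℝ), pf r^2 = 2/π^2 * ∫ y in Ioi (0:ℝ), aR y^2 * sinh (y/3) := by
  have hpi := pi_pos
  have key : ∀ r, 3 < r → cosh (arsinh (√(((r-1)/2)^2-1))) = (r-1)/2 := by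
    intro r hr
    rw [Real.cosh_arsinh, Real.sq_sqrt (by nlinarith), add_sub_cancel, Real.sqrt_sq (by linarith)]
  rw [cov (Ioi 0) (Ioi 3) measurableSet_Ioi (fun x => 1 + 2 * cosh (x/3)) (fun x => 2 * (sinh (x/3) * (1/3)))
    (fun r => 3 * arsinh (√(((r-1)/2)^2-1))), ← integral_const_mul]
  · refine setIntegral_congr_fun measurableSet_Ioi fun x hx => ?_
    have hx : 0 < x := hx
    have hs : 0 < sinh (x/3) := sinh_pos_iff.mpr (by linarith)
    try simp only
    have e : uu (1 + 2 * cosh (x/3)) = -sinh (x/2)^2 := by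
      rw [uu_c, ← Real.cosh_three_mul, show 3 * (x/3) = x by ring, (cosh_half x).2]; ring
    have e2 : pf (1 + 2 * cosh (x/3))^2 = 3/π^2 * aR x^2 := by
      unfold pf PP aR; rw [e, mul_pow, div_pow, Real.sq_sqrt (by norm_num)]
    rw [e2, abs_of_pos (by positivity)]
    ring
  · intro x _
    exact (((Real.hasDerivAt_cosh (x/3)).comp x ((hasDerivAt_id x).div_const 3)).const_mul 2).const_add 1
  · intro x hx
    have hx : 0 < x := hx
    have := Real.one_lt_cosh.mpr (by positivity : x/3 ≠ 0)
    rw [mem_Ioi]; linarith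
  · intro r hr
    have hr : 3 < r := hr
    have : 0 < arsinh (√(((r-1)/2)^2-1)) := Real.arsinh_pos_iff.mpr (Real.sqrt_pos.mpr (by nlinarith))
    rw [mem_Ioi]; linarith
  · intro x hx
    have hx : 0 < x := hx
    have hs : 0 < sinh (x/3) := sinh_pos_iff.mpr (by linarith)
    try simp only
    rw [show ((1 + 2 * cosh (x/3) - 1)/2)^2 - 1 = sinh (x/3)^2 by rw [Real.sinh_sq]; ring, Real.sqrt_sq hs.le, Real.arsinh_sinh]; ring
  · intro r hr
    try simp only
    rw [show 3 * arsinh (√(((r-1)/2)^2-1))/3 = arsinh (√(((r-1)/2)^2-1)) by ring, key r hr]; ring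

lemma phi_deriv (x : ℝ) (hx : 2 < x) : HasDerivAt (fun r : ℝ => (r-3)/(r-1)) (2/(x-1)^2) x := by
  have hx1 : x - 1 ≠ 0 := by linarith
  refine (((hasDerivAt_id x).sub_const 3).div ((hasDerivAt_id x).sub_const 1) hx1).congr_deriv ?_
  simp only [id]; field_simp; ring

lemma phi_cov (s t : Set ℝ) (hs : MeasurableSet s) (h0 : ∀ x ∈ s, 2 < x) (h1 : ∀ x ∈ s, (x-3)/(x-1) ∈ t) (h2 : ∀ r ∈ t, (3-r)/(1-r) ∈ s)
   (h3 : ∀ r ∈ t, r < 1) : ∫ r in t, pf r^2 = 1/2 * ∫ r in s, pf r^2 := by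
  rw [cov s t hs (fun r => (r-3)/(r-1)) (fun x => 2/(x-1)^2) (fun r => (3-r)/(1-r)) (fun r => pf r^2) (fun x hx => phi_deriv x (h0 x hx)) h1 h2, ← integral_const_mul]
  · refine setIntegral_congr_fun hs fun x hx => ?_
    have := h0 x hx
    have hx1 : 0 < x - 1 := by linarith
    try simp only
    rw [pf_W x this, abs_of_pos (by positivity)]
    field_simp
  · intro x hx
    have := h0 x hx
    have hx1 : x - 1 ≠ 0 := by linarith
    try simp only
    have : 1 - (x-3)/(x-1) ≠ 0 := by
      have : 1 - (x-3)/(x-1) = 2/(x-1) := by field_simp; ring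
      rw [this]; positivity
    rw [div_eq_iff this]; field_simp; ring
  · intro r hr
    have := h3 r hr
    have hr1 : 1 - r ≠ 0 := by linarith
    try simp only
    have : (3-r)/(1-r) - 1 ≠ 0 := by
      have : (3-r)/(1-r) - 1 = 2/(1-r) := by field_simp; ring
      rw [this]; positivity
    rw [div_eq_iff this]; field_simp; ring

lemma YX : ∫ r in Ioo (-1:ℝ) 0, pf r^2 = 1/2 * ∫ r in Ioo (2:ℝ) 3, pf r^2 := by
  refine phi_cov _ _ measurableSet_Ioo (fun x hx => hx.1) (fun x hx => ?_) (fun r hr => ?_) (fun r hr => by linarith [hr.2])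
  · have hx1 : 0 < x - 1 := by linarith [hx.1]
    exact ⟨by rw [lt_div_iff₀ hx1]; linarith [hx.1], by rw [div_lt_iff₀ hx1]; linarith [hx.2]⟩
  · have hx1 : 0 < 1 - r := by linarith [hr.2]
    exact ⟨by rw [lt_div_iff₀ hx1]; linarith [hr.1], by rw [div_lt_iff₀ hx1]; linarith [hr.2]⟩

lemma hO : ∫ r in Ioo (0:ℝ) 1, pf r^2 = 1/2 * ∫ r in Ioi (3:ℝ), pf r^2 := by
  refine phi_cov _ _ measurableSet_Ioi (fun x (hx : 3 < x) => by linarith) (fun x (hx : 3 < x) => ?_) (fun r hr => ?_) (fun r hr => by linarith [hr.2])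
  · have hx1 : 0 < x - 1 := by linarith
    exact ⟨by rw [lt_div_iff₀ hx1]; linarith, by rw [div_lt_iff₀ hx1]; linarith⟩
  · have hx1 : 0 < 1 - r := by linarith [hr.2]
    rw [mem_Ioi]
    rw [lt_div_iff₀ hx1]; linarith [hr.1]

lemma Z_h : ∫ r in Ioo (0:ℝ) 2, pf r^2 = 18/5 * ∫ r in Ioo (0:ℝ) 1, pf r^2 := by
  have hpi := pi_pos
  have i1 := AR2_mul_int (fun x => sin (x/3)) (by fun_prop) (fun x => Real.abs_sin_le_one _)
  have i2 := AR2_mul_int (fun x => sin ((π-x)/3)) (by fun_prop) (fun x => Real.abs_sin_le_one _)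
  have s3 : √3 * √3 = (3:ℝ) := Real.mul_self_sqrt (by norm_num)
  have e1 : ∫ x in Ioo 0 π, sin ((π+x)/3) * AR x^2 = (∫ x in Ioo 0 π, sin (x/3) * AR x^2) + ∫ x in Ioo 0 π, sin ((π-x)/3) * AR x^2 := by
    rw [← integral_add i1 i2]
    congr 1; ext x
    have : sin ((π+x)/3) = sin (x/3) + sin ((π-x)/3) := by
      rw [add_div, sub_div, Real.sin_add, Real.sin_sub, cos_pi_div_three]; ring
    rw [this]; ring
  have e2 : √3 * ∫ x in Ioo 0 π, ph x = 2 * (∫ x in Ioo 0 π, sin (x/3) * AR x^2) + ∫ x in Ioo 0 π, sin ((π-x)/3) * AR x^2 := by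
    rw [← integral_const_mul, ← integral_const_mul, ← integral_add (i1.const_mul 2) i2]
    congr 1; ext x
    have : √3 * cos ((π-x)/3) = 2 * sin (x/3) + sin ((π-x)/3) := by
      rw [sub_div, Real.sin_sub, Real.cos_sub, cos_pi_div_three, Real.sin_pi_div_three]
      linear_combination (sin (x/3)/2) * s3
    unfold ph
    rw [← mul_assoc, this]; ring
  have e3 := star.2
  have hY := YX
  rw [Y_cov, X_cov] at hY
  rw [Z_cov, hO, O_cov, e1]
  rw [e3, ← mul_assoc, s3] at e2
  generalize (∫ x in Ioo 0 π, sin (x/3) * AR x^2) = a at *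
  generalize (∫ x in Ioo 0 π, sin ((π-x)/3) * AR x^2) = b at *
  generalize (∫ y in Ioi (0:ℝ), aR y^2 * sinh (y/3)) = c at *
  have hb : b = a/2 := by
    field_simp at hY; linarith
  rw [hb] at e2 ⊢
  have : c = 5/6 * a := by linarith
  rw [this]; ring

noncomputable def Bc (z : ℂ) : ℂ := ∫ θ in Ioo (-π) π, Complex.exp (z * (cos θ : ℂ))

lemma gauss_dom (c M : ℝ) (hc : 0 < c) : IntegrableOn (fun t : ℝ => t * exp (-c*t^2) * exp (M*t)) (Ioi 0) := by
  have h := ((integrable_mul_exp_neg_mul_sq (half_pos hc)).const_mul (exp (M^2/(2*c)))).integrableOn (s := Ioi 0)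
  refine Integrable.mono' h (by fun_prop) ?_
  refine (ae_restrict_iff' measurableSet_Ioi).mpr (ae_of_all _ fun t ht => ?_)
  have ht : 0 < t := ht
  rw [norm_of_nonneg (by positivity), mul_left_comm, mul_assoc, ← Real.exp_add, ← Real.exp_add]
  refine mul_le_mul_of_nonneg_left (Real.exp_le_exp.mpr ?_) ht.le
  have : M^2/(2*c) + -(c/2)*t^2 - (-c*t^2 + M*t) = (c*t-M)^2/(2*c) := by field_simp; ring
  have h2 : 0 ≤ (c*t-M)^2/(2*c) := by positivity
  linarith

lemma gauss2 (c P Q : ℝ) (hc : 0 < c) (z : ℂ) :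
    ∫ p in Ioi (0:ℝ) ×ˢ Ioo (-π) π, (p.1:ℂ) * Complex.exp (-c * p.1^2) * Complex.exp (z * p.1 * (P * cos p.2 + Q * sin p.2))
      = π/c * Complex.exp (z^2*(P^2+Q^2)/(4*c)) := by
  have h1 : ∀ R : ℝ, ∫ x : ℝ, Complex.exp (-c * x^2 + z*R * x + 0) = (π / c : ℂ)^(1/2:ℂ) * Complex.exp (z^2*R^2/(4*c)) := by
    intro R
    rw [integral_cexp_quadratic (by simpa using hc)]
    rw [neg_neg]; congr 2; field_simp; ring
  have h2 := integral_comp_polarCoord_symm (fun p : ℝ × ℝ => Complex.exp (-c * p.1^2 + z*P*p.1 + 0) * Complex.exp (-c * p.2^2 + z*Q*p.2 + 0))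
  rw [Measure.volume_eq_prod, integral_prod_mul (fun x : ℝ => Complex.exp (-c * x^2 + z*P*x + 0)) (fun x : ℝ => Complex.exp (-c * x^2 + z*Q*x + 0)), h1, h1] at h2
  have h3 : (π / c : ℂ)^(1/2:ℂ) * (π / c : ℂ)^(1/2:ℂ) = π/c := by
    rw [← Complex.cpow_add _ _ (by
      have := pi_pos
      have : ((π/c : ℝ) : ℂ) ≠ 0 := Complex.ofReal_ne_zero.mpr (by positivity)
      simpa using this)]; norm_num
  have h4 : (π / c : ℂ)^(1/2:ℂ) * Complex.exp (z^2*P^2/(4*c)) * ((π / c : ℂ)^(1/2:ℂ) * Complex.exp (z^2*Q^2/(4*c))) = π/c * Complex.exp (z^2*(P^2+Q^2)/(4*c)) := by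
    rw [mul_mul_mul_comm, h3, ← Complex.exp_add]; congr 2; ring
  rw [← h4, ← h2, polarCoord_target, Measure.volume_eq_prod]
  congr 1; ext p
  rw [polarCoord_symm_apply, Complex.real_smul, mul_assoc, ← Complex.exp_add, ← Complex.exp_add]
  congr 2
  have := Real.sin_sq_add_cos_sq p.2
  have : ((sin p.2 : ℂ))^2 + (cos p.2 : ℂ)^2 = 1 := by exact_mod_cast this
  push_cast at this ⊢
  linear_combination (c * p.1^2 : ℂ) * this

lemma Bc_shift (z : ℂ) (θ : ℝ) : Bc z = ∫ δ in Ioo (-π) π, Complex.exp (z * (cos (θ + δ) : ℂ)) := by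
  have hpi := pi_pos
  unfold Bc
  rw [← integral_Ioc_eq_integral_Ioo, ← integral_Ioc_eq_integral_Ioo, ← intervalIntegral.integral_of_le (by linarith), ← intervalIntegral.integral_of_le (by linarith)]
  rw [intervalIntegral.integral_comp_add_left (fun x => Complex.exp (z * (cos x : ℂ)))]
  have hp : Function.Periodic (fun x : ℝ => Complex.exp (z * (cos x : ℂ))) (2*π) := fun x => by simp only [Real.cos_add_two_pi]
  have := hp.intervalIntegral_add_eq (-π) (θ + -π)
  rw [show -π + 2*π = π by ring, show θ + -π + 2*π = θ + π by ring] at this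
  exact this

lemma gauss_B (c a b : ℝ) (hc : 0 < c) (z : ℂ) :
    ∫ t in Ioi (0:ℝ), (t:ℂ) * Complex.exp (-c * t^2) * (Bc (z*a*t) * Bc (z*b*t))
      = π/c * ∫ δ in Ioo (-π) π, Complex.exp (z^2*(a^2+b^2+2*a*b*cos δ)/(4*c)) := by
  let H : (ℝ × ℝ) × ℝ → ℂ := fun q => (q.1.1:ℂ) * Complex.exp (-c * q.1.1^2) * Complex.exp (z * q.1.1 * (a * cos q.1.2 + b * cos (q.1.2 + q.2)))
  have hH : Integrable H (((volume.restrict (Ioi (0:ℝ))).prod (volume.restrict (Ioo (-π) π))).prod (volume.restrict (Ioo (-π) π))) := by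
    have h := ((gauss_dom c (‖z‖*(|a|+|b|)) hc).comp_fst (volume.restrict (Ioo (-π) π))).comp_fst (volume.restrict (Ioo (-π) π))
    refine Integrable.mono' h (Continuous.aestronglyMeasurable (by fun_prop)) ?_
    have : ∀ᵐ q ∂(((volume.restrict (Ioi (0:ℝ))).prod (volume.restrict (Ioo (-π) π))).prod (volume.restrict (Ioo (-π) π))), 0 < q.1.1 := by
      rw [Measure.prod_restrict, Measure.prod_restrict]
      refine (ae_restrict_iff' ((measurableSet_Ioi.prod measurableSet_Ioo).prod measurableSet_Ioo)).mpr (ae_of_all _ fun q hq => hq.1.1)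
    filter_upwards [this] with q hq
    simp only [H]
    rw [norm_mul, norm_mul, Complex.norm_of_nonneg hq.le]
    have e1 : ‖Complex.exp (-c * q.1.1^2)‖ = exp (-c*q.1.1^2) := by
      rw [Complex.norm_exp]; norm_cast
    rw [e1]
    gcongr
    refine (Complex.norm_exp_le_exp_norm _).trans ?_
    rw [norm_mul, norm_mul, Complex.norm_of_nonneg hq.le]
    have : ‖(a * cos q.1.2 + b * cos (q.1.2 + q.2) : ℂ)‖ ≤ |a| + |b| := by
      refine (norm_add_le _ _).trans ?_
      rw [norm_mul, norm_mul, Complex.norm_real, Complex.norm_real, Complex.norm_real, Complex.norm_real]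
      simp only [Real.norm_eq_abs]
      exact add_le_add (mul_le_of_le_one_right (abs_nonneg _) (Real.abs_cos_le_one _)) (mul_le_of_le_one_right (abs_nonneg _) (Real.abs_cos_le_one _))
    refine Real.exp_le_exp.mpr ?_
    calc ‖z‖ * q.1.1 * _ ≤ ‖z‖ * q.1.1 * (|a|+|b|) := by gcongr
      _ = _ := by ring
  have s1 : ∫ q, H q ∂(((volume.restrict (Ioi (0:ℝ))).prod (volume.restrict (Ioo (-π) π))).prod (volume.restrict (Ioo (-π) π)))
      = ∫ t in Ioi (0:ℝ), (t:ℂ) * Complex.exp (-c * t^2) * (Bc (z*a*t) * Bc (z*b*t)) := by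
    rw [integral_prod _ hH, integral_prod _ hH.integral_prod_left]
    congr 1; ext t
    conv_rhs => rw [Bc, ← integral_mul_const, ← integral_const_mul]
    congr 1; ext θ
    rw [Bc_shift (z*b*t) θ, ← integral_const_mul, ← integral_const_mul]
    congr 1; ext δ
    simp only [H]
    rw [← Complex.exp_add]; congr 2; ring
  rw [← s1, integral_prod_symm _ hH, ← integral_const_mul]
  congr 1; ext δ
  rw [Measure.prod_restrict, ← Measure.volume_eq_prod]
  have := gauss2 c (a + b * cos δ) (-b * sin δ) hc z
  have hcs := Real.sin_sq_add_cos_sq δ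
  have hcs : ((sin δ : ℂ))^2 + (cos δ : ℂ)^2 = 1 := by exact_mod_cast hcs
  have e : (((a + b * cos δ : ℝ) : ℂ)^2 + ((-b * sin δ : ℝ) : ℂ)^2) = a^2+b^2+2*a*b*cos δ := by
    push_cast at hcs ⊢
    linear_combination (b^2:ℂ) * hcs
  rw [e] at this
  rw [← this]
  congr 1; ext p
  simp only [H]
  congr 3
  rw [Real.cos_add]; push_cast; ring

noncomputable def Jb (x : ℝ) : ℝ := 1/(2*π) * ∫ θ in Ioo (-π) π, cos (x * cos θ)

lemma Bc_neg (z : ℂ) : Bc (-z) = Bc z := by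
  rw [Bc_shift z π]; unfold Bc
  congr 1; ext δ
  rw [add_comm, Real.cos_add_pi]; push_cast; congr 1; ring

lemma cont_Ioo {E : Type*} [NormedAddCommGroup E] (f : ℝ → E) (hf : Continuous f) : Integrable f (volume.restrict (Ioo (-π) π)) :=
  (hf.integrableOn_Icc (a := -π) (b := π)).mono_set Ioo_subset_Icc_self

lemma Bc_I (x : ℝ) : Bc (Complex.I * x) = 2*π * Jb x := by
  have h : 2 * Bc (Complex.I * x) = 2 * ((∫ θ in Ioo (-π) π, cos (x * cos θ) : ℝ) : ℂ) := by
    conv_lhs => rw [two_mul]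
    conv_lhs => enter [1]; rw [← Bc_neg]
    unfold Bc
    rw [← integral_add (cont_Ioo _ (by fun_prop)) (cont_Ioo _ (by fun_prop)), ← integral_complex_ofReal, ← integral_const_mul]
    congr 1; ext θ
    rw [Complex.ofReal_cos (x * cos θ), Complex.cos, mul_div_cancel₀ _ two_ne_zero, add_comm]
    congr 2 <;> push_cast <;> ring
  have h := mul_left_cancel₀ two_ne_zero h
  rw [h]; unfold Jb
  have := Real.pi_ne_zero
  have : (π:ℂ) ≠ 0 := by exact_mod_cast this
  push_cast; field_simp

lemma Bc_r (t : ℝ) : Bc t = 2*π * I0 t := by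
  have hpi := pi_pos
  have e : ∫ θ in Ioo (-π) π, exp (t * cos θ) = 2 * ∫ θ in (0:ℝ)..π, exp (t * cos θ) := by
    rw [← integral_Ioc_eq_integral_Ioo, ← intervalIntegral.integral_of_le (by linarith)]
    have hc : ∀ a b, IntervalIntegrable (fun θ => exp (t * cos θ)) volume a b := fun a b => (by fun_prop : Continuous (fun θ => exp (t * cos θ))).intervalIntegrable a b
    rw [← intervalIntegral.integral_add_adjacent_intervals (hc (-π) 0) (hc 0 π)]
    have := intervalIntegral.integral_comp_neg (fun θ => exp (t * cos θ)) (a := 0) (b := π)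
    simp only [Real.cos_neg, neg_zero] at this
    rw [← this]; ring
  have h : Bc t = ((∫ θ in Ioo (-π) π, exp (t * cos θ) : ℝ) : ℂ) := by
    unfold Bc
    rw [← integral_complex_ofReal]; congr 1; ext θ
    push_cast; rfl
  rw [h, e]; unfold I0
  have : (π:ℂ) ≠ 0 := by exact_mod_cast hpi.ne'
  push_cast; field_simp

lemma gauss_B2 (c a b : ℝ) (hc : 0 < c) (z : ℂ) :
    ∫ t in Ioi (0:ℝ), (t:ℂ) * Complex.exp (-c * t^2) * (Bc (z*a*t) * Bc (z*b*t))
      = π/c * (Complex.exp (z^2*(a^2+b^2)/(4*c)) * Bc (z^2*a*b/(2*c))) := by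
  rw [gauss_B c a b hc z]; unfold Bc
  congr 1
  rw [← integral_const_mul]
  congr 1; ext δ
  rw [← Complex.exp_add]; congr 1
  have : (c:ℂ) ≠ 0 := by exact_mod_cast hc.ne'
  field_simp; ring

lemma gauss_eq (α β : ℝ) (hα : 0 < α) (hβ : 0 < β) :
    ∫ t in Ioi (0:ℝ), t * I0 t^2 * exp (-(t^2/(4*α)+t^2/(4*β)))
     = 4*α*β*exp (α+β) * ∫ k in Ioi (0:ℝ), k * exp (-(α+β)*k^2) * (Jb (2*α*k) * Jb (2*β*k)) := by
  have hpi := pi_pos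
  have p0 : (π:ℂ) ≠ 0 := by exact_mod_cast hpi.ne'
  have a0 : (α:ℂ) ≠ 0 := by exact_mod_cast hα.ne'
  have b0 : (β:ℂ) ≠ 0 := by exact_mod_cast hβ.ne'
  have ab0 : (α:ℂ) + β ≠ 0 := by exact_mod_cast (by positivity : α + β ≠ 0)
  have h1 := gauss_B2 ((α+β)/(4*α*β)) 1 1 (by positivity) 1
  have h2 := gauss_B2 (α+β) (2*α) (2*β) (by positivity) Complex.I
  have e1 : ∫ t in Ioi (0:ℝ), (t:ℂ) * Complex.exp (-((α+β)/(4*α*β) : ℝ) * t^2) * (Bc (1*(1:ℝ)*t) * Bc (1*(1:ℝ)*t)) =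
     (2*π)^2 * ((∫ t in Ioi (0:ℝ), t * I0 t^2 * exp (-(t^2/(4*α)+t^2/(4*β))) : ℝ) : ℂ) := by
    rw [← integral_complex_ofReal, ← integral_const_mul]
    congr 1; ext t
    rw [Complex.ofReal_one, one_mul, one_mul, Bc_r]; push_cast
    have : (-((α+β)/(4*α*β)) * t^2 : ℂ) = -(t^2/(4*α)+t^2/(4*β)) := by field_simp; ring
    rw [this]; ring
  have e2 : ∫ t in Ioi (0:ℝ), (t:ℂ) * Complex.exp (-((α+β) : ℝ) * t^2) * (Bc (Complex.I*(2*α:ℝ)*t) * Bc (Complex.I*(2*β:ℝ)*t)) =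
     (2*π)^2 * ((∫ k in Ioi (0:ℝ), k * exp (-(α+β)*k^2) * (Jb (2*α*k) * Jb (2*β*k)) : ℝ) : ℂ) := by
    rw [← integral_complex_ofReal, ← integral_const_mul]
    congr 1; ext t
    rw [mul_assoc Complex.I, mul_assoc Complex.I, ← Complex.ofReal_mul, ← Complex.ofReal_mul, Bc_I, Bc_I]; push_cast
    ring
  rw [e1] at h1
  rw [e2, ← Bc_neg] at h2
  have q1 : (1^2*((1:ℝ):ℂ)*((1:ℝ):ℂ)/(2*(((α+β)/(4*α*β):ℝ):ℂ))) = 2*α*β/(α+β) := by push_cast; field_simp; norm_num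
  have q2 : -(Complex.I^2*((2*α:ℝ):ℂ)*((2*β:ℝ):ℂ)/(2*((α+β:ℝ):ℂ))) = 2*α*β/(α+β) := by rw [Complex.I_sq]; push_cast; field_simp
  have q3 : (1^2*(((1:ℝ):ℂ)^2+((1:ℝ):ℂ)^2)/(4*(((α+β)/(4*α*β):ℝ):ℂ))) = (α+β) + Complex.I^2*(((2*α:ℝ):ℂ)^2+((2*β:ℝ):ℂ)^2)/(4*((α+β:ℝ):ℂ)) := by
    rw [Complex.I_sq]; push_cast; field_simp; ring
  rw [q1, q3, Complex.exp_add] at h1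
  rw [q2] at h2
  have h3 : (2*π:ℂ)^2 ≠ 0 := pow_ne_zero _ (mul_ne_zero two_ne_zero p0)
  have h4 : (π / (((α+β)/(4*α*β):ℝ):ℂ) : ℂ) = 4*α*β*(π / ((α+β:ℝ):ℂ)) := by push_cast; field_simp
  rw [h4] at h1
  have : (2*π:ℂ)^2 * ((∫ t in Ioi (0:ℝ), t * I0 t^2 * exp (-(t^2/(4*α)+t^2/(4*β))) : ℝ) : ℂ) = (2*π:ℂ)^2 * ((4*α*β*exp (α+β) * ∫ k in Ioi (0:ℝ), k * exp (-(α+β)*k^2) * (Jb (2*α*k) * Jb (2*β*k)) : ℝ) : ℂ) := by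
    rw [h1, Complex.ofReal_mul (4*α*β*exp (α+β)), mul_left_comm ((2*π:ℂ)^2), h2]
    push_cast; ring
  exact_mod_cast mul_left_cancel₀ h3 this

lemma Jb_cont : Continuous Jb := by
  unfold Jb
  refine Continuous.mul continuous_const ?_
  refine continuous_of_dominated (bound := fun _ => 1) (fun x => by fun_prop) (fun x => ae_of_all _ fun θ => ?_) (cont_Ioo _ continuous_const) (ae_of_all _ fun θ => by fun_prop)
  exact Real.abs_cos_le_one _

lemma Jb_le (x : ℝ) : |Jb x| ≤ 1 := by
  have hpi := pi_pos
  unfold Jb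
  rw [abs_mul, abs_of_pos (by positivity)]
  have := norm_integral_le_of_norm_le (μ := volume.restrict (Ioo (-π) π)) (f := fun θ => cos (x * cos θ)) (g := fun _ => 1) (cont_Ioo _ continuous_const) (ae_of_all _ fun θ => Real.abs_cos_le_one _)
  simp only [integral_const, MeasurableSet.univ, measureReal_restrict_apply, univ_inter, Real.volume_real_Ioo_of_le (by linarith : -π ≤ π), smul_eq_mul, mul_one, Real.norm_eq_abs] at this
  rw [one_div, inv_mul_le_iff₀ (by positivity)]; linarith

lemma I0_bd (t : ℝ) (ht : 0 ≤ t) : 0 ≤ I0 t ∧ I0 t ≤ exp t := by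
  have hpi := pi_pos
  unfold I0
  constructor
  · have := intervalIntegral.integral_nonneg (μ := volume) hpi.le (fun θ _ => (exp_pos (t * cos θ)).le)
    positivity
  · have := intervalIntegral.integral_mono_on (μ := volume) hpi.le ((by fun_prop : Continuous (fun θ => exp (t * cos θ))).intervalIntegrable 0 π) (intervalIntegrable_const (c := exp t))
      (fun θ _ => Real.exp_le_exp.mpr (mul_le_of_le_one_right ht (Real.cos_le_one θ)))
    rw [intervalIntegral.integral_const, smul_eq_mul, sub_zero] at this
    rw [one_div, inv_mul_le_iff₀ hpi]; exact this

lemma I0_cont : Continuous I0 := by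
  unfold I0
  refine Continuous.mul continuous_const (intervalIntegral.continuous_parametric_intervalIntegral_of_continuous' (by fun_prop) 0 π)

lemma I0_int (c : ℝ) (hc : 0 < c) : IntegrableOn (fun t => t * I0 t^2 * exp (-c*t^2)) (Ioi 0) := by
  have := I0_cont
  refine Integrable.mono' (gauss_dom c 2 hc) (Continuous.aestronglyMeasurable (by fun_prop)) ?_
  refine (ae_restrict_iff' measurableSet_Ioi).mpr (ae_of_all _ fun t ht => ?_)
  have ht : 0 < t := ht
  obtain ⟨h1, h2⟩ := I0_bd t ht.le
  rw [norm_of_nonneg (by positivity), mul_right_comm]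
  gcongr
  rw [two_mul, Real.exp_add, ← sq]
  gcongr

lemma ec_int (c : ℝ) (hc : 0 < c) : IntegrableOn (fun u => exp (-(c * cosh u))) (Ioi 0) := by
  refine Integrable.mono' (exp_neg_integrableOn_Ioi 0 (by positivity : 0 < c/2)) (Continuous.aestronglyMeasurable (by fun_prop)) ?_
  refine (ae_restrict_iff' measurableSet_Ioi).mpr (ae_of_all _ fun u hu => ?_)
  rw [norm_of_nonneg (by positivity)]
  refine Real.exp_le_exp.mpr ?_
  have h : u + 1 ≤ exp u := Real.add_one_le_exp u
  have h2 : exp u ≤ 2 * cosh u := by rw [Real.cosh_eq]; linarith [exp_pos (-u)]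
  nlinarith

lemma ec_R (c : ℝ) (hc : 0 < c) : Integrable (fun u => exp (-(c * cosh u))) ∧ ∫ u, exp (-(c * cosh u)) = 2 * K0 c :=
  even_int _ (fun x => by rw [Real.cosh_neg]) (ec_int c hc)

lemma K0_meas : Measurable K0 := by
  unfold K0
  have : StronglyMeasurable (fun p : ℝ × ℝ => exp (-(p.1 * cosh p.2))) := Continuous.stronglyMeasurable (by fun_prop)
  exact (this.integral_prod_right (ν := volume.restrict (Ioi (0:ℝ)))).measurable

lemma K0_nonneg (t : ℝ) : 0 ≤ K0 t := integral_nonneg fun _ => (exp_pos _).le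

lemma pos_ae : ∀ᵐ x ∂(volume.restrict (Ioi (0:ℝ))), 0 < x :=
  (ae_restrict_iff' measurableSet_Ioi).mpr (ae_of_all _ fun _ hx => hx)

lemma m_int : IntegrableOn (fun α : ℝ => α^(-(1/2):ℝ) * (exp (-α) * K0 (2*α))) (Ioi 0) := by
  have hN : Integrable (fun p : ℝ × ℝ => p.1^(-(1/2):ℝ) * exp (-((1 + 2 * cosh p.2) * p.1)))
      ((volume.restrict (Ioi (0:ℝ))).prod (volume.restrict (Ioi (0:ℝ)))) := by
    rw [integrable_prod_iff' (by
      refine Measurable.aestronglyMeasurable (Measurable.mul (by fun_prop) (Continuous.measurable (by fun_prop))))]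
    have hA : ∀ w : ℝ, 0 < 1 + 2 * cosh w := fun w => by linarith [Real.one_le_cosh w]
    constructor
    · refine ae_of_all _ fun w => ?_
      have := integrableOn_rpow_mul_exp_neg_mul_rpow (s := -(1/2)) (p := 1) (b := 1 + 2 * cosh w) (by norm_num) one_pos (hA w)
      simp only [Real.rpow_one, neg_mul] at this
      exact this
    · have e : ∀ w : ℝ, ∫ x in Ioi (0:ℝ), ‖x^(-(1/2):ℝ) * exp (-((1 + 2 * cosh w) * x))‖ = (1/(1 + 2 * cosh w))^(1/2:ℝ) * Real.Gamma (1/2) := by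
        intro w
        rw [← Real.integral_rpow_mul_exp_neg_mul_Ioi (by norm_num) (hA w)]
        refine setIntegral_congr_fun measurableSet_Ioi fun x hx => ?_
        have hx : 0 < x := hx
        rw [norm_of_nonneg (by positivity)]; norm_num
      simp only [e]
      refine Integrable.mul_const ?_ _
      refine Integrable.mono' (exp_neg_integrableOn_Ioi 0 (by norm_num : (0:ℝ) < 1/2)) (Measurable.aestronglyMeasurable ?_) (ae_of_all _ fun w => ?_)
      · have : Measurable cosh := Real.continuous_cosh.measurable
        fun_prop
      have := hA w
      rw [norm_of_nonneg (by positivity)]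
      have e2 : exp (-(1/2)*w) = (exp (-w))^(1/2:ℝ) := by rw [← Real.exp_mul]; congr 1; ring
      rw [e2, Real.exp_neg, ← one_div]
      gcongr
      rw [Real.cosh_eq]; linarith [exp_pos (-w)]
  refine hN.integral_prod_left.congr ?_
  refine ae_of_all _ fun α => ?_
  simp only
  rw [integral_const_mul]
  congr 1
  rw [K0, ← integral_const_mul]
  congr 1; ext w
  rw [← Real.exp_add]; congr 1; ring

lemma w_ge (α : ℝ) (h : 0 < α) : exp (-α) ≤ α^(-(1/2):ℝ) := by
  rw [Real.rpow_neg h.le, Real.exp_neg, ← sqrt_eq_rpow]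
  refine inv_anti₀ (Real.sqrt_pos.mpr h) ?_
  rw [Real.sqrt_le_iff]
  have := Real.add_one_le_exp α
  exact ⟨by positivity, by nlinarith⟩

lemma cosh2_int (α : ℝ) (h : 0 < α) : Integrable (fun b => exp (-(2*α*cosh (2*b)))) ∧ ∫ b, exp (-(2*α*cosh (2*b))) = K0 (2*α) := by
  obtain ⟨h1, h2⟩ := ec_R (2*α) (by positivity)
  refine ⟨h1.comp_mul_left' two_ne_zero, ?_⟩
  rw [Measure.integral_comp_mul_left (fun u => exp (-(2*α*cosh u))), h2]
  simp [abs_of_pos]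

lemma cc_id (u b : ℝ) : 2 * (cosh (u-b) * cosh b) = cosh u + cosh (u-2*b) := by
  have h1 := Real.cosh_add (u-b) b
  have h2 := Real.cosh_sub (u-b) b
  rw [show u-b+b = u by ring] at h1
  rw [show u-b-b = u-2*b by ring] at h2
  linarith

lemma K0sq1 (t : ℝ) (ht : 0 < t) : K0 t^2 = 1/2 * ∫ b, ∫ a, exp (-(2*t*(cosh a * cosh b))) := by
  obtain ⟨h1, h2⟩ := ec_R t ht
  have hin : ∀ u : ℝ, Integrable (fun b => exp (-(t*cosh (u-2*b)))) ∧ ∫ b, exp (-(t*cosh (u-2*b))) = K0 t := by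
    intro u
    refine ⟨(h1.comp_sub_left u).comp_mul_left' two_ne_zero, ?_⟩
    rw [Measure.integral_comp_mul_left (fun b => exp (-(t*cosh (u-b)))), integral_sub_left_eq_self (fun b => exp (-(t*cosh b))), h2]
    simp [abs_of_pos]
  have e : ∀ u b : ℝ, exp (-(2*t*(cosh (u-b) * cosh b))) = exp (-(t*cosh u)) * exp (-(t*cosh (u-2*b))) := by
    intro u b
    rw [← Real.exp_add]; congr 1; linear_combination (-t) * cc_id u b
  have hI : Integrable (Function.uncurry fun u b : ℝ => exp (-(2*t*(cosh (u-b) * cosh b)))) (volume.prod volume) := by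
    rw [integrable_prod_iff (Continuous.aestronglyMeasurable (by unfold Function.uncurry; fun_prop))]
    simp only [Function.uncurry, e]
    refine ⟨ae_of_all _ fun u => (hin u).1.const_mul _, ?_⟩
    simp only [norm_mul, norm_of_nonneg (exp_pos _).le, integral_const_mul, (hin _).2]
    exact h1.mul_const _
  have s := integral_integral_swap hI
  simp only [e, integral_const_mul, (hin _).2, integral_mul_const, h2] at s
  simp only [← e] at s
  have s2 : ∀ b : ℝ, ∫ u, exp (-(2*t*(cosh (u-b) * cosh b))) = ∫ a, exp (-(2*t*(cosh a * cosh b))) :=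
    fun b => integral_sub_right_eq_self (fun a => exp (-(2*t*(cosh a * cosh b)))) b
  simp only [s2] at s
  rw [← s]; ring

noncomputable def qK (t α : ℝ) : ℝ := 1/(2*α) * exp (-(t^2/(4*α)) - 2*α) * K0 (2*α)

lemma qK_int (t : ℝ) (ht : 0 < t) : IntegrableOn (qK t) (Ioi 0) := by
  refine Integrable.mono' (m_int.const_mul (2/t^2)) (Measurable.aestronglyMeasurable ?_) ?_
  · have := K0_meas
    unfold qK; fun_prop
  filter_upwards [pos_ae] with α hα
  have hK := K0_nonneg (2*α)
  unfold qK
  rw [norm_of_nonneg (by positivity), ← mul_assoc, ← mul_assoc]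
  refine mul_le_mul_of_nonneg_right ?_ hK
  have h1 : exp (-(t^2/(4*α))) ≤ 4*α/t^2 := by
    rw [Real.exp_neg, ← inv_div (t^2)]
    refine inv_anti₀ (by positivity) ?_
    linarith [Real.add_one_le_exp (t^2/(4*α))]
  have h2 := w_ge α hα
  have h3 : 0 ≤ α^(-(1/2):ℝ) := by positivity
  calc 1/(2*α) * exp (-(t^2/(4*α)) - 2*α) = 1/(2*α) * (exp (-(t^2/(4*α))) * (exp (-α) * exp (-α))) := by
        rw [← Real.exp_add, ← Real.exp_add]; congr 2; ring
    _ ≤ 1/(2*α) * (4*α/t^2 * (α^(-(1/2):ℝ) * exp (-α))) := by gcongr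
    _ = _ := by field_simp; ring

lemma K0sq (t : ℝ) (ht : 0 < t) : K0 t^2 = ∫ α in Ioi (0:ℝ), qK t α := by
  let g : ℝ → ℝ → ℝ := fun b α => 1/α * exp (-(t^2/(4*α)) - 2*α) * exp (-(2*α*cosh (2*b)))
  have hg : ∀ b : ℝ, ∫ α in Ioi (0:ℝ), g b α = ∫ a, exp (-(2*t*(cosh a * cosh b))) := by
    intro b
    have hb := cosh_pos b
    have hs : 0 < t/(4*cosh b) := by positivity
    rw [cov univ (Ioi 0) MeasurableSet.univ (fun a => t/(4*cosh b) * exp a) (fun a => t/(4*cosh b) * exp a) (fun α => Real.log (α / (t/(4*cosh b))))]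
    · rw [setIntegral_univ]
      congr 1; ext a
      have ha := exp_pos a
      rw [abs_of_pos (by positivity)]
      simp only [g]
      have hx : ∀ x p q : ℝ, x ≠ 0 → x*(1/x*p*q) = p*q := by intros; field_simp
      rw [hx _ _ _ (by positivity), ← Real.exp_add]
      congr 1
      rw [Real.cosh_two_mul, Real.sinh_sq, Real.cosh_eq a, Real.exp_neg]
      field_simp; ring
    · exact fun a _ => (Real.hasDerivAt_exp a).const_mul _
    · exact fun a _ => mem_Ioi.mpr (by positivity)
    · exact fun _ _ => mem_univ _
    · intro a _
      rw [mul_div_cancel_left₀ _ hs.ne', Real.log_exp]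
    · intro α hα
      have hα : 0 < α := hα
      rw [Real.exp_log (by positivity), mul_div_cancel₀ _ hs.ne']
  have hI : Integrable (Function.uncurry g) (volume.prod (volume.restrict (Ioi (0:ℝ)))) := by
    rw [integrable_prod_iff' (by
      refine Measurable.aestronglyMeasurable ?_
      have : Measurable cosh := Real.continuous_cosh.measurable
      unfold Function.uncurry; simp only [g]; fun_prop)]
    simp only [Function.uncurry, g]
    constructor
    · filter_upwards [pos_ae] with α hα
      exact (cosh2_int α hα).1.const_mul _
    · refine ((qK_int t ht).const_mul 2).congr ?_
      filter_upwards [pos_ae] with α hα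
      simp only [norm_mul, norm_of_nonneg (exp_pos _).le, integral_const_mul, (cosh2_int α hα).2]
      rw [norm_of_nonneg (by positivity), qK]
      ring
  rw [K0sq1 t ht]
  simp only [← hg]
  rw [integral_integral_swap hI, ← integral_const_mul]
  refine setIntegral_congr_fun measurableSet_Ioi fun α hα => ?_
  simp only [g]
  rw [integral_const_mul, (cosh2_int α hα).2, qK]; ring

lemma exp_cos (A c : ℝ) (hA : 0 < A) : ∫ x in Ioi (0:ℝ), exp (-(A*x)) * cos (c*x) = A/(A^2+c^2) := by
  have ha : (-A + c * Complex.I : ℂ).re < 0 := by simpa using hA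
  have h := integral_exp_mul_complex_Ioi ha 0
  have hi := integrableOn_exp_mul_complex_Ioi ha 0
  have h2 := integral_re hi
  rw [h] at h2
  have e : ∀ x : ℝ, RCLike.re (Complex.exp ((-A + c * Complex.I) * x)) = exp (-(A*x)) * cos (c*x) := by
    intro x
    rw [show ((-A + c * Complex.I) * x : ℂ) = ((-(A*x) : ℝ):ℂ) + ((c*x:ℝ):ℂ) * Complex.I by push_cast; ring]
    simp [Complex.exp_re]
  simp only [e] at h2
  rw [h2]
  simp [Complex.div_re, Complex.normSq_apply]
  field_simp

lemma theta4 (A b : ℝ) (hA : 0 < A) : ∫ θ in Ioo (-π) π, A/(A^2+(b*cos θ)^2) = 2*π*(A^2+b^2)^(-(1/2):ℝ) := by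
  have hpi := pi_pos
  have hpos : ∀ θ, A^2+(b*cos θ)^2 ≠ 0 := fun θ => by positivity
  let g : ℝ → ℝ := fun θ => A/(A^2+(b*cos θ)^2)
  have hc : Continuous g := by
    refine Continuous.div continuous_const (by fun_prop) hpos
  have hii : ∀ a b, IntervalIntegrable g volume a b := fun a b => hc.intervalIntegrable a b
  have hp : Function.Periodic g π := fun x => by simp only [g, Real.cos_add_pi]; ring_nf
  have hn : ∀ x, g (-x) = g x := fun x => by simp only [g, Real.cos_neg]
  have h0 : ∫ θ in (0:ℝ)..(π/2), g θ = A * (π/(2*√(A^2+b^2)*A)) := by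
    rw [← theta_int (√(A^2+b^2)) A (by positivity) hA, ← intervalIntegral.integral_const_mul]
    congr 1; ext θ
    simp only [g]
    rw [Real.sq_sqrt (by positivity), mul_one_div]; congr 1
    rw [Real.sin_sq]; ring
  have h1 : ∫ θ in (-(π/2))..0, g θ = ∫ θ in (0:ℝ)..(π/2), g θ := by
    have := intervalIntegral.integral_comp_neg g (a := 0) (b := π/2)
    simp only [hn, neg_zero] at this
    exact this.symm
  have h2 : ∫ θ in (0:ℝ)..π, g θ = ∫ θ in (-(π/2))..(π/2), g θ := by
    have := hp.intervalIntegral_add_eq 0 (-(π/2))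
    rwa [zero_add, show -(π/2) + π = π/2 by ring] at this
  have h3 : ∫ θ in (-π)..0, g θ = ∫ θ in (0:ℝ)..π, g θ := by
    have := hp.intervalIntegral_add_eq (-π) 0
    rwa [zero_add, neg_add_cancel] at this
  rw [← integral_Ioc_eq_integral_Ioo, ← intervalIntegral.integral_of_le (by linarith)]
  change ∫ θ in (-π)..π, g θ = _
  rw [← intervalIntegral.integral_add_adjacent_intervals (hii (-π) 0) (hii 0 π), h3, h2,
    ← intervalIntegral.integral_add_adjacent_intervals (hii (-(π/2)) 0) (hii 0 (π/2)), h1, h0, Real.rpow_neg (by positivity), ← sqrt_eq_rpow]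
  have : 0 < √(A^2+b^2) := by positivity
  field_simp; ring

lemma lapJ (A b : ℝ) (hA : 0 < A) : ∫ x in Ioi (0:ℝ), exp (-(A*x)) * Jb (b*x) = (A^2+b^2)^(-(1/2):ℝ) := by
  have hpi := pi_pos
  have hI : Integrable (Function.uncurry fun x θ : ℝ => exp (-(A*x)) * cos (b*cos θ*x)) ((volume.restrict (Ioi (0:ℝ))).prod (volume.restrict (Ioo (-π) π))) := by
    refine Integrable.mono' ((exp_neg_integrableOn_Ioi 0 hA).comp_fst (volume.restrict (Ioo (-π) π))) (Continuous.aestronglyMeasurable (by unfold Function.uncurry; fun_prop)) (ae_of_all _ fun p => ?_)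
    simp only [Function.uncurry, norm_mul, Real.norm_eq_abs, Real.abs_exp, neg_mul]
    exact mul_le_of_le_one_right (exp_pos _).le (Real.abs_cos_le_one _)
  have s := integral_integral_swap hI
  simp only [exp_cos _ _ hA, theta4 A b hA] at s
  calc _ = 1/(2*π) * ∫ x in Ioi (0:ℝ), ∫ θ in Ioo (-π) π, exp (-(A*x)) * cos (b*cos θ*x) := by
        rw [← integral_const_mul]; congr 1; ext x
        rw [integral_const_mul, Jb, mul_left_comm]; congr 3; ext θ
        congr 1; ring
    _ = _ := by rw [s]; field_simp

noncomputable def mK (α : ℝ) : ℝ := exp (-α) * K0 (2*α)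
noncomputable def XK (k α : ℝ) : ℝ := exp (-(α*k^2)) * mK α * Jb (2*k*α)

lemma XK_int (k : ℝ) : ∫ α in Ioi (0:ℝ), XK k α = F3 (k^2) := by
  have hA : ∀ w : ℝ, 0 < 1 + k^2 + 2 * cosh w := fun w => by nlinarith [Real.one_le_cosh w]
  have hJ := Jb_cont
  have hI : Integrable (Function.uncurry fun α w : ℝ => exp (-((1+k^2+2*cosh w)*α)) * Jb (2*k*α)) ((volume.restrict (Ioi (0:ℝ))).prod (volume.restrict (Ioi (0:ℝ)))) := by
    rw [integrable_prod_iff' (Continuous.aestronglyMeasurable (by unfold Function.uncurry; fun_prop))]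
    have hb : ∀ w α : ℝ, ‖exp (-((1+k^2+2*cosh w)*α)) * Jb (2*k*α)‖ ≤ exp (-(1+k^2+2*cosh w)*α) := fun w α => by
      rw [norm_mul, Real.norm_eq_abs, Real.norm_eq_abs, Real.abs_exp, neg_mul]
      exact mul_le_of_le_one_right (exp_pos _).le (Jb_le _)
    have h1 : ∀ w : ℝ, IntegrableOn (fun α => exp (-((1+k^2+2*cosh w)*α)) * Jb (2*k*α)) (Ioi 0) := fun w =>
      Integrable.mono' (exp_neg_integrableOn_Ioi 0 (hA w)) (Continuous.aestronglyMeasurable (by fun_prop)) (ae_of_all _ (hb w))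
    refine ⟨ae_of_all _ h1, ?_⟩
    refine Integrable.mono' (exp_neg_integrableOn_Ioi 0 one_pos) (StronglyMeasurable.aestronglyMeasurable ?_) (ae_of_all _ fun w => ?_)
    · exact StronglyMeasurable.integral_prod_left' (μ := volume.restrict (Ioi (0:ℝ))) (f := fun p : ℝ × ℝ => ‖exp (-((1+k^2+2*cosh p.2)*p.1)) * Jb (2*k*p.1)‖) (Continuous.stronglyMeasurable (by fun_prop))
    · rw [norm_of_nonneg (integral_nonneg fun _ => norm_nonneg _)]
      refine (integral_mono (h1 w).norm (exp_neg_integrableOn_Ioi 0 (hA w)) (hb w)).trans ?_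
      have := integral_exp_mul_Ioi (neg_lt_zero.mpr (hA w)) 0
      rw [this, mul_zero, Real.exp_zero, neg_div_neg_eq, neg_one_mul, Real.exp_neg, one_div]
      refine inv_anti₀ (exp_pos w) ?_
      rw [Real.cosh_eq]; nlinarith [exp_pos (-w)]
  have s := integral_integral_swap hI
  simp only [lapJ _ _ (hA _)] at s
  have e : F3 (k^2) = ∫ w in Ioi (0:ℝ), ((1+k^2+2*cosh w)^2+(2*k)^2)^(-(1/2):ℝ) := by
    unfold F3 fe0 QE; congr 1; ext w; congr 2; ring
  rw [e, ← s]
  congr 1; ext α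
  rw [integral_mul_const]; unfold XK mK K0; congr 1
  rw [← integral_const_mul, ← integral_const_mul]; congr 1; ext w
  rw [← Real.exp_add, ← Real.exp_add]; congr 1; ring

lemma gint (c : ℝ) (hc : 0 < c) : ∫ k in Ioi (0:ℝ), k * exp (-c*k^2) = (2*c)⁻¹ := by
  have h := integral_mul_cexp_neg_mul_sq (b := (c:ℂ)) (by simpa using hc)
  have : ((∫ k in Ioi (0:ℝ), k * exp (-c*k^2) : ℝ) : ℂ) = ((2*c)⁻¹ : ℝ) := by
    rw [← integral_complex_ofReal]; push_cast; exact h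
  exact_mod_cast this

lemma pos_ae2 : ∀ᵐ p ∂((volume.restrict (Ioi (0:ℝ))).prod (volume.restrict (Ioi (0:ℝ)))), 0 < p.1 ∧ 0 < p.2 := by
  rw [Measure.prod_restrict]
  exact (ae_restrict_iff' (measurableSet_Ioi.prod measurableSet_Ioi)).mpr (ae_of_all _ fun q hq => ⟨hq.1, hq.2⟩)

lemma mK_meas : Measurable mK := by
  have := K0_meas
  unfold mK; fun_prop

lemma mK_nonneg (α : ℝ) : 0 ≤ mK α := mul_nonneg (exp_pos _).le (K0_nonneg _)

lemma amgm (α β : ℝ) (ha : 0 < α) (hb : 0 < β) : (2*(α+β))⁻¹ ≤ α^(-(1/2):ℝ) * β^(-(1/2):ℝ) := by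
  rw [Real.rpow_neg ha.le, Real.rpow_neg hb.le, ← mul_inv, ← sqrt_eq_rpow, ← sqrt_eq_rpow]
  have h1 := Real.sqrt_pos.mpr ha
  have h2 := Real.sqrt_pos.mpr hb
  refine inv_anti₀ (by positivity) ?_
  nlinarith [Real.mul_self_sqrt ha.le, Real.mul_self_sqrt hb.le, sq_nonneg (√α - √β), mul_pos h1 h2]

lemma bd_int : Integrable (fun p : ℝ × ℝ => (p.1^(-(1/2):ℝ) * mK p.1) * (p.2^(-(1/2):ℝ) * mK p.2)) ((volume.restrict (Ioi (0:ℝ))).prod (volume.restrict (Ioi (0:ℝ)))) :=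
  m_int.mul_prod m_int

noncomputable def SK (q : ℝ × (ℝ × ℝ)) : ℝ := q.1 * (XK q.1 q.2.1 * XK q.1 q.2.2)

lemma SK_meas : Measurable SK := by
  have h1 := mK_meas
  have h2 := Jb_cont.measurable
  unfold SK XK; fun_prop

lemma SK_bd (k α β : ℝ) (hk : 0 < k) : ‖SK (k, (α, β))‖ ≤ mK α * mK β * (k * exp (-(α+β)*k^2)) := by
  have h1 := mK_nonneg α
  have h2 := mK_nonneg β
  have e : exp (-(α+β)*k^2) = exp (-(α*k^2)) * exp (-(β*k^2)) := by rw [← Real.exp_add]; congr 1; ring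
  unfold SK XK
  simp only [norm_mul, norm_of_nonneg hk.le, norm_of_nonneg (exp_pos _).le, norm_of_nonneg h1, norm_of_nonneg h2, Real.norm_eq_abs]
  rw [e]
  calc k * (exp (-(α*k^2)) * mK α * |Jb (2*k*α)| * (exp (-(β*k^2)) * mK β * |Jb (2*k*β)|))
      ≤ k * (exp (-(α*k^2)) * mK α * 1 * (exp (-(β*k^2)) * mK β * 1)) := by
        gcongr <;> exact Jb_le _
    _ = _ := by ring

lemma SK_k (α β : ℝ) (ha : 0 < α) (hb : 0 < β) : IntegrableOn (fun k => SK (k, (α, β))) (Ioi 0) ∧ ∫ k in Ioi (0:ℝ), ‖SK (k, (α, β))‖ ≤ (α^(-(1/2):ℝ) * mK α) * (β^(-(1/2):ℝ) * mK β) := by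
  have hc : 0 < α + β := by positivity
  have hg := ((integrable_mul_exp_neg_mul_sq hc).integrableOn (s := Ioi 0)).const_mul (mK α * mK β)
  have hm : Measurable (fun k => SK (k, (α, β))) := SK_meas.comp (by fun_prop)
  have hb' : ∀ᵐ k ∂(volume.restrict (Ioi (0:ℝ))), ‖SK (k, (α, β))‖ ≤ mK α * mK β * (k * exp (-(α+β)*k^2)) := by
    filter_upwards [pos_ae] with k hk using SK_bd k α β hk
  have hi := Integrable.mono' hg hm.aestronglyMeasurable hb'
  refine ⟨hi, (integral_mono_ae hi.norm hg hb').trans ?_⟩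
  rw [integral_const_mul, gint _ hc]
  have h1 := mK_nonneg α
  have h2 := mK_nonneg β
  calc _ ≤ mK α * mK β * (α^(-(1/2):ℝ) * β^(-(1/2):ℝ)) := mul_le_mul_of_nonneg_left (amgm α β ha hb) (by positivity)
    _ = _ := by ring

lemma SK_int : Integrable SK ((volume.restrict (Ioi (0:ℝ))).prod ((volume.restrict (Ioi (0:ℝ))).prod (volume.restrict (Ioi (0:ℝ))))) := by
  rw [integrable_prod_iff' SK_meas.aestronglyMeasurable]
  constructor
  · filter_upwards [pos_ae2] with p hp using (SK_k p.1 p.2 hp.1 hp.2).1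
  · refine Integrable.mono' bd_int (StronglyMeasurable.integral_prod_left' SK_meas.norm.stronglyMeasurable).aestronglyMeasurable ?_
    filter_upwards [pos_ae2] with p hp
    rw [norm_of_nonneg (integral_nonneg fun _ => norm_nonneg _)]
    exact (SK_k p.1 p.2 hp.1 hp.2).2

noncomputable def TK (q : ℝ × (ℝ × ℝ)) : ℝ := q.1 * I0 q.1^2 * (qK q.1 q.2.1 * qK q.1 q.2.2)

lemma TK_meas : Measurable TK := by
  have h1 := K0_meas
  have h2 := I0_cont.measurable
  unfold TK qK; fun_prop

lemma TK_eq (t α β : ℝ) (ha : 0 < α) (hb : 0 < β) : TK (t, (α, β)) = mK α * mK β * exp (-(α+β))/(4*α*β) * (t * I0 t^2 * exp (-(t^2/(4*α)+t^2/(4*β)))) := by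
  unfold TK qK mK
  have e : exp (-(t^2/(4*α)) - 2*α) * exp (-(t^2/(4*β)) - 2*β) = exp (-α) * exp (-β) * exp (-(α+β)) * exp (-(t^2/(4*α)+t^2/(4*β))) := by
    simp only [← Real.exp_add]; congr 1; ring
  calc _ = t * I0 t^2 * (K0 (2*α) * K0 (2*β)) / (4*α*β) * (exp (-(t^2/(4*α)) - 2*α) * exp (-(t^2/(4*β)) - 2*β)) := by
        simp only; field_simp; ring
    _ = _ := by rw [e]; ring

lemma TK_t (α β : ℝ) (ha : 0 < α) (hb : 0 < β) : IntegrableOn (fun t => TK (t, (α, β))) (Ioi 0) ∧ ∫ t in Ioi (0:ℝ), TK (t, (α, β)) = ∫ k in Ioi (0:ℝ), SK (k, (α, β)) := by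
  simp only [TK_eq _ α β ha hb]
  constructor
  · refine Integrable.const_mul ?_ _
    have := I0_int (1/(4*α)+1/(4*β)) (by positivity)
    refine this.congr_fun (fun t _ => ?_) measurableSet_Ioi
    simp only; congr 2; ring
  · rw [integral_const_mul, gauss_eq α β ha hb, ← mul_assoc, ← integral_const_mul]
    congr 1; ext k
    unfold SK XK
    have e : exp (-(α+β)*k^2) = exp (-(α*k^2)) * exp (-(β*k^2)) := by rw [← Real.exp_add]; congr 1; ring
    have e2 : exp (-(α+β)) * exp (α+β) = 1 := by rw [← Real.exp_add, neg_add_cancel, Real.exp_zero]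
    simp only
    rw [e, show 2*α*k = 2*k*α by ring, show 2*β*k = 2*k*β by ring]
    calc _ = (exp (-(α+β)) * exp (α+β)) * (k * (exp (-(α*k^2)) * mK α * Jb (2*k*α) * (exp (-(β*k^2)) * mK β * Jb (2*k*β)))) := by field_simp
      _ = _ := by rw [e2, one_mul]

lemma TK_nonneg (t α β : ℝ) (ht : 0 < t) (ha : 0 < α) (hb : 0 < β) : 0 ≤ TK (t, (α, β)) := by
  have h1 := mK_nonneg α
  have h2 := mK_nonneg β
  rw [TK_eq t α β ha hb]; positivity

lemma TK_int : Integrable TK ((volume.restrict (Ioi (0:ℝ))).prod ((volume.restrict (Ioi (0:ℝ))).prod (volume.restrict (Ioi (0:ℝ))))) := by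
  rw [integrable_prod_iff' TK_meas.aestronglyMeasurable]
  constructor
  · filter_upwards [pos_ae2] with p hp using (TK_t p.1 p.2 hp.1 hp.2).1
  · refine Integrable.mono' bd_int (StronglyMeasurable.integral_prod_left' TK_meas.norm.stronglyMeasurable).aestronglyMeasurable ?_
    filter_upwards [pos_ae2] with p hp
    rw [norm_of_nonneg (integral_nonneg fun _ => norm_nonneg _)]
    have : ∫ t in Ioi (0:ℝ), ‖TK (t, p)‖ = ∫ t in Ioi (0:ℝ), TK (t, p) :=
      setIntegral_congr_fun measurableSet_Ioi fun t ht => norm_of_nonneg (TK_nonneg t p.1 p.2 ht hp.1 hp.2)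
    rw [this, (TK_t p.1 p.2 hp.1 hp.2).2]
    exact (le_abs_self _).trans ((norm_integral_le_integral_norm _).trans (SK_k p.1 p.2 hp.1 hp.2).2)

lemma IKM_F3 : ∫ t in Ioi (0:ℝ), (I0 t)^2 * (K0 t)^4 * t = ∫ k in Ioi (0:ℝ), k * F3 (k^2)^2 := by
  have h1 : ∫ t in Ioi (0:ℝ), (I0 t)^2 * (K0 t)^4 * t = ∫ q, TK q ∂((volume.restrict (Ioi (0:ℝ))).prod ((volume.restrict (Ioi (0:ℝ))).prod (volume.restrict (Ioi (0:ℝ))))) := by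
    rw [integral_prod _ TK_int]
    refine setIntegral_congr_fun measurableSet_Ioi fun t ht => ?_
    simp only [TK]
    rw [integral_const_mul, integral_prod_mul (qK t) (qK t), ← K0sq t ht]; ring
  have h2 : ∫ k in Ioi (0:ℝ), k * F3 (k^2)^2 = ∫ q, SK q ∂((volume.restrict (Ioi (0:ℝ))).prod ((volume.restrict (Ioi (0:ℝ))).prod (volume.restrict (Ioi (0:ℝ))))) := by
    rw [integral_prod _ SK_int]
    congr 1; ext k
    simp only [SK]
    rw [integral_const_mul, integral_prod_mul (XK k) (XK k), XK_int]; ring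
  rw [h1, h2, integral_prod_symm _ TK_int, integral_prod_symm _ SK_int]
  refine integral_congr_ae ?_
  filter_upwards [pos_ae2] with p hp using (TK_t p.1 p.2 hp.1 hp.2).2

lemma IKM_pf : ∫ t in Ioi (0:ℝ), (I0 t)^2 * (K0 t)^4 * t = π^2/36 * ∫ r in Ioo (0:ℝ) 2, pf r^2 := by
  have hpi := pi_pos
  rw [IKM_F3, cov (Ioi 0) (Ioo 0 2) measurableSet_Ioi (fun k => 2*k^2/(3+k^2)) (fun k => 12*k/(3+k^2)^2) (fun r => √(3*r/(2-r))), ← integral_const_mul]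
  · refine setIntegral_congr_fun measurableSet_Ioi fun k hk => ?_
    have hk : 0 < k := hk
    have hs : √3^2 = (3:ℝ) := Real.sq_sqrt (by norm_num)
    rw [F3_eq _ (by nlinarith), abs_of_pos (by positivity), mul_pow, div_pow, hs, mul_pow]
    field_simp; ring
  · intro k _
    have h3 : 3 + k^2 ≠ 0 := by positivity
    refine ((((hasDerivAt_id k).pow 2).const_mul 2).div (((hasDerivAt_id k).pow 2).const_add 3) h3).congr_deriv ?_
    simp only [id, Pi.pow_apply]; norm_num; congr 1; ring
  · intro k hk
    have hk : 0 < k := hk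
    exact ⟨by positivity, by rw [div_lt_iff₀ (by positivity)]; linarith⟩
  · intro r hr
    have := hr.1
    have : 0 < 2 - r := by linarith [hr.2]
    exact mem_Ioi.mpr (Real.sqrt_pos.mpr (by positivity))
  · intro k hk
    have hk : 0 < k := hk
    rw [show 3*(2*k^2/(3+k^2))/(2-2*k^2/(3+k^2)) = k^2 by
      rw [show 2-2*k^2/(3+k^2) = 6/(3+k^2) by field_simp; ring]; field_simp; ring, Real.sqrt_sq hk.le]
  · intro r hr
    have h1 := hr.1
    have h2 : 0 < 2 - r := by linarith [hr.2]
    rw [Real.sq_sqrt (by positivity)]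
    rw [show 3+3*r/(2-r) = 6/(2-r) by field_simp; ring]; field_simp; ring

lemma claim1 : ∫ t in Ioi (0:ℝ), (I0 t)^2 * (K0 t)^4 * t = (π^2/10) * pFq [1/3, 1/2, 1/2, 2/3] [5/6, 1, 7/6] 1 := by
  rw [IKM_pf, Z_h, ← h_int, intervalIntegral.integral_of_le zero_le_one, integral_Ioc_eq_integral_Ioo]; ring

theorem IKM241_hypergeometric :
    (∫ t in Ioi (0:ℝ), (I0 t)^2 * (K0 t)^4 * t)
      = (π^2/10) * pFq [1/3, 1/2, 1/2, 2/3] [5/6, 1, 7/6] 1 ∧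
    (∫ t in Ioi (0:ℝ), (I0 t)^2 * (K0 t)^4 * t)
      = (3 * π ^ ((3:ℝ)/2) / 20) *
          ((Real.sqrt 3 / 64) * (Gamma (1/3) / Real.sqrt π)^9 *
              pFq [1/6, 1/3, 1/3, 1/2] [2/3, 5/6, 5/6] 1
            + (16/3) * (Real.sqrt π / Gamma (1/3))^9 *
              pFq [1/2, 2/3, 2/3, 5/6] [7/6, 7/6, 4/3] 1) :=
  ⟨claim1, claim1.trans claim2_of⟩
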